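/- arXiv:1409.1821 — 3 statements merged into one kernel-verified Lean document; each statement's English description precedes it below -/
import Mathlib

section
/- Let k be an algebraically closed field of characteristic p > 0 and let C_p denote the cyclic group of order p. Let A and B be indecomposable, non-semisimple finite-dimensional k-algebras which are stably equivalent of Morita type. If the tensor product algebras A ⊗_k kC_p and B ⊗_k kC_p are stably equivalent of Morita type, then A and B have the same number of isomorphism classes of non-projective simple modules. -/
set_option synthInstance.maxHeartbeats 1000000
set_option maxHeartbeats 1000000

universe u v w

open TensorProduct MulOpposite in
/-- The subgroup of relations defining the tensor product `M ⊗_B N` over `B` inside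
`M ⊗_ℤ N`, where `M` is an `(A,B)`-bimodule and `N` a `(B,C)`-bimodule (bimodules are
modules over the corresponding enveloping algebras `A ⊗ₖ Bᵒᵖ`, resp. `B ⊗ₖ Cᵒᵖ`). -/
noncomputable def balancedRel (k A B C : Type*) [Field k] [Ring A] [Ring B] [Ring C]
    [Algebra k A] [Algebra k B] [Algebra k C]
    (M N : Type*) [AddCommGroup M] [AddCommGroup N]
    [Module (A ⊗[k] Bᵐᵒᵖ) M] [Module (B ⊗[k] Cᵐᵒᵖ) N] : Submodule ℤ (M ⊗[ℤ] N) :=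
  Submodule.span ℤ
    {x | ∃ (m : M) (b : B) (n : N),
      x = ((((1 : A) ⊗ₜ[k] op b) • m) ⊗ₜ[ℤ] n) - (m ⊗ₜ[ℤ] ((b ⊗ₜ[k] (1 : Cᵐᵒᵖ)) • n))}

open TensorProduct MulOpposite in
/-- The tensor product `M ⊗_B N` over `B` of an `(A,B)`-bimodule `M` and a
`(B,C)`-bimodule `N`, realized as the quotient of `M ⊗_ℤ N` by the balancing
relations. -/
noncomputable abbrev OverTensor (k A B C : Type*) [Field k] [Ring A] [Ring B] [Ring C]
    [Algebra k A] [Algebra k B] [Algebra k C]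
    (M N : Type*) [AddCommGroup M] [AddCommGroup N]
    [Module (A ⊗[k] Bᵐᵒᵖ) M] [Module (B ⊗[k] Cᵐᵒᵖ) N] :=
  (M ⊗[ℤ] N) ⧸ balancedRel k A B C M N

open TensorProduct MulOpposite in
/-- A witness for a stable equivalence of Morita type between `k`-algebras `A` and `B`
(Broué): bimodules `AMB` and `BNA`, projective as one-sided modules on either side,
together with bimodule isomorphisms `M ⊗_B N ≅ A ⊕ P` and `N ⊗_A M ≅ B ⊕ Q`, where `P`
and `Q` are projective bimodules.  Bimodules are modules over the enveloping algebras,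
and the bimodule isomorphisms are encoded as additive isomorphisms which are equivariant
for the left and right actions (stated on generators of the tensor products). -/
structure StableMoritaWitness (k : Type u) (A : Type v) (B : Type w)
    [Field k] [Ring A] [Ring B] [Algebra k A] [Algebra k B] where
  M : Type (max u v w)
  N : Type (max u v w)
  P : Type (max u v w)
  Q : Type (max u v w)
  [addM : AddCommGroup M]
  [addN : AddCommGroup N]
  [addP : AddCommGroup P]
  [addQ : AddCommGroup Q]
  [modM : Module (A ⊗[k] Bᵐᵒᵖ) M]
  [modN : Module (B ⊗[k] Aᵐᵒᵖ) N]
  [modP : Module (A ⊗[k] Aᵐᵒᵖ) P]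
  [modQ : Module (B ⊗[k] Bᵐᵒᵖ) Q]
  projM_left :
    letI : Module A M :=
      Module.compHom M (Algebra.TensorProduct.includeLeftRingHom (R := k) (A := A) (B := Bᵐᵒᵖ))
    Module.Projective A M
  projM_right :
    letI : Module Bᵐᵒᵖ M :=
      Module.compHom M (Algebra.TensorProduct.includeRight (R := k) (A := A) (B := Bᵐᵒᵖ)).toRingHom
    Module.Projective Bᵐᵒᵖ M
  projN_left :
    letI : Module B N :=
      Module.compHom N (Algebra.TensorProduct.includeLeftRingHom (R := k) (A := B) (B := Aᵐᵒᵖ))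
    Module.Projective B N
  projN_right :
    letI : Module Aᵐᵒᵖ N :=
      Module.compHom N (Algebra.TensorProduct.includeRight (R := k) (A := B) (B := Aᵐᵒᵖ)).toRingHom
    Module.Projective Aᵐᵒᵖ N
  projP : Module.Projective (A ⊗[k] Aᵐᵒᵖ) P
  projQ : Module.Projective (B ⊗[k] Bᵐᵒᵖ) Q
  theta : OverTensor k A B A M N ≃+ A × P
  theta_left : ∀ (a : A) (m : M) (n : N),
    theta (Submodule.Quotient.mk (((a ⊗ₜ[k] (1 : Bᵐᵒᵖ)) • m) ⊗ₜ[ℤ] n)) =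
      (a * (theta (Submodule.Quotient.mk (m ⊗ₜ[ℤ] n))).1,
        (a ⊗ₜ[k] (1 : Aᵐᵒᵖ)) • (theta (Submodule.Quotient.mk (m ⊗ₜ[ℤ] n))).2)
  theta_right : ∀ (a : A) (m : M) (n : N),
    theta (Submodule.Quotient.mk (m ⊗ₜ[ℤ] (((1 : B) ⊗ₜ[k] op a) • n))) =
      ((theta (Submodule.Quotient.mk (m ⊗ₜ[ℤ] n))).1 * a,
        ((1 : A) ⊗ₜ[k] op a) • (theta (Submodule.Quotient.mk (m ⊗ₜ[ℤ] n))).2)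
  eta : OverTensor k B A B N M ≃+ B × Q
  eta_left : ∀ (b : B) (n : N) (m : M),
    eta (Submodule.Quotient.mk (((b ⊗ₜ[k] (1 : Aᵐᵒᵖ)) • n) ⊗ₜ[ℤ] m)) =
      (b * (eta (Submodule.Quotient.mk (n ⊗ₜ[ℤ] m))).1,
        (b ⊗ₜ[k] (1 : Bᵐᵒᵖ)) • (eta (Submodule.Quotient.mk (n ⊗ₜ[ℤ] m))).2)
  eta_right : ∀ (b : B) (n : N) (m : M),
    eta (Submodule.Quotient.mk (n ⊗ₜ[ℤ] (((1 : A) ⊗ₜ[k] op b) • m))) =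
      ((eta (Submodule.Quotient.mk (n ⊗ₜ[ℤ] m))).1 * b,
        ((1 : B) ⊗ₜ[k] op b) • (eta (Submodule.Quotient.mk (n ⊗ₜ[ℤ] m))).2)

/-- Two `k`-algebras are *stably equivalent of Morita type* if there is a witness as
above. -/
def IsStablyEquivalentOfMoritaType (k : Type u) (A : Type v) (B : Type w)
    [Field k] [Ring A] [Ring B] [Algebra k A] [Algebra k B] : Prop :=
  Nonempty (StableMoritaWitness k A B)

/-- The isomorphism classes of non-projective simple modules over a ring `R`.  Every
simple left `R`-module is isomorphic to a quotient `R ⧸ I` by a maximal left ideal `I`,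
so these classes form the quotient of the set of maximal left ideals `I` with `R ⧸ I`
non-projective, identifying ideals with isomorphic quotients. -/
def NonProjSimpleClasses (R : Type*) [Ring R] : Type _ :=
  Quot (fun (I J : {I : Ideal R // IsCoatom I ∧ ¬ Module.Projective R (R ⧸ (I : Ideal R))}) =>
    Nonempty ((R ⧸ (I : Ideal R)) ≃ₗ[R] (R ⧸ (J : Ideal R))))

/-- A `k`-algebra is indecomposable if it is nonzero and has no central idempotents
other than `0` and `1`. -/
def IsIndecomposableAlgebra (A : Type*) [Ring A] : Prop :=
  Nontrivial A ∧ ∀ e : A, IsIdempotentElem e → e ∈ Set.center A → e = 0 ∨ e = 1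

section

open MulOpposite

section RelTensor

/-- The relations defining the tensor product of a right and a left module. -/
def relTensorRel (R N Y : Type*) [Ring R] [AddCommGroup N] [Module Rᵐᵒᵖ N]
    [AddCommGroup Y] [Module R Y] : Submodule ℤ (TensorProduct ℤ N Y) :=
  Submodule.span ℤ {x | ∃ (n : N) (r : R) (y : Y),
    x = TensorProduct.tmul ℤ (op r • n) y - TensorProduct.tmul ℤ n (r • y)}

/-- The tensor product of a right module `N` and a left module `Y` over a ring `R`. -/
def RelTensor (R N Y : Type*) [Ring R] [AddCommGroup N] [Module Rᵐᵒᵖ N]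
    [AddCommGroup Y] [Module R Y] := TensorProduct ℤ N Y ⧸ relTensorRel R N Y

namespace RelTensor

instance (R N Y : Type*) [Ring R] [AddCommGroup N] [Module Rᵐᵒᵖ N]
    [AddCommGroup Y] [Module R Y] : AddCommGroup (RelTensor R N Y) :=
  inferInstanceAs (AddCommGroup (TensorProduct ℤ N Y ⧸ relTensorRel R N Y))

variable {R N Y Z S : Type*} [Ring R] [AddCommGroup N] [Module Rᵐᵒᵖ N]
    [AddCommGroup Y] [Module R Y] [AddCommGroup Z]

/-- The pure tensor `n ⊗ y`. -/
def tm (R : Type*) {N Y : Type*} [Ring R] [AddCommGroup N] [Module Rᵐᵒᵖ N]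
    [AddCommGroup Y] [Module R Y] (n : N) (y : Y) : RelTensor R N Y :=
  Submodule.Quotient.mk (p := relTensorRel R N Y) (TensorProduct.tmul ℤ n y)

theorem tm_add (n : N) (y y' : Y) : tm R n (y + y') = tm R n y + tm R n y' := by
  simp only [tm, TensorProduct.tmul_add]; rfl

theorem add_tm (n n' : N) (y : Y) : tm R (n + n') y = tm R n y + tm R n' y := by
  simp only [tm, TensorProduct.add_tmul]; rfl

@[simp] theorem tm_zero (n : N) : tm R n (0 : Y) = 0 := by
  simp only [tm, TensorProduct.tmul_zero]; rfl

@[simp] theorem zero_tm (y : Y) : tm R (0 : N) y = 0 := by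
  simp only [tm, TensorProduct.zero_tmul]; rfl

theorem tm_smul (n : N) (r : R) (y : Y) : tm R n (r • y) = tm R (op r • n) y := by
  symm
  refine (Submodule.Quotient.eq _).2 (Submodule.subset_span ⟨n, r, y, rfl⟩)

/-- `tm` as a biadditive map. -/
def tmHom (R N Y : Type*) [Ring R] [AddCommGroup N] [Module Rᵐᵒᵖ N]
    [AddCommGroup Y] [Module R Y] : N →+ Y →+ RelTensor R N Y :=
  AddMonoidHom.mk' (fun n => AddMonoidHom.mk' (tm R n) (tm_add n))
    (fun n n' => by ext y; exact add_tm n n' y)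

theorem tm_sum {ι : Type*} (s : Finset ι) (n : N) (y : ι → Y) :
    tm R n (∑ i ∈ s, y i) = ∑ i ∈ s, tm R n (y i) :=
  map_sum (tmHom R N Y n) y s

theorem sum_tm {ι : Type*} (s : Finset ι) (n : ι → N) (y : Y) :
    tm R (∑ i ∈ s, n i) y = ∑ i ∈ s, tm R (n i) y :=
  map_sum ((tmHom R N Y).flip y) n s

/-- The universal property. -/
def lift (f : N →+ Y →+ Z) (hf : ∀ (r : R) n y, f (op r • n) y = f n (r • y)) :
    RelTensor R N Y →+ Z :=
  ((relTensorRel R N Y).liftQ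
    (TensorProduct.liftAddHom f (fun r n y => by simp)).toIntLinearMap (by
      rw [relTensorRel, Submodule.span_le]
      rintro _ ⟨n, r, y, rfl⟩
      simp [hf])).toAddMonoidHom

@[simp] theorem lift_tm (f : N →+ Y →+ Z) (hf) (n : N) (y : Y) :
    lift (R := R) f hf (tm R n y) = f n y :=
  rfl

theorem exists_sum (t : RelTensor R N Y) :
    ∃ (r : ℕ) (n : Fin r → N) (y : Fin r → Y), t = ∑ i, tm R (n i) (y i) := by
  obtain ⟨t, rfl⟩ := Submodule.Quotient.mk_surjective _ t
  induction t using TensorProduct.induction_on with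
  | zero => exact ⟨0, 0, 0, by simp; rfl⟩
  | tmul n y => exact ⟨1, fun _ => n, fun _ => y, by simp; rfl⟩
  | add a b ha hb =>
    obtain ⟨r, n, y, h⟩ := ha
    obtain ⟨r', n', y', h'⟩ := hb
    refine ⟨r + r', Fin.append n n', Fin.append y y', ?_⟩
    rw [Fin.sum_univ_add]
    simp only [Fin.append_left, Fin.append_right, ← h, ← h']
    rfl

theorem induct {p : RelTensor R N Y → Prop} (t : RelTensor R N Y) (h0 : p 0)
    (ht : ∀ n y, p (tm R n y)) (ha : ∀ a b, p a → p b → p (a + b)) : p t := by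
  obtain ⟨r, n, y, rfl⟩ := exists_sum t
  exact Finset.sum_induction _ p ha h0 (fun i _ => ht _ _)

theorem hom_ext {F : Type*} [FunLike F (RelTensor R N Y) Z] [AddMonoidHomClass F (RelTensor R N Y) Z]
    {f g : F} (h : ∀ n y, f (tm R n y) = g (tm R n y)) : f = g := by
  refine DFunLike.ext _ _ fun t => ?_
  induction t using induct with
  | h0 => simp
  | ht n y => exact h n y
  | ha a b ha hb => simp [ha, hb]

section Module

variable [Ring S] [Module S N] [SMulCommClass S Rᵐᵒᵖ N]

/-- Multiplication by `s` on the tensor product. -/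
def smulHom (s : S) : RelTensor R N Y →+ RelTensor R N Y :=
  lift ((tmHom R N Y).comp (DistribSMul.toAddMonoidHom N s)) (fun r n y => by
    simp only [tmHom, AddMonoidHom.comp_apply, DistribSMul.toAddMonoidHom_apply,
      AddMonoidHom.mk'_apply]
    rw [tm_smul, smul_comm])

@[simp] theorem smulHom_tm (s : S) (n : N) (y : Y) :
    smulHom s (tm R n y) = tm R (s • n) y := by
  simp [smulHom, tmHom]

/-- The left module structure on the tensor product. -/
instance instMod : Module S (RelTensor R N Y) where
  smul s t := smulHom s t
  one_smul t := by
    change smulHom 1 t = AddMonoidHom.id _ t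
    congr 1
    exact hom_ext (by simp)
  mul_smul a b t := by
    change smulHom (a * b) t = ((smulHom a).comp (smulHom b)) t
    congr 1
    exact hom_ext (by simp [mul_smul])
  smul_zero s := map_zero (smulHom s)
  smul_add s := map_add (smulHom s)
  add_smul a b t := by
    change smulHom (a + b) t = (smulHom a + smulHom b : RelTensor R N Y →+ RelTensor R N Y) t
    congr 1
    exact hom_ext (by simp [add_smul, add_tm])
  zero_smul t := by
    change smulHom (0 : S) t = (0 : RelTensor R N Y →+ RelTensor R N Y) t
    congr 1
    exact hom_ext (by simp)

@[simp] theorem smul_tm (s : S) (n : N) (y : Y) : s • tm R n y = tm R (s • n) y :=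
  smulHom_tm s n y

/-- The universal property for linear maps. -/
def liftL [Module S Z] (f : N →+ Y →+ Z) (hf : ∀ (r : R) n y, f (op r • n) y = f n (r • y))
    (hs : ∀ (s : S) n y, f (s • n) y = s • f n y) : RelTensor R N Y →ₗ[S] Z where
  __ := lift f hf
  map_smul' s t := by
    change lift f hf (s • t) = s • lift f hf t
    induction t using induct with
    | h0 => simp
    | ht n y => simp [hs]
    | ha a b ha hb => simp only [smul_add, map_add, ha, hb]

@[simp] theorem liftL_tm [Module S Z] (f : N →+ Y →+ Z) (hf)
    (hs : ∀ (s : S) n y, f (s • n) y = s • f n y) (n : N) (y : Y) :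
    liftL (R := R) f hf hs (tm R n y) = f n y :=
  lift_tm f hf n y

variable {Y' Y'' : Type*} [AddCommGroup Y'] [Module R Y'] [AddCommGroup Y''] [Module R Y'']

/-- Functoriality of the tensor product. -/
def map (S : Type*) [Ring S] (N : Type*) [AddCommGroup N] [Module Rᵐᵒᵖ N] [Module S N]
    [SMulCommClass S Rᵐᵒᵖ N] (f : Y →ₗ[R] Y') : RelTensor R N Y →ₗ[S] RelTensor R N Y' :=
  liftL (AddMonoidHom.mk' (fun n => (tmHom R N Y' n).comp f.toAddMonoidHom)
    (fun n n' => by ext; simp [tmHom, add_tm]))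
    (fun r n y => by simp [tmHom, tm_smul])
    (fun s n y => by simp [tmHom])

@[simp] theorem map_tm (f : Y →ₗ[R] Y') (n : N) (y : Y) :
    map S N f (tm R n y) = tm R n (f y) := by
  simp [map, tmHom]

theorem map_id : map S N (LinearMap.id : Y →ₗ[R] Y) = LinearMap.id :=
  hom_ext (by simp)

theorem map_comp (g : Y' →ₗ[R] Y'') (f : Y →ₗ[R] Y') :
    map S N (g ∘ₗ f) = map S N g ∘ₗ map S N f :=
  hom_ext (by simp)

theorem map_add (g f : Y →ₗ[R] Y') : map S N (g + f) = map S N g + map S N f :=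
  hom_ext (by simp [tm_add])

theorem map_sub (g f : Y →ₗ[R] Y') : map S N (g - f) = map S N g - map S N f := by
  rw [eq_sub_iff_add_eq, ← map_add, sub_add_cancel]

theorem map_surjective {f : Y →ₗ[R] Y'} (hf : Function.Surjective f) :
    Function.Surjective (map S N f) := by
  intro t
  induction t using induct with
  | h0 => exact ⟨0, by simp⟩
  | ht n y =>
    obtain ⟨y, rfl⟩ := hf y
    exact ⟨tm R n y, by simp⟩
  | ha a b ha hb =>
    obtain ⟨a, rfl⟩ := ha
    obtain ⟨b, rfl⟩ := hb
    exact ⟨a + b, by simp⟩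

end Module

end RelTensor
end RelTensor

end

section

open MulOpposite

section Bimodule

open TensorProduct

variable (k A B X : Type*) [Field k] [Ring A] [Ring B] [Algebra k A] [Algebra k B]
  [AddCommGroup X] [Module (A ⊗[k] Bᵐᵒᵖ) X]

/-- The left module structure of a bimodule. -/
abbrev bimoduleLeft : Module A X :=
  Module.compHom X (Algebra.TensorProduct.includeLeftRingHom (R := k) (A := A) (B := Bᵐᵒᵖ))

/-- The right module structure of a bimodule. -/
abbrev bimoduleRight : Module Bᵐᵒᵖ X :=
  Module.compHom X (Algebra.TensorProduct.includeRight (R := k) (A := A) (B := Bᵐᵒᵖ)).toRingHom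

/-- The underlying vector space of a bimodule. -/
abbrev bimoduleBase : Module k X :=
  Module.compHom X (algebraMap k (A ⊗[k] Bᵐᵒᵖ))

theorem bimodule_smulCommClass :
    letI := bimoduleLeft k A B X
    letI := bimoduleRight k A B X
    SMulCommClass A Bᵐᵒᵖ X := by
  let := bimoduleLeft k A B X
  let := bimoduleRight k A B X
  refine ⟨fun a b x => ?_⟩
  change (a ⊗ₜ[k] (1 : Bᵐᵒᵖ)) • ((1 : A) ⊗ₜ[k] b) • x = ((1 : A) ⊗ₜ[k] b) • (a ⊗ₜ[k] (1 : Bᵐᵒᵖ)) • x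
  simp [smul_smul]

theorem bimodule_isScalarTower_left :
    letI := bimoduleLeft k A B X
    letI := bimoduleBase k A B X
    IsScalarTower k A X := by
  let := bimoduleLeft k A B X
  let := bimoduleBase k A B X
  refine ⟨fun c a x => ?_⟩
  change ((c • a) ⊗ₜ[k] (1 : Bᵐᵒᵖ)) • x = (algebraMap k (A ⊗[k] Bᵐᵒᵖ) c) • (a ⊗ₜ[k] (1 : Bᵐᵒᵖ)) • x
  rw [smul_smul, Algebra.algebraMap_eq_smul_one, smul_one_mul, TensorProduct.smul_tmul']

theorem bimodule_isScalarTower_right :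
    letI := bimoduleRight k A B X
    letI := bimoduleBase k A B X
    IsScalarTower k Bᵐᵒᵖ X := by
  let := bimoduleRight k A B X
  let := bimoduleBase k A B X
  refine ⟨fun c b x => ?_⟩
  change ((1 : A) ⊗ₜ[k] (c • b)) • x = (algebraMap k (A ⊗[k] Bᵐᵒᵖ) c) • ((1 : A) ⊗ₜ[k] b) • x
  rw [smul_smul, Algebra.algebraMap_eq_smul_one, smul_one_mul, TensorProduct.tmul_smul]

end Bimodule

namespace StableMoritaWitness

open TensorProduct

variable {k A B : Type u} [Field k] [Ring A] [Ring B] [Algebra k A] [Algebra k B]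
  (W : StableMoritaWitness k A B)

instance : AddCommGroup W.M := W.addM
instance : AddCommGroup W.N := W.addN
instance : AddCommGroup W.P := W.addP
instance : AddCommGroup W.Q := W.addQ
instance instModEnvM : Module (A ⊗[k] Bᵐᵒᵖ) W.M := W.modM
instance instModEnvN : Module (B ⊗[k] Aᵐᵒᵖ) W.N := W.modN
instance instModEnvP : Module (A ⊗[k] Aᵐᵒᵖ) W.P := W.modP
instance instModEnvQ : Module (B ⊗[k] Bᵐᵒᵖ) W.Q := W.modQ
instance instLeftM : Module A W.M := bimoduleLeft k A B W.M
instance instRightM : Module Bᵐᵒᵖ W.M := bimoduleRight k A B W.M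
instance instBaseM : Module k W.M := bimoduleBase k A B W.M
instance instLeftN : Module B W.N := bimoduleLeft k B A W.N
instance instRightN : Module Aᵐᵒᵖ W.N := bimoduleRight k B A W.N
instance instBaseN : Module k W.N := bimoduleBase k B A W.N
instance instLeftP : Module A W.P := bimoduleLeft k A A W.P
instance instRightP : Module Aᵐᵒᵖ W.P := bimoduleRight k A A W.P
instance instBaseP : Module k W.P := bimoduleBase k A A W.P
instance instLeftQ : Module B W.Q := bimoduleLeft k B B W.Q
instance instRightQ : Module Bᵐᵒᵖ W.Q := bimoduleRight k B B W.Q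
instance instBaseQ : Module k W.Q := bimoduleBase k B B W.Q
instance : SMulCommClass A Bᵐᵒᵖ W.M := bimodule_smulCommClass k A B W.M
instance : SMulCommClass B Aᵐᵒᵖ W.N := bimodule_smulCommClass k B A W.N
instance : SMulCommClass A Aᵐᵒᵖ W.P := bimodule_smulCommClass k A A W.P
instance : SMulCommClass B Bᵐᵒᵖ W.Q := bimodule_smulCommClass k B B W.Q
instance : IsScalarTower k A W.M := bimodule_isScalarTower_left k A B W.M
instance : IsScalarTower k Bᵐᵒᵖ W.M := bimodule_isScalarTower_right k A B W.M
instance : IsScalarTower k B W.N := bimodule_isScalarTower_left k B A W.N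
instance : IsScalarTower k Aᵐᵒᵖ W.N := bimodule_isScalarTower_right k B A W.N
instance : IsScalarTower k A W.P := bimodule_isScalarTower_left k A A W.P
instance : IsScalarTower k Aᵐᵒᵖ W.P := bimodule_isScalarTower_right k A A W.P
instance : IsScalarTower k B W.Q := bimodule_isScalarTower_left k B B W.Q
instance : IsScalarTower k Bᵐᵒᵖ W.Q := bimodule_isScalarTower_right k B B W.Q
instance : Module.Projective A W.M := W.projM_left
instance : Module.Projective Bᵐᵒᵖ W.M := W.projM_right
instance : Module.Projective B W.N := W.projN_left
instance : Module.Projective Aᵐᵒᵖ W.N := W.projN_right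
instance : Module.Projective (A ⊗[k] Aᵐᵒᵖ) W.P := W.projP
instance : Module.Projective (B ⊗[k] Bᵐᵒᵖ) W.Q := W.projQ

/-- Exchanging the two algebras. -/
@[reducible] def symm : StableMoritaWitness k B A where
  M := W.N
  N := W.M
  P := W.Q
  Q := W.P
  projM_left := W.projN_left
  projM_right := W.projN_right
  projN_left := W.projM_left
  projN_right := W.projM_right
  projP := W.projQ
  projQ := W.projP
  theta := W.eta
  theta_left := W.eta_left
  theta_right := W.eta_right
  eta := W.theta
  eta_left := W.theta_left
  eta_right := W.theta_right

/-- `theta` in terms of `RelTensor`. -/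
noncomputable def th : RelTensor B W.M W.N ≃+ A × W.P := W.theta

theorem th_left (a : A) (m : W.M) (n : W.N) :
    W.th (RelTensor.tm B (a • m) n) = a • W.th (RelTensor.tm B m n) :=
  W.theta_left a m n

theorem th_right (a : A) (m : W.M) (n : W.N) :
    W.th (RelTensor.tm B m (op a • n)) = op a • W.th (RelTensor.tm B m n) :=
  W.theta_right a m n

theorem th_smul (a : A) (t : RelTensor B W.M W.N) : W.th (a • t) = a • W.th t := by
  induction t using RelTensor.induct with
  | h0 => simp
  | ht m n => rw [RelTensor.smul_tm, th_left]
  | ha x y hx hy => rw [smul_add, map_add, hx, hy, map_add, smul_add]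

/-- `th` as a linear equivalence. -/
noncomputable def thL : RelTensor B W.M W.N ≃ₗ[A] A × W.P where
  __ := W.th
  map_smul' := W.th_smul

/-- The pairing `M × N → A`. -/
noncomputable def ang : W.M →ₗ[k] W.N →ₗ[k] A :=
  LinearMap.mk₂ k (fun m n => (W.th (RelTensor.tm B m n)).1)
    (fun m m' n => by simp [RelTensor.add_tm])
    (fun c m n => by
      rw [← algebraMap_smul A c m, th_left, Prod.smul_fst, algebraMap_smul])
    (fun m n n' => by simp [RelTensor.tm_add])
    (fun c m n => by
      rw [← algebraMap_smul Aᵐᵒᵖ c n, MulOpposite.algebraMap_apply, th_right, Prod.smul_fst,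
        op_smul_eq_mul, ← Algebra.commutes, ← Algebra.smul_def])

theorem ang_smul (a : A) (m : W.M) (n : W.N) : W.ang (a • m) n = a * W.ang m n := by
  simp [ang, th_left]

theorem ang_op_smul (a : A) (m : W.M) (n : W.N) : W.ang m (op a • n) = W.ang m n * a := by
  simp [ang, th_right]

theorem ang_bal (b : B) (m : W.M) (n : W.N) : W.ang (op b • m) n = W.ang m (b • n) := by
  simp [ang, RelTensor.tm_smul]

/-- The pairing `M × N → P`. -/
noncomputable def angP : W.M →ₗ[k] W.N →ₗ[k] W.P :=
  LinearMap.mk₂ k (fun m n => (W.th (RelTensor.tm B m n)).2)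
    (fun m m' n => by simp [RelTensor.add_tm])
    (fun c m n => by
      rw [← algebraMap_smul A c m, th_left, Prod.smul_snd, algebraMap_smul])
    (fun m n n' => by simp [RelTensor.tm_add])
    (fun c m n => by
      rw [← algebraMap_smul Aᵐᵒᵖ c n, MulOpposite.algebraMap_apply, th_right, Prod.smul_snd,
        ← MulOpposite.algebraMap_apply, algebraMap_smul])

theorem angP_smul (a : A) (m : W.M) (n : W.N) : W.angP (a • m) n = a • W.angP m n := by
  simp [angP, th_left]

theorem angP_op_smul (a : A) (m : W.M) (n : W.N) : W.angP m (op a • n) = op a • W.angP m n := by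
  simp [angP, th_right]

theorem angP_bal (b : B) (m : W.M) (n : W.N) : W.angP (op b • m) n = W.angP m (b • n) := by
  simp [angP, RelTensor.tm_smul]

theorem th_tm (m : W.M) (n : W.N) : W.th (RelTensor.tm B m n) = (W.ang m n, W.angP m n) := rfl

theorem exists_me : ∃ (r : ℕ) (mn : Fin r → W.M × W.N),
    W.th.symm (1, 0) = ∑ i, RelTensor.tm B (mn i).1 (mn i).2 := by
  obtain ⟨r, m, n, h⟩ := RelTensor.exists_sum (W.th.symm (1, 0))
  exact ⟨r, fun i => (m i, n i), h⟩

/-- The number of terms in a chosen preimage of `1`. -/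
noncomputable def r : ℕ := W.exists_me.choose
/-- The left components of a chosen preimage of `1`. -/
noncomputable def me (i : Fin W.r) : W.M := (W.exists_me.choose_spec.choose i).1
/-- The right components of a chosen preimage of `1`. -/
noncomputable def ne (i : Fin W.r) : W.N := (W.exists_me.choose_spec.choose i).2

theorem sum_tm_me : ∑ i, RelTensor.tm B (W.me i) (W.ne i) = W.th.symm (1, 0) :=
  W.exists_me.choose_spec.choose_spec.symm

theorem th_sum_me : ∑ i, W.th (RelTensor.tm B (W.me i) (W.ne i)) = (1, 0) := by
  rw [← map_sum, sum_tm_me, AddEquiv.apply_symm_apply]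

theorem sum_ang : ∑ i, W.ang (W.me i) (W.ne i) = 1 := by
  have := congrArg Prod.fst W.th_sum_me
  simpa [th_tm, Prod.fst_sum] using this

theorem sum_tm_central (a : A) :
    ∑ i, RelTensor.tm B (a • W.me i) (W.ne i) = ∑ i, RelTensor.tm B (W.me i) (op a • W.ne i) := by
  apply W.th.injective
  rw [map_sum, map_sum]
  simp_rw [th_left, th_right]
  rw [← Finset.smul_sum, ← Finset.smul_sum, th_sum_me]
  simp

theorem sum_central {Z : Type*} [AddCommGroup Z] (f : W.M →+ W.N →+ Z)
    (hf : ∀ (b : B) m n, f (op b • m) n = f m (b • n)) (a : A) :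
    ∑ i, f (a • W.me i) (W.ne i) = ∑ i, f (W.me i) (op a • W.ne i) := by
  have := congrArg (RelTensor.lift f hf) (W.sum_tm_central a)
  simpa [map_sum] using this

theorem sum_tm_smul (a : A) :
    ∑ i, RelTensor.tm B (a • W.me i) (W.ne i) = W.th.symm (a, 0) := by
  apply W.th.injective
  rw [map_sum]
  simp_rw [th_left]
  rw [← Finset.smul_sum, th_sum_me]
  simp

end StableMoritaWitness

end

section

section Trace

variable {k M V V' ι κ : Type*} [Field k] [AddCommGroup M] [Module k M]
  [AddCommGroup V] [Module k V] [FiniteDimensional k V]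
  [AddCommGroup V'] [Module k V'] [FiniteDimensional k V'] [Fintype ι] [Fintype κ]

theorem sum_trace_eq_trace_codRestrict (θ : ι → M →ₗ[k] V) (j : ι → V →ₗ[k] M)
    (E : Submodule k M) [FiniteDimensional k E] (hE : ∀ i v, j i v ∈ E) :
    ∑ i, LinearMap.trace k V (θ i ∘ₗ j i) =
      LinearMap.trace k E (∑ i, (j i).codRestrict E (hE i) ∘ₗ θ i ∘ₗ E.subtype) := by
  rw [map_sum]
  refine Finset.sum_congr rfl fun i _ => ?_
  exact (LinearMap.trace_comp_comm' ((j i).codRestrict E (hE i)) (θ i ∘ₗ E.subtype))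

/-- Two finite-rank factorizations of the same endomorphism have the same trace. -/
theorem sum_trace_eq_of_sum_comp_eq (θ : ι → M →ₗ[k] V) (j : ι → V →ₗ[k] M)
    (θ' : κ → M →ₗ[k] V') (j' : κ → V' →ₗ[k] M)
    (h : ∀ m, ∑ i, j i (θ i m) = ∑ x, j' x (θ' x m)) :
    ∑ i, LinearMap.trace k V (θ i ∘ₗ j i) = ∑ x, LinearMap.trace k V' (θ' x ∘ₗ j' x) := by
  let E : Submodule k M := (⨆ i, LinearMap.range (j i)) ⊔ ⨆ x, LinearMap.range (j' x)
  have h1 : ∀ i v, j i v ∈ E := fun i v =>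
    Submodule.mem_sup_left (Submodule.mem_iSup_of_mem i ⟨v, rfl⟩)
  have h2 : ∀ i v, j' i v ∈ E := fun i v =>
    Submodule.mem_sup_right (Submodule.mem_iSup_of_mem i ⟨v, rfl⟩)
  rw [sum_trace_eq_trace_codRestrict θ j E h1, sum_trace_eq_trace_codRestrict θ' j' E h2]
  congr 1
  ext m
  simpa using h m

theorem exists_finset_support_subset {k V X R : Type*} [Field k] [AddCommGroup V] [Module k V]
    [FiniteDimensional k V] [AddCommGroup R] [Module k R] (g : V →ₗ[k] (X →₀ R)) :
    ∃ F : Finset X, ∀ v, (g v).support ⊆ F := by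
  classical
  let b := Module.finBasis k V
  refine ⟨Finset.univ.biUnion fun i => (g (b i)).support, fun v => ?_⟩
  have : (⊤ : Submodule k V) ≤ (Finsupp.supported R k
      ((Finset.univ.biUnion fun i => (g (b i)).support : Finset X) : Set X)).comap g := by
    rw [← b.span_eq, Submodule.span_le]
    rintro _ ⟨i, rfl⟩
    simp only [SetLike.mem_coe, Submodule.mem_comap, Finsupp.mem_supported]
    exact Finset.coe_subset.2 (Finset.subset_biUnion_of_mem (fun i => (g (b i)).support)
      (Finset.mem_univ i))
  exact Finset.coe_subset.1 ((Finsupp.mem_supported k _).1 (this (Submodule.mem_top (x := v))))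

end Trace

section Functions

variable (k R : Type*) [Field k] [Ring R] [Algebra k R]

/-- The trace functions on an algebra. -/
def traceFun : Submodule k (Module.Dual k R) where
  carrier := {χ | ∀ a b, χ (a * b) = χ (b * a)}
  add_mem' := fun h h' a b => by simp [h a b, h' a b]
  zero_mem' := fun a b => by simp
  smul_mem' := fun c χ h a b => by simp [h a b]

/-- The span of the characters of an algebra over an algebraically closed field:
trace functions vanishing on the Jacobson radical. -/
def charFun : Submodule k (Module.Dual k R) where
  carrier := {χ | (∀ a b, χ (a * b) = χ (b * a)) ∧ ∀ a ∈ Ring.jacobson R, χ a = 0}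
  add_mem' := fun h h' => ⟨fun a b => by simp [h.1 a b, h'.1 a b],
    fun a ha => by simp [h.2 a ha, h'.2 a ha]⟩
  zero_mem' := ⟨fun a b => by simp, fun a _ => by simp⟩
  smul_mem' := fun c χ h => ⟨fun a b => by simp [h.1 a b], fun a ha => by simp [h.2 a ha]⟩

/-- The functional sending `a` to the trace of `y ↦ a * y * w`. -/
noncomputable def bimulTrace : R →ₗ[k] Module.Dual k R :=
  LinearMap.mk₂ k (fun w a => LinearMap.trace k R (LinearMap.mulLeft k a ∘ₗ LinearMap.mulRight k w))
    (fun w w' a => by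
      rw [← map_add]; congr 1; ext y; simp [mul_add])
    (fun c w a => by
      rw [← map_smul]; congr 1; ext y; simp)
    (fun w a a' => by
      rw [← map_add]; congr 1; ext y; simp [add_mul])
    (fun c w a => by
      rw [← map_smul]; congr 1; ext y; simp)

theorem bimulTrace_apply (w a : R) : bimulTrace k R w a =
    LinearMap.trace k R (LinearMap.mulLeft k a ∘ₗ LinearMap.mulRight k w) := rfl

/-- The projective characters. -/
noncomputable def projFun : Submodule k (Module.Dual k R) := LinearMap.range (bimulTrace k R)

variable {k R}

theorem charFun_le : charFun k R ≤ traceFun k R := fun _ h => h.1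

theorem exists_pow_eq_zero_of_mem_jacobson [FiniteDimensional k R] {a : R}
    (ha : a ∈ Ring.jacobson R) : IsNilpotent a := by
  have : IsArtinianRing R := .of_finite k R
  obtain ⟨n, hn⟩ := (IsSemiprimaryRing.isNilpotent (R := R))
  refine ⟨n, ?_⟩
  have := Ideal.pow_mem_pow ha n
  rw [hn] at this
  simpa using this

theorem projFun_le [FiniteDimensional k R] : projFun k R ≤ charFun k R := by
  rintro _ ⟨w, rfl⟩
  refine ⟨fun a b => ?_, fun a ha => ?_⟩
  · simp only [bimulTrace_apply]
    have h1 : LinearMap.mulLeft k (a * b) ∘ₗ LinearMap.mulRight k w =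
        LinearMap.mulLeft k a ∘ₗ (LinearMap.mulLeft k b ∘ₗ LinearMap.mulRight k w) := by
      ext y; simp
    have h2 : LinearMap.mulLeft k (b * a) ∘ₗ LinearMap.mulRight k w =
        (LinearMap.mulLeft k b ∘ₗ LinearMap.mulRight k w) ∘ₗ LinearMap.mulLeft k a := by
      ext y; simp [mul_assoc]
    rw [h1, h2, LinearMap.trace_comp_comm']
  · obtain ⟨n, hn⟩ := exists_pow_eq_zero_of_mem_jacobson (k := k) ha
    rw [bimulTrace_apply]
    refine (LinearMap.isNilpotent_trace_of_isNilpotent (R := k) ?_).eq_zero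
    refine ⟨n, ?_⟩
    have hc : Commute (LinearMap.mulLeft k a) (LinearMap.mulRight k w) := by
      ext y; simp [mul_assoc]
    change (LinearMap.mulLeft k a * LinearMap.mulRight k w) ^ n = 0
    rw [hc.mul_pow, LinearMap.pow_mulLeft, hn, LinearMap.mulLeft_zero_eq_zero, zero_mul]

end Functions

section Projective

variable {k R N V ι : Type*} [Field k] [Ring R] [Algebra k R] [FiniteDimensional k R]
  [AddCommGroup N] [Module k N] [Module R N] [IsScalarTower k R N] [Module.Projective R N]
  [AddCommGroup V] [Module k V] [FiniteDimensional k V] [Fintype ι]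

theorem exists_sum_trace_eq_bimulTrace (θ : ι → N →ₗ[k] V) (j : ι → V →ₗ[k] N)
    (Ψ : N →ₗ[R] N) (hΨ : ∀ n, Ψ n = ∑ i, j i (θ i n)) :
    ∃ w : R, ∀ b : R,
      ∑ i, LinearMap.trace k V (θ i ∘ₗ Algebra.lsmul k k N b ∘ₗ j i) = bimulTrace k R w b := by
  obtain ⟨s, hs⟩ := Module.projective_def.1 (inferInstance : Module.Projective R N)
  have hF : ∃ F : Finset N, ∀ n, (s (Ψ n)).support ⊆ F := by
    classical
    choose F hF using fun i => exists_finset_support_subset ((s.restrictScalars k) ∘ₗ j i)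
    refine ⟨Finset.univ.biUnion F, fun n => ?_⟩
    rw [hΨ, map_sum]
    refine Finsupp.support_finsetSum.trans ?_
    intro x hx
    simp only [Finset.mem_biUnion, Finset.mem_univ, true_and] at hx ⊢
    obtain ⟨i, hi⟩ := hx
    exact ⟨i, hF i _ hi⟩
  obtain ⟨F, hF⟩ := hF
  have hrec : ∀ n, Ψ n = ∑ x : F, s (Ψ n) x • (x : N) := by
    intro n
    rw [Finset.sum_coe_sort F (fun x => s (Ψ n) x • x)]
    conv_lhs => rw [← hs (Ψ n)]
    rw [Finsupp.linearCombination_apply, Finsupp.sum_of_support_subset _ (hF n) _ (by simp)]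
    rfl
  refine ⟨∑ x : F, s (Ψ x) x, fun b => ?_⟩
  let θ' : F → N →ₗ[k] R := fun x =>
    ((Finsupp.lapply (x : N) : (N →₀ R) →ₗ[R] R) ∘ₗ s ∘ₗ Ψ).restrictScalars k
  let j' : F → R →ₗ[k] N := fun x =>
    Algebra.lsmul k k N b ∘ₗ (LinearMap.toSpanSingleton R N (x : N)).restrictScalars k
  rw [sum_trace_eq_of_sum_comp_eq θ (fun i => Algebra.lsmul k k N b ∘ₗ j i) θ' j']
  · rw [map_sum, LinearMap.sum_apply]
    refine Finset.sum_congr rfl fun x _ => ?_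
    rw [bimulTrace_apply]
    congr 1
    ext y
    simp [θ', j']
  · intro m
    have h1 : ∑ i, (Algebra.lsmul k k N b ∘ₗ j i) (θ i m) = b • Ψ m := by
      simp [hΨ, Finset.smul_sum]
    rw [h1, hrec, Finset.smul_sum]
    rfl

end Projective

end

section

open MulOpposite

namespace StableMoritaWitness

open TensorProduct

variable {k A B : Type u} [Field k] [Ring A] [Ring B] [Algebra k A] [Algebra k B]
  (W : StableMoritaWitness k A B)

/-- `b ↦ ⟨m, b n⟩`. -/
noncomputable def coeffMap (m : W.M) (n : W.N) : B →ₗ[k] A :=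
  W.ang m ∘ₗ (LinearMap.toSpanSingleton B W.N n).restrictScalars k

@[simp] theorem coeffMap_apply (m : W.M) (n : W.N) (b : B) :
    W.coeffMap m n b = W.ang m (b • n) := rfl

/-- The transfer of functionals. -/
noncomputable def transfer : Module.Dual k A →ₗ[k] Module.Dual k B :=
  ∑ j, (W.coeffMap (W.symm.ne j) (W.symm.me j)).dualMap

theorem transfer_apply (χ : Module.Dual k A) (b : B) :
    W.transfer χ b = ∑ j, χ (W.ang (W.symm.ne j) (b • W.symm.me j)) := by
  simp [transfer, LinearMap.sum_apply]

/-- The functional `n ⊗ m ↦ χ ⟨m, n⟩`. -/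
noncomputable def pairFun (χ : Module.Dual k A) (hχ : χ ∈ traceFun k A) :
    RelTensor A W.N W.M →ₗ[k] k :=
  RelTensor.liftL
    (AddMonoidHom.mk' (fun n => (χ ∘ₗ W.ang.flip n).toAddMonoidHom) (fun n n' => by ext m; simp))
    (fun a n m => by simpa [ang_op_smul, ang_smul] using hχ _ _)
    (fun c n m => by simp)

@[simp] theorem pairFun_tm (χ : Module.Dual k A) (hχ : χ ∈ traceFun k A) (n : W.N) (m : W.M) :
    W.pairFun χ hχ (RelTensor.tm A n m) = χ (W.ang m n) := by
  simp [pairFun]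

theorem transfer_mem_traceFun {χ : Module.Dual k A} (hχ : χ ∈ traceFun k A) :
    W.transfer χ ∈ traceFun k B := by
  intro b c
  rw [transfer_apply, transfer_apply]
  have := W.symm.sum_central
    (AddMonoidHom.mk' (fun n => (χ ∘ₗ W.ang.flip (b • n)).toAddMonoidHom)
      (fun n n' => by ext m; simp))
    (fun a n m => by
      simp only [AddMonoidHom.mk'_apply, LinearMap.toAddMonoidHom_coe, LinearMap.comp_apply,
        LinearMap.flip_apply]
      rw [smul_comm b, ang_op_smul, ang_smul]
      exact hχ _ _) c
  simp only [AddMonoidHom.mk'_apply, LinearMap.toAddMonoidHom_coe, LinearMap.comp_apply,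
        LinearMap.flip_apply, ang_bal] at this
  simpa [mul_smul] using this

theorem th_smul_base (c : k) (t : RelTensor B W.M W.N) : W.th (c • t) = c • W.th t := by
  induction t using RelTensor.induct with
  | h0 => simp
  | ht m n =>
    rw [RelTensor.smul_tm, ← algebraMap_smul A c m, th_left]
    ext <;> simp
  | ha x y hx hy => rw [smul_add, map_add, hx, hy, map_add, smul_add]

/-- `th` as a linear equivalence over the base field. -/
noncomputable def thK : RelTensor B W.M W.N ≃ₗ[k] A × W.P where
  __ := W.th
  map_smul' := W.th_smul_base

theorem thK_tm (m : W.M) (n : W.N) : W.thK (RelTensor.tm B m n) = (W.ang m n, W.angP m n) := rfl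

/-- The restriction to `Q` of the functional `n ⊗ m ↦ χ ⟨m, n⟩`. -/
noncomputable def pairQ (χ : Module.Dual k A) (hχ : χ ∈ traceFun k A) : W.Q →ₗ[k] k :=
  W.pairFun χ hχ ∘ₗ W.symm.thK.symm.toLinearMap ∘ₗ LinearMap.inr k B W.Q

theorem pairFun_symm_left (χ : Module.Dual k A) (hχ : χ ∈ traceFun k A) (b : B) :
    W.pairFun χ hχ (W.symm.thK.symm (b, 0)) = W.transfer χ b := by
  have := W.symm.sum_tm_smul b
  change ∑ i, RelTensor.tm A (b • W.symm.me i) (W.symm.ne i) = W.symm.thK.symm (b, 0) at this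
  rw [← this, map_sum, transfer_apply]
  simp

theorem pair_eq (χ : Module.Dual k A) (hχ : χ ∈ traceFun k A) (m : W.M) (n : W.N) :
    χ (W.ang m n) = W.transfer χ (W.symm.ang n m) + W.pairQ χ hχ (W.symm.angP n m) := by
  rw [← pairFun_symm_left _ _ hχ, pairQ, LinearMap.comp_apply, LinearMap.comp_apply, ← pairFun_tm _ _ hχ, LinearMap.inr_apply,
    LinearEquiv.coe_coe, ← map_add (W.pairFun χ hχ), ← map_add, Prod.mk_add_mk, add_zero, zero_add, ← thK_tm]
  simp

/-- The map `u ⊗ v ↦ v * u`. -/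
noncomputable def mulRev (k B : Type*) [Field k] [Ring B] [Algebra k B] : B ⊗[k] Bᵐᵒᵖ →ₗ[k] B :=
  TensorProduct.lift (LinearMap.mk₂ k (fun u v => unop v * u)
    (by simp [mul_add]) (by simp) (by simp [add_mul]) (by simp))

@[simp] theorem mulRev_tmul (u : B) (v : Bᵐᵒᵖ) : mulRev k B (u ⊗ₜ v) = unop v * u := by
  simp [mulRev]

/-- The map `u ⊗ v ↦ φ v • u`. -/
noncomputable def slice (φ : B →ₗ[k] k) : B ⊗[k] Bᵐᵒᵖ →ₗ[k] B :=
  TensorProduct.lift (LinearMap.mk₂ k (fun u v => φ (unop v) • u)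
    (by simp) (fun c m n => smul_comm _ _ _) (by simp [add_smul]) (by simp [mul_smul]))

@[simp] theorem slice_tmul (φ : B →ₗ[k] k) (u : B) (v : Bᵐᵒᵖ) :
    slice φ (u ⊗ₜ v) = φ (unop v) • u := by
  simp [slice]

theorem slice_mul (φ : B →ₗ[k] k) (b : B) (z : B ⊗[k] Bᵐᵒᵖ) :
    slice φ ((b ⊗ₜ 1) * z) = b * slice φ z := by
  induction z with
  | zero => simp
  | tmul u v => simp
  | add x y hx hy => simp [mul_add, hx, hy]

/-- The map `b ↦ slice φ ((1 ⊗ b) * z)`. -/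
noncomputable def sliceEnd (φ : B →ₗ[k] k) (z : B ⊗[k] Bᵐᵒᵖ) : B →ₗ[k] B :=
  slice φ ∘ₗ LinearMap.mulRight k z ∘ₗ
    (Algebra.TensorProduct.includeRight (R := k) (A := B) (B := Bᵐᵒᵖ)).toLinearMap ∘ₗ
    (opLinearEquiv k).toLinearMap

theorem sliceEnd_apply (φ : B →ₗ[k] k) (z : B ⊗[k] Bᵐᵒᵖ) (b : B) :
    sliceEnd φ z b = slice φ ((1 ⊗ₜ op b) * z) := by simp [sliceEnd]

theorem trace_sliceEnd [FiniteDimensional k B] (φ : B →ₗ[k] k) (z : B ⊗[k] Bᵐᵒᵖ) :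
    LinearMap.trace k B (sliceEnd φ z) = φ (mulRev k B z) := by
  induction z with
  | zero =>
    have : sliceEnd φ (0 : B ⊗[k] Bᵐᵒᵖ) = 0 := by ext; simp [sliceEnd_apply]
    simp [this]
  | tmul u v =>
    have : sliceEnd φ (u ⊗ₜ v) = (φ ∘ₗ LinearMap.mulLeft k (unop v)).smulRight u := by
      ext b; simp [sliceEnd_apply]
    rw [this, LinearMap.trace_smulRight]
    simp
  | add x y hx hy =>
    have : sliceEnd φ (x + y) = sliceEnd φ x + sliceEnd φ y := by
      ext; simp [sliceEnd_apply, mul_add]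
    rw [this, map_add, hx, hy, map_add, map_add]

theorem pairQ_smul_smul (χ : Module.Dual k A) (hχ : χ ∈ traceFun k A) (u v : B) (x : W.Q) :
    W.pairQ χ hχ (u • op v • x) = W.pairQ χ hχ ((v * u) • x) := by
  obtain ⟨r, n, m, h⟩ := RelTensor.exists_sum (W.symm.thK.symm (0, x))
  have h0 : ((0 : B), x) = ∑ i, W.symm.thK (RelTensor.tm A (n i) (m i)) := by
    rw [← map_sum, ← h]; simp
  have key : ∀ u v : B, W.symm.thK.symm (0, u • op v • x) =
      ∑ i, RelTensor.tm A (u • n i) (op v • m i) := by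
    intro u v
    rw [LinearEquiv.symm_apply_eq, map_sum]
    have : ∀ i, W.symm.thK (RelTensor.tm A (u • n i) (op v • m i)) =
        u • op v • W.symm.thK (RelTensor.tm A (n i) (m i)) := fun i => by
      change W.symm.th _ = _ • _ • W.symm.th _
      rw [th_left, th_right]
    simp_rw [this]
    rw [← Finset.smul_sum, ← Finset.smul_sum, ← h0]
    simp
  have e1 := key u v
  have e2 := key (v * u) 1
  simp only [op_one, one_smul] at e2
  simp only [pairQ, LinearMap.comp_apply, LinearMap.inr_apply, LinearEquiv.coe_coe]
  rw [e1, e2, map_sum, map_sum]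
  simp [ang_bal, mul_smul]

theorem pairQ_smul (χ : Module.Dual k A) (hχ : χ ∈ traceFun k A) (z : B ⊗[k] Bᵐᵒᵖ) (x : W.Q) :
    W.pairQ χ hχ (z • x) = W.pairQ χ hχ (mulRev k B z • x) := by
  induction z with
  | zero =>
    rw [map_zero (mulRev k B), zero_smul]
    exact congrArg _ (zero_smul (B ⊗[k] Bᵐᵒᵖ) x)
  | tmul u v =>
    rw [mulRev_tmul, ← pairQ_smul_smul, op_unop]
    congr 1
    change _ = (u ⊗ₜ[k] (1 : Bᵐᵒᵖ)) • ((1 : B) ⊗ₜ[k] v) • x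
    simp [smul_smul]
  | add y y' hx hy => simp [add_smul, hx, hy]

end StableMoritaWitness

end

section

open MulOpposite

namespace StableMoritaWitness

open TensorProduct

variable {k A B : Type u} [Field k] [Ring A] [Ring B] [Algebra k A] [Algebra k B]
  (W : StableMoritaWitness k A B)

/-- The map `b ↦ m b`. -/
noncomputable def rmulMap (m : W.M) : B →ₗ[k] W.M :=
  (LinearMap.toSpanSingleton Bᵐᵒᵖ W.M m).restrictScalars k ∘ₗ (opLinearEquiv k).toLinearMap

@[simp] theorem rmulMap_apply (m : W.M) (b : B) : W.rmulMap m b = op b • m := by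
  simp [rmulMap]

theorem sum_symm_angP_eq (q : W.Q →ₗ[B ⊗[k] Bᵐᵒᵖ] W.Q →₀ B ⊗[k] Bᵐᵒᵖ) (a : A) (b : B)
    (n : W.N) (m : W.M) (x : W.Q) :
    q (W.symm.angP n (a • op b • m)) x = (1 ⊗ₜ op b) * q (W.symm.angP n (a • m)) x := by
  rw [smul_comm a (op b) m, angP_op_smul]
  change q (((1 : B) ⊗ₜ[k] op b) • _) x = _
  rw [map_smul]
  rfl

theorem transfer_transfer_sub_mem [FiniteDimensional k A] [FiniteDimensional k B]
    {χ : Module.Dual k A} (hχ : χ ∈ traceFun k A) :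
    W.symm.transfer (W.transfer χ) - χ ∈ projFun k A := by
  obtain ⟨s, hs⟩ := Module.projective_def.1
    (inferInstance : Module.Projective (B ⊗[k] Bᵐᵒᵖ) W.Q)
  have hF : ∃ F : Finset W.Q, ∀ i (a : A), (s (W.symm.angP (W.ne i) (a • W.me i))).support ⊆ F := by
    classical
    have hlin : ∀ i, ∃ F : Finset W.Q, ∀ a : A,
        (s (W.symm.angP (W.ne i) (a • W.me i))).support ⊆ F := by
      intro i
      let g : A →ₗ[k] W.Q →₀ (B ⊗[k] Bᵐᵒᵖ) :=
        { toFun := fun a => s (W.symm.angP (W.ne i) (a • W.me i))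
          map_add' := fun a a' => by rw [add_smul, map_add, map_add]
          map_smul' := fun c a => by
            rw [smul_assoc, map_smul]
            change s ((algebraMap k (B ⊗[k] Bᵐᵒᵖ) c) • _) = _
            rw [map_smul]
            ext x
            rw [Finsupp.smul_apply, smul_eq_mul, ← Algebra.smul_def]
            rfl }
      exact exists_finset_support_subset g
    choose F hF using hlin
    exact ⟨Finset.univ.biUnion F, fun i a => (hF i a).trans
      (Finset.subset_biUnion_of_mem F (Finset.mem_univ i))⟩
  obtain ⟨F, hF⟩ := hF
  let φ : W.Q → B →ₗ[k] k := fun x =>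
    W.pairQ χ hχ ∘ₗ (LinearMap.toSpanSingleton B W.Q x).restrictScalars k
  let sk : W.Q → W.Q →ₗ[k] (B ⊗[k] Bᵐᵒᵖ) := fun x =>
    { toFun := fun q => s q x
      map_add' := by simp
      map_smul' := fun c q => by
        change s ((algebraMap k (B ⊗[k] Bᵐᵒᵖ) c) • _) x = _
        rw [map_smul, Finsupp.smul_apply, smul_eq_mul, ← Algebra.smul_def]
        rfl }
  let θ : W.Q → Fin W.r → W.M →ₗ[k] B := fun x i => slice (φ x) ∘ₗ sk x ∘ₗ W.symm.angP (W.ne i)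
  have hθ : ∀ x i m, θ x i m = slice (φ x) (s (W.symm.angP (W.ne i) m) x) := fun x i m => rfl
  have hΨ : ∀ x, ∃ Ψ : W.M →ₗ[A] W.M, ∀ m, Ψ m = ∑ i, W.rmulMap (W.me i) (θ x i m) := by
    intro x
    refine ⟨{ toFun := fun m => ∑ i, W.rmulMap (W.me i) (θ x i m)
              map_add' := fun m m' => by simp [add_smul, Finset.sum_add_distrib]
              map_smul' := fun a m => ?_ }, fun m => rfl⟩
    simp only [rmulMap_apply, RingHom.id_apply, Finset.smul_sum]
    have := W.sum_central
      (AddMonoidHom.mk' (fun m' => AddMonoidHom.mk'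
        (fun n' => op (slice (φ x) (s (W.symm.angP n' m) x)) • m')
        (fun n n' => by simp [add_smul])) (fun m m' => by ext n; simp))
      (fun b m' n' => by
        simp only [AddMonoidHom.mk'_apply]
        rw [angP_smul]
        change _ = op (slice (φ x) (s ((b ⊗ₜ[k] (1 : Bᵐᵒᵖ)) • _) x)) • _
        rw [map_smul, Finsupp.smul_apply, smul_eq_mul, slice_mul, op_mul, mul_smul]) a
    simp only [AddMonoidHom.mk'_apply] at this
    simp_rw [hθ, smul_comm a]
    rw [this]
    exact Finset.sum_congr rfl fun i _ =>
      congrArg (fun t => op (slice (φ x) (s t x)) • W.me i) (W.symm.angP_bal a (W.ne i) m).symm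
  have hw : ∀ x, ∃ w : A, ∀ a : A, ∑ i, LinearMap.trace k B
      (θ x i ∘ₗ Algebra.lsmul k k W.M a ∘ₗ W.rmulMap (W.me i)) = bimulTrace k A w a := by
    intro x
    obtain ⟨Ψ, hΨ⟩ := hΨ x
    exact exists_sum_trace_eq_bimulTrace (θ x) (fun i => W.rmulMap (W.me i)) Ψ hΨ
  choose w hw using hw
  have htr : ∀ x i (a : A), LinearMap.trace k B
      (θ x i ∘ₗ Algebra.lsmul k k W.M a ∘ₗ W.rmulMap (W.me i)) =
      W.pairQ χ hχ (s (W.symm.angP (W.ne i) (a • W.me i)) x • x) := by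
    intro x i a
    have : θ x i ∘ₗ Algebra.lsmul k k W.M a ∘ₗ W.rmulMap (W.me i) =
        sliceEnd (φ x) (s (W.symm.angP (W.ne i) (a • W.me i)) x) := by
      ext b
      rw [sliceEnd_apply, ← sum_symm_angP_eq]
      simp [hθ]
    rw [this, trace_sliceEnd, pairQ_smul]
    rfl
  refine ⟨-∑ x ∈ F, w x, ?_⟩
  rw [map_neg, neg_eq_iff_eq_neg, neg_sub, map_sum]
  ext a
  rw [LinearMap.sum_apply, LinearMap.sub_apply, eq_sub_iff_add_eq']
  have h1 : χ a = ∑ i, χ (W.ang (a • W.me i) (W.ne i)) := by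
    simp_rw [ang_smul]
    rw [← map_sum, ← Finset.mul_sum, sum_ang, mul_one]
  rw [h1, transfer_apply]
  simp_rw [W.pair_eq χ hχ]
  rw [Finset.sum_add_distrib]
  congr 1
  simp_rw [← hw, htr]
  rw [Finset.sum_comm]
  refine Finset.sum_congr rfl fun i _ => ?_
  rw [← map_sum]
  congr 1
  conv_rhs => rw [← hs (W.symm.angP (W.ne i) (a • W.me i))]
  rw [Finsupp.linearCombination_apply, Finsupp.sum_of_support_subset _ (hF i a) _
    (fun x _ => zero_smul (B ⊗[k] Bᵐᵒᵖ) x)]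
  rfl

theorem exists_linear_reconstruct (w : A) : ∃ Ψ : W.N →ₗ[B] W.N,
    ∀ n, Ψ n = ∑ i, op (W.ang (W.symm.ne i) n * w) • W.symm.me i := by
  refine ⟨{ toFun := fun n => ∑ i, op (W.ang (W.symm.ne i) n * w) • W.symm.me i
            map_add' := fun m m' => by simp [add_mul, add_smul, Finset.sum_add_distrib]
            map_smul' := fun b n => ?_ }, fun m => rfl⟩
  simp only [RingHom.id_apply, Finset.smul_sum]
  have := W.symm.sum_central
    (AddMonoidHom.mk' (fun n' => AddMonoidHom.mk'
      (fun m' => op (W.ang m' n * w) • n')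
      (fun n n' => by simp [add_mul, add_smul])) (fun m m' => by ext n; simp))
    (fun a n' m' => by
      simp only [AddMonoidHom.mk'_apply]
      rw [ang_smul, mul_assoc, op_mul a, mul_smul]) b
  simp only [AddMonoidHom.mk'_apply] at this
  simp_rw [smul_comm b]
  rw [this]
  simp_rw [ang_bal]

theorem transfer_mem_projFun [FiniteDimensional k A] [FiniteDimensional k B]
    {χ : Module.Dual k A} (hχ : χ ∈ projFun k A) : W.transfer χ ∈ projFun k B := by
  obtain ⟨w, rfl⟩ := hχ
  let j : Fin W.symm.r → A →ₗ[k] W.N := fun i => W.symm.rmulMap (W.symm.me i)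
  let θ : Fin W.symm.r → W.N →ₗ[k] A := fun i =>
    LinearMap.mulRight k w ∘ₗ W.ang (W.symm.ne i)
  have hj : ∀ i y, j i y = op y • W.symm.me i := fun i y => W.symm.rmulMap_apply _ _
  have hθ : ∀ i n, θ i n = W.ang (W.symm.ne i) n * w := fun i n => rfl
  obtain ⟨Ψ, hΨ⟩ := W.exists_linear_reconstruct w
  replace hΨ : ∀ n, Ψ n = ∑ i, j i (θ i n) := fun n => by simp_rw [hj, hθ]; exact hΨ n
  obtain ⟨w', hw'⟩ := exists_sum_trace_eq_bimulTrace θ j Ψ hΨ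
  refine ⟨w', ?_⟩
  ext b
  rw [← hw', transfer_apply]
  refine Finset.sum_congr rfl fun i _ => ?_
  rw [bimulTrace_apply]
  congr 1
  ext y
  simp only [LinearMap.comp_apply, Algebra.lsmul_coe, hj, hθ,
    LinearMap.mulRight_apply, LinearMap.mulLeft_apply]
  rw [smul_comm b, ang_op_smul, mul_assoc]

end StableMoritaWitness

end

section

open MulOpposite

/-- A surjection onto a product of matrix algebras whose kernel is the Jacobson radical. -/
structure WedderburnData (k R : Type*) [Field k] [Ring R] [Algebra k R] where
  /-- The number of blocks. -/
  n : ℕ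
  /-- The sizes of the blocks. -/
  d : Fin n → ℕ
  d_ne : ∀ i, NeZero (d i)
  /-- The surjection. -/
  g : R →ₐ[k] ((i : Fin n) → Matrix (Fin (d i)) (Fin (d i)) k)
  surj : Function.Surjective g
  ker : ∀ a, g a = 0 ↔ a ∈ Ring.jacobson R

theorem nonempty_wedderburnData (k R : Type*) [Field k] [IsAlgClosed k] [Ring R] [Algebra k R]
    [FiniteDimensional k R] : Nonempty (WedderburnData k R) := by
  have : IsArtinianRing R := .of_finite k R
  have : IsSemisimpleRing (R ⧸ Ring.jacobson R) := IsSemiprimaryRing.isSemisimpleRing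
  obtain ⟨n, d, hd, ⟨e⟩⟩ := IsSemisimpleRing.exists_algEquiv_pi_matrix_of_isAlgClosed k
    (R ⧸ Ring.jacobson R)
  refine ⟨⟨n, d, hd, e.toAlgHom.comp (Ideal.Quotient.mkₐ k (Ring.jacobson R)),
    e.surjective.comp (Ideal.Quotient.mkₐ_surjective k _), fun a => ?_⟩⟩
  simp [Ideal.Quotient.eq_zero_iff_mem]

namespace WedderburnData

variable {k R : Type*} [Field k] [Ring R] [Algebra k R] (D : WedderburnData k R)

instance (i : Fin D.n) : NeZero (D.d i) := D.d_ne i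

/-- Lifts of the matrix units. -/
noncomputable def unit (i : Fin D.n) (s t : Fin (D.d i)) : R :=
  (D.surj (Pi.single i (Matrix.single s t 1))).choose

theorem g_unit (i : Fin D.n) (s t : Fin (D.d i)) :
    D.g (D.unit i s t) = Pi.single i (Matrix.single s t 1) :=
  (D.surj (Pi.single i (Matrix.single s t 1))).choose_spec

theorem sub_mem {a b : R} (h : D.g a = D.g b) : a - b ∈ Ring.jacobson R := by
  rw [← D.ker, map_sub, h, sub_self]

theorem apply_eq {χ : Module.Dual k R} (hχ : χ ∈ charFun k R) {a b : R} (h : D.g a = D.g b) :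
    χ a = χ b := by
  rw [← sub_eq_zero, ← map_sub]
  exact hχ.2 _ (D.sub_mem h)

theorem apply_unit {χ : Module.Dual k R} (hχ : χ ∈ charFun k R) (i : Fin D.n)
    (s t : Fin (D.d i)) : χ (D.unit i s t) = if s = t then χ (D.unit i 0 0) else 0 := by
  split_ifs with h
  · subst h
    have h1 : χ (D.unit i s s) = χ (D.unit i s 0 * D.unit i 0 s) := D.apply_eq hχ (by
      rw [map_mul]; simp [g_unit, ← Pi.single_mul])
    have h2 : χ (D.unit i 0 0) = χ (D.unit i 0 s * D.unit i s 0) := D.apply_eq hχ (by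
      rw [map_mul]; simp [g_unit, ← Pi.single_mul])
    rw [h1, h2, hχ.1]
  · have h1 : χ (D.unit i s t) = χ (D.unit i s s * D.unit i s t) := D.apply_eq hχ (by
      rw [map_mul]; simp [g_unit, ← Pi.single_mul])
    have h2 : χ (D.unit i s t * D.unit i s s) = χ 0 := D.apply_eq hχ (by
      rw [map_mul]
      simp [g_unit, ← Pi.single_mul, Ne.symm h])
    rw [h1, hχ.1, h2, map_zero]

theorem apply_eq_sum_trace {χ : Module.Dual k R} (hχ : χ ∈ charFun k R) (a : R) :
    χ a = ∑ i, χ (D.unit i 0 0) * (D.g a i).trace := by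
  have h1 : χ a = χ (∑ i, ∑ s, ∑ t, D.g a i s t • D.unit i s t) := D.apply_eq hχ (by
    simp only [map_sum, map_smul, g_unit]
    ext i s t
    simp only [Finset.sum_apply, Pi.smul_apply, Matrix.sum_apply]
    rw [Finset.sum_eq_single i]
    · simp [Matrix.single_apply, Matrix.smul_apply, ite_and]
    · intro j _ hj
      simp [Pi.single_eq_of_ne hj.symm]
    · simp)
  rw [h1]
  simp only [map_sum, map_smul]
  refine Finset.sum_congr rfl fun i _ => ?_
  rw [Matrix.trace, Finset.mul_sum]
  refine Finset.sum_congr rfl fun s _ => ?_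
  rw [Finset.sum_eq_single s]
  · rw [D.apply_unit hχ, if_pos rfl, smul_eq_mul, mul_comm]
    rfl
  · intro t _ ht
    rw [D.apply_unit hχ, if_neg ht.symm, smul_zero]
  · simp

/-- Characters are determined by their values on primitive idempotents. -/
noncomputable def charEval : charFun k R →ₗ[k] (Fin D.n → k) :=
  LinearMap.pi (fun i => LinearMap.applyₗ (D.unit i 0 0)) ∘ₗ (charFun k R).subtype

theorem charEval_bijective : Function.Bijective D.charEval := by
  constructor
  · rw [injective_iff_map_eq_zero]
    intro χ h
    ext a
    rw [D.apply_eq_sum_trace χ.2]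
    have : ∀ i, χ.1 (D.unit i 0 0) = 0 := fun i => congrFun h i
    simp [this]
  · intro c
    let χ : Module.Dual k R := ∑ i, c i • (Matrix.traceLinearMap _ k k ∘ₗ
      LinearMap.proj i ∘ₗ D.g.toLinearMap)
    have hχ : ∀ a, χ a = ∑ i, c i * (D.g a i).trace := fun a => by simp [χ, LinearMap.sum_apply]
    refine ⟨⟨χ, fun a b => ?_, fun a ha => ?_⟩, ?_⟩
    · simp [hχ, Matrix.trace_mul_comm (D.g a _)]
    · simp [hχ, (D.ker a).2 ha]
    · ext j
      change χ (D.unit j 0 0) = _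
      rw [hχ, Finset.sum_eq_single j]
      · simp [g_unit]
      · intro i _ hi
        simp [g_unit, Pi.single_eq_of_ne hi]
      · simp

theorem finrank_charFun : Module.finrank k (charFun k R) = D.n := by
  rw [(LinearEquiv.ofBijective _ D.charEval_bijective).finrank_eq]
  simp

theorem sum_apply_eq_zero_of_isNilpotent (D : WedderburnData k R) {χ : Module.Dual k R}
    (hχ : χ ∈ charFun k R) {r : ℕ} (X : Matrix (Fin r) (Fin r) R) (hX : IsNilpotent X) : ∑ j, χ (X j j) = 0 := by
  rw [Finset.sum_congr rfl fun j _ => D.apply_eq_sum_trace hχ (X j j), Finset.sum_comm]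
  refine Finset.sum_eq_zero fun i _ => ?_
  rw [← Finset.mul_sum]
  let f : R →+* Matrix (Fin (D.d i)) (Fin (D.d i)) k :=
    (Pi.evalRingHom _ i).comp D.g.toRingHom
  have h1 : IsNilpotent (Matrix.compRingEquiv (Fin r) (Fin (D.d i)) k (f.mapMatrix X)) :=
    (hX.map f.mapMatrix).map _
  have h2 := (Matrix.isNilpotent_trace_of_isNilpotent h1).eq_zero
  have h3 : ∑ j, (D.g (X j j) i).trace =
      (Matrix.compRingEquiv (Fin r) (Fin (D.d i)) k (f.mapMatrix X)).trace := by
    rw [Matrix.trace, Fintype.sum_prod_type]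
    rfl
  rw [h3, h2, mul_zero]

end WedderburnData

namespace StableMoritaWitness

variable {k A B : Type u} [Field k] [Ring A] [Ring B] [Algebra k A] [Algebra k B]
  (W : StableMoritaWitness k A B)

theorem transfer_mem_charFun [IsAlgClosed k] [FiniteDimensional k A] [FiniteDimensional k B]
    {χ : Module.Dual k A} (hχ : χ ∈ charFun k A) : W.transfer χ ∈ charFun k B := by
  refine ⟨W.transfer_mem_traceFun hχ.1, fun b hb => ?_⟩
  obtain ⟨D⟩ := nonempty_wedderburnData k A
  rw [transfer_apply]
  let X : Matrix (Fin W.symm.r) (Fin W.symm.r) A :=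
    Matrix.of fun j j' => W.ang (W.symm.ne j) (b • W.symm.me j')
  obtain ⟨Ψ, hΨ⟩ := W.exists_linear_reconstruct 1
  have hpow : ∀ t j j', (X ^ (t + 1)) j j' =
      W.ang (W.symm.ne j) (b ^ t • (Ψ ^ t) (b • W.symm.me j')) := by
    intro t
    induction t with
    | zero => intro j j'; simp [X]
    | succ t ih =>
      intro j j'
      rw [pow_succ', Matrix.mul_apply]
      simp_rw [ih]
      have h1 : b ^ (t + 1) • (Ψ ^ (t + 1)) (b • W.symm.me j') =
          b • Ψ (b ^ t • (Ψ ^ t) (b • W.symm.me j')) := by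
        rw [LinearMap.map_smul Ψ (b ^ t), smul_smul, ← pow_succ', pow_succ' Ψ]
        rfl
      rw [h1, hΨ, Finset.smul_sum, map_sum]
      refine Finset.sum_congr rfl fun l _ => ?_
      rw [smul_comm b, ang_op_smul, mul_one]
      rfl
  have hX : IsNilpotent X := by
    obtain ⟨t, ht⟩ := exists_pow_eq_zero_of_mem_jacobson (k := k) hb
    refine ⟨t + 1, ?_⟩
    ext j j'
    rw [hpow, ht]
    simp
  exact D.sum_apply_eq_zero_of_isNilpotent hχ X hX

end StableMoritaWitness

end

section Counting

theorem finrank_add_finrank_eq_of_inverse_modulo {k V V' : Type*} [Field k] [AddCommGroup V]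
    [Module k V] [AddCommGroup V'] [Module k V'] [FiniteDimensional k V] [FiniteDimensional k V']
    {X U : Submodule k V} {X' U' : Submodule k V'} (hU : U ≤ X) (hU' : U' ≤ X')
    (T : V →ₗ[k] V') (S : V' →ₗ[k] V) (hT : ∀ x ∈ X, T x ∈ X') (hTU : ∀ x ∈ U, T x ∈ U')
    (hS : ∀ x ∈ X', S x ∈ X) (hSU : ∀ x ∈ U', S x ∈ U)
    (hST : ∀ x ∈ X, S (T x) - x ∈ U) (hTS : ∀ x ∈ X', T (S x) - x ∈ U') :
    Module.finrank k X + Module.finrank k U' = Module.finrank k X' + Module.finrank k U := by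
  let f : X →ₗ[k] X' ⧸ U'.submoduleOf X' := (U'.submoduleOf X').mkQ ∘ₗ T.restrict hT
  have hker : LinearMap.ker f = U.submoduleOf X := by
    ext x
    rw [LinearMap.mem_ker, LinearMap.comp_apply, Submodule.mkQ_apply,
      Submodule.Quotient.mk_eq_zero]
    change T x ∈ U' ↔ (x : V) ∈ U
    refine ⟨fun h => ?_, fun h => hTU _ h⟩
    have := U.sub_mem (hSU _ h) (hST _ x.2)
    simpa using this
  have hrange : LinearMap.range f = ⊤ := by
    rw [LinearMap.range_eq_top]
    intro y
    obtain ⟨y, rfl⟩ := Submodule.Quotient.mk_surjective _ y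
    refine ⟨⟨S y, hS _ y.2⟩, ?_⟩
    exact (Submodule.Quotient.eq _).2 (hTS _ y.2)
  have h1 := f.finrank_range_add_finrank_ker
  have h2 := (U'.submoduleOf X').finrank_quotient_add_finrank
  rw [hker, hrange, finrank_top, (Submodule.submoduleOfEquivOfLe hU).finrank_eq] at h1
  rw [(Submodule.submoduleOfEquivOfLe hU').finrank_eq] at h2
  lia

namespace StableMoritaWitness

variable {k A B : Type u} [Field k] [Ring A] [Ring B] [Algebra k A] [Algebra k B]
  [FiniteDimensional k A] [FiniteDimensional k B]

theorem finrank_traceFun_add (W : StableMoritaWitness k A B) :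
    Module.finrank k (traceFun k A) + Module.finrank k (projFun k B) =
    Module.finrank k (traceFun k B) + Module.finrank k (projFun k A) :=
  finrank_add_finrank_eq_of_inverse_modulo (projFun_le.trans charFun_le)
    (projFun_le.trans charFun_le) W.transfer W.symm.transfer
    (fun _ => W.transfer_mem_traceFun) (fun _ => W.transfer_mem_projFun)
    (fun _ => W.symm.transfer_mem_traceFun) (fun _ => W.symm.transfer_mem_projFun)
    (fun _ => W.transfer_transfer_sub_mem) (fun _ => W.symm.transfer_transfer_sub_mem)

theorem finrank_charFun_add [IsAlgClosed k] (W : StableMoritaWitness k A B) :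
    Module.finrank k (charFun k A) + Module.finrank k (projFun k B) =
    Module.finrank k (charFun k B) + Module.finrank k (projFun k A) :=
  finrank_add_finrank_eq_of_inverse_modulo projFun_le
    projFun_le W.transfer W.symm.transfer
    (fun _ => W.transfer_mem_charFun) (fun _ => W.transfer_mem_projFun)
    (fun _ => W.symm.transfer_mem_charFun) (fun _ => W.symm.transfer_mem_projFun)
    (fun _ h => W.transfer_transfer_sub_mem (charFun_le h))
    (fun _ h => W.symm.transfer_transfer_sub_mem (charFun_le h))

end StableMoritaWitness

section Cyclic

open TensorProduct

variable {k A : Type*} [Field k] [Ring A] [Algebra k A] [FiniteDimensional k A]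
  {G : Type*} [CommGroup G] [Fintype G]

theorem trace_mul_monoidAlgebra (hG : (Fintype.card G : k) = 0) (g h : G) :
    LinearMap.trace k (MonoidAlgebra k G)
      (LinearMap.mulLeft k (MonoidAlgebra.of k G g) ∘ₗ
        LinearMap.mulRight k (MonoidAlgebra.of k G h)) = 0 := by
  classical
  rw [LinearMap.trace_eq_matrix_trace k (MonoidAlgebra.basis G k), Matrix.trace]
  have h1 : ∀ x : G, LinearMap.toMatrix (MonoidAlgebra.basis G k) (MonoidAlgebra.basis G k)
      (LinearMap.mulLeft k (MonoidAlgebra.of k G g) ∘ₗ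
        LinearMap.mulRight k (MonoidAlgebra.of k G h)) x x = if g * h = 1 then 1 else 0 := by
    intro x
    have h2 : g * (x * h) = x ↔ g * h = 1 := by
      rw [mul_left_comm, mul_eq_left]
    rw [LinearMap.toMatrix_apply]
    simp [MonoidAlgebra.basis, MonoidAlgebra.single_mul_single, Finsupp.single_apply, h2]
  simp only [Matrix.diag_apply, h1, Finset.sum_const, Finset.card_univ]
  rw [nsmul_eq_mul, hG, zero_mul]

theorem projFun_tensor_monoidAlgebra (hG : (Fintype.card G : k) = 0) :
    projFun k (A ⊗[k] MonoidAlgebra k G) = ⊥ := by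
  rw [projFun, LinearMap.range_eq_bot]
  have key : ∀ (w a : A) (h g : G), bimulTrace k (A ⊗[k] MonoidAlgebra k G)
      (w ⊗ₜ MonoidAlgebra.of k G h) (a ⊗ₜ MonoidAlgebra.of k G g) = 0 := by
    intro w a h g
    rw [bimulTrace_apply]
    have h1 : LinearMap.mulLeft k (a ⊗ₜ[k] MonoidAlgebra.of k G g) ∘ₗ
        LinearMap.mulRight k (w ⊗ₜ[k] MonoidAlgebra.of k G h) =
        TensorProduct.map (LinearMap.mulLeft k a ∘ₗ LinearMap.mulRight k w)
          (LinearMap.mulLeft k (MonoidAlgebra.of k G g) ∘ₗ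
            LinearMap.mulRight k (MonoidAlgebra.of k G h)) := by
      ext; simp
    rw [h1, LinearMap.trace_tensorProduct', trace_mul_monoidAlgebra hG, mul_zero]
  ext w h a g
  simpa using key w a h g

/-- The components of a trace function on `A ⊗ kG`. -/
noncomputable def traceFunComponents (k A G : Type*) [Field k] [Ring A] [Algebra k A]
    [CommGroup G] : traceFun k (A ⊗[k] MonoidAlgebra k G) →ₗ[k] (G → traceFun k A) where
  toFun χ g := ⟨χ.1 ∘ₗ (TensorProduct.mk k A (MonoidAlgebra k G)).flip (MonoidAlgebra.of k G g),
    fun a b => by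
      have := χ.2 (a ⊗ₜ MonoidAlgebra.of k G g) (b ⊗ₜ 1)
      simpa using this⟩
  map_add' χ ψ := rfl
  map_smul' c χ := rfl

theorem traceFunComponents_bijective {k A G : Type*} [Field k] [Ring A] [Algebra k A]
    [CommGroup G] :
    Function.Bijective (traceFunComponents k A G) := by
  constructor
  · rw [injective_iff_map_eq_zero]
    intro χ hχ
    ext a g
    exact LinearMap.congr_fun (congrArg Subtype.val (congrFun hχ g)) a
  · intro c
    let χ : Module.Dual k (A ⊗[k] MonoidAlgebra k G) := TensorProduct.lift
      ((MonoidAlgebra.basis G k).constr k (fun g => (c g).1)).flip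
    have hχ : ∀ a g, χ (a ⊗ₜ MonoidAlgebra.of k G g) = (c g).1 a := by
      intro a g
      have : MonoidAlgebra.of k G g = MonoidAlgebra.basis G k g := by simp [MonoidAlgebra.basis]
      rw [this, TensorProduct.lift.tmul, LinearMap.flip_apply, Module.Basis.constr_basis]
    refine ⟨⟨χ, fun x y => ?_⟩, ?_⟩
    · have : (LinearMap.mul k (A ⊗[k] MonoidAlgebra k G)).compr₂ χ =
          ((LinearMap.mul k (A ⊗[k] MonoidAlgebra k G)).compr₂ χ).flip := by
        ext a g b h
        have h1 := hχ (a * b) (g * h)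
        have h2 := hχ (b * a) (h * g)
        rw [mul_comm h g, (c (g * h)).2 b a, ← h1] at h2
        simpa [mul_comm h g] using h2.symm
      exact LinearMap.congr_fun (LinearMap.congr_fun this x) y
    · ext g a
      exact hχ a g

theorem finrank_traceFun_tensor_monoidAlgebra :
    Module.finrank k (traceFun k (A ⊗[k] MonoidAlgebra k G)) =
      Fintype.card G * Module.finrank k (traceFun k A) := by
  rw [(LinearEquiv.ofBijective _ (traceFunComponents_bijective (k := k) (A := A)
    (G := G))).finrank_eq]
  have : Module.Free k (traceFun k A) := Module.Free.of_divisionRing k (traceFun k A)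
  have : Module.Finite k (traceFun k A) := inferInstance
  rw [Module.finrank_pi_fintype]
  simp

end Cyclic

theorem finrank_charFun_eq {k : Type u} [Field k] [IsAlgClosed k] {p : ℕ} (hp : 0 < p) [CharP k p]
    {A B : Type u} [Ring A] [Ring B] [Algebra k A] [Algebra k B]
    [FiniteDimensional k A] [FiniteDimensional k B]
    (h : IsStablyEquivalentOfMoritaType k A B)
    (h' : IsStablyEquivalentOfMoritaType k
      (TensorProduct k A (MonoidAlgebra k (Multiplicative (ZMod p))))
      (TensorProduct k B (MonoidAlgebra k (Multiplicative (ZMod p))))) :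
    Module.finrank k (charFun k A) = Module.finrank k (charFun k B) := by
  obtain ⟨W⟩ := h
  obtain ⟨W'⟩ := h'
  have : NeZero p := ⟨hp.ne'⟩
  have hG : (Fintype.card (Multiplicative (ZMod p)) : k) = 0 := by simp
  have : FiniteDimensional k (MonoidAlgebra k (Multiplicative (ZMod p))) :=
    (MonoidAlgebra.basis _ k).finiteDimensional_of_finite
  have h1 := W'.finrank_traceFun_add
  rw [projFun_tensor_monoidAlgebra hG, projFun_tensor_monoidAlgebra hG, finrank_bot, finrank_bot,
    finrank_traceFun_tensor_monoidAlgebra, finrank_traceFun_tensor_monoidAlgebra] at h1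
  simp only [Fintype.card_multiplicative, ZMod.card, add_zero] at h1
  have h2 := Nat.eq_of_mul_eq_mul_left hp h1
  have h3 := W.finrank_traceFun_add
  have h4 := W.finrank_charFun_add
  lia

end Counting

section

namespace WedderburnData

variable {k R : Type*} [Field k] [Ring R] [Algebra k R] (D : WedderburnData k R)

/-- The left ideal of elements whose first column in the `i`-th block vanishes. -/
def colIdeal (i : Fin D.n) : Ideal R where
  carrier := {a | ∀ s, D.g a i s 0 = 0}
  add_mem' := fun h h' s => by simp [h s, h' s]
  zero_mem' := fun s => by simp
  smul_mem' := fun c x h s => by simp [Matrix.mul_apply, show ∀ j, D.g x i j 0 = 0 from h]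

theorem mem_colIdeal {i : Fin D.n} {a : R} : a ∈ D.colIdeal i ↔ ∀ s, D.g a i s 0 = 0 := Iff.rfl

theorem isCoatom_colIdeal (i : Fin D.n) : IsCoatom (D.colIdeal i) := by
  refine ⟨fun h => ?_, fun J hJ => ?_⟩
  · have : (1 : R) ∈ D.colIdeal i := h ▸ Submodule.mem_top
    simpa using this 0
  · obtain ⟨a, haJ, ha⟩ := SetLike.exists_of_lt hJ
    rw [mem_colIdeal, not_forall] at ha
    obtain ⟨s, hs⟩ := ha
    rw [Ideal.eq_top_iff_one]
    have h1 : 1 - ((D.g a i s 0)⁻¹ • D.unit i 0 s) * a ∈ D.colIdeal i := by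
      intro t
      by_cases ht : t = 0
      · subst ht
        simp [g_unit, hs]
      · simp [g_unit, ht, Matrix.single_mul_apply_of_ne]
    have h2 := J.mul_mem_left ((D.g a i s 0)⁻¹ • D.unit i 0 s) haJ
    simpa using J.add_mem (hJ.le h1) h2

instance (i : Fin D.n) : IsSimpleModule R (R ⧸ D.colIdeal i) :=
  isSimpleModule_iff_isCoatom.2 (D.isCoatom_colIdeal i)

theorem exists_equiv_quotient_colIdeal {X : Type*} [AddCommGroup X] [Module R X] [IsSimpleModule R X] :
    ∃ i, Nonempty ((R ⧸ D.colIdeal i) ≃ₗ[R] X) := by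
  have := IsSimpleModule.nontrivial R X
  obtain ⟨y, hy⟩ := exists_ne (0 : X)
  have hJ : ∀ a ∈ Ring.jacobson R, ∀ x : X, a • x = 0 := by
    intro a ha x
    have h := Ring.jacobson_smul_top_le R X (Submodule.smul_mem_smul ha (Submodule.mem_top (x := x)))
    rwa [IsSemisimpleModule.jacobson_eq_bot, Submodule.mem_bot] at h
  have hg : ∀ {a b : R} (x : X), D.g a = D.g b → a • x = b • x := fun x h => by
    rw [← sub_eq_zero, ← sub_smul]
    exact hJ _ (D.sub_mem h) x
  have h1 : ∑ i, ∑ s, D.unit i s s • y = y := by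
    simp_rw [← Finset.sum_smul]
    refine (hg y ?_).trans (one_smul R y)
    simp only [map_sum, g_unit, map_one]
    have h2 : ∀ i : Fin D.n, ∑ s, Pi.single i (Matrix.single s s 1) =
        (Pi.single i 1 : (i : Fin D.n) → Matrix (Fin (D.d i)) (Fin (D.d i)) k) := fun i => by
      rw [← Matrix.sum_single_one]
      exact (map_sum (AddMonoidHom.single
        (fun i : Fin D.n => Matrix (Fin (D.d i)) (Fin (D.d i)) k) i) _ _).symm
    simp_rw [h2]
    exact Finset.univ_sum_single (1 : (i : Fin D.n) → Matrix (Fin (D.d i)) (Fin (D.d i)) k)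
  obtain ⟨i, -, hi⟩ := Finset.exists_ne_zero_of_sum_ne_zero (h1.trans_ne hy)
  obtain ⟨s, -, hs⟩ := Finset.exists_ne_zero_of_sum_ne_zero hi
  let f : R →ₗ[R] X := LinearMap.toSpanSingleton R X (D.unit i 0 s • y)
  have hf : D.unit i 0 s • y ≠ 0 := fun h => hs (by
    rw [← hg y (show D.g (D.unit i s 0 * D.unit i 0 s) = _ by
      rw [map_mul]; simp [g_unit, ← Pi.single_mul]), mul_smul, h, smul_zero])
  have hle : D.colIdeal i ≤ LinearMap.ker f := by
    intro a ha
    rw [LinearMap.mem_ker, LinearMap.toSpanSingleton_apply, ← mul_smul]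
    refine (hg y ?_).trans (zero_smul R y)
    rw [map_mul, g_unit, map_zero]
    ext j t t'
    by_cases hj : j = i
    · subst hj
      by_cases ht : t' = s
      · subst ht
        simp [show D.g a j t 0 = 0 from ha t]
      · simp [ht, Matrix.mul_single_apply_of_ne]
    · simp [Pi.single_eq_of_ne hj]
  have hker : LinearMap.ker f = D.colIdeal i := by
    refine ((D.isCoatom_colIdeal i).le_iff.1 hle).resolve_left fun h => hf ?_
    have : (1 : R) ∈ LinearMap.ker f := h ▸ Submodule.mem_top
    simpa [f] using this
  exact ⟨i, ⟨(Submodule.quotEquivOfEq _ _ hker.symm).trans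
    (f.quotKerEquivOfSurjective (IsSimpleModule.toSpanSingleton_surjective R hf))⟩⟩

theorem eq_of_equiv {i j : Fin D.n} (e : (R ⧸ D.colIdeal i) ≃ₗ[R] (R ⧸ D.colIdeal j)) : i = j := by
  by_contra hij
  have h1 : D.unit i 0 0 • (Submodule.Quotient.mk 1 : R ⧸ D.colIdeal i) = 0 := by
    apply e.injective
    rw [map_smul, map_zero]
    obtain ⟨a, ha⟩ := Submodule.Quotient.mk_surjective _ (e (Submodule.Quotient.mk 1))
    rw [← ha, ← Submodule.Quotient.mk_smul, Submodule.Quotient.mk_eq_zero]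
    intro s
    simp [g_unit, Pi.single_eq_of_ne (Ne.symm hij)]
  rw [← Submodule.Quotient.mk_smul, Submodule.Quotient.mk_eq_zero] at h1
  simpa [g_unit] using h1 0

theorem nonempty_nonProjSimpleClasses_equiv :
    Nonempty ({i // ¬ Module.Projective R (R ⧸ D.colIdeal i)} ≃ NonProjSimpleClasses R) := by
  refine ⟨Equiv.ofBijective
    (fun i => Quot.mk _ ⟨D.colIdeal i.1, D.isCoatom_colIdeal i.1, i.2⟩) ⟨fun i j h => ?_, ?_⟩⟩
  · have hequiv : Equivalence
        (fun (I J : {I : Ideal R // IsCoatom I ∧ ¬ Module.Projective R (R ⧸ (I : Ideal R))}) =>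
        Nonempty ((R ⧸ (I : Ideal R)) ≃ₗ[R] (R ⧸ (J : Ideal R)))) :=
      ⟨fun _ => ⟨.refl _ _⟩, fun ⟨e⟩ => ⟨e.symm⟩, fun ⟨e⟩ ⟨e'⟩ => ⟨e.trans e'⟩⟩
    obtain ⟨e⟩ := (Equivalence.eqvGen_iff hequiv).1 (Quot.eqvGen_exact h)
    exact Subtype.ext (D.eq_of_equiv e)
  · rintro ⟨I, hI, hI'⟩
    have : IsSimpleModule R (R ⧸ I) := isSimpleModule_iff_isCoatom.2 hI
    obtain ⟨i, ⟨e⟩⟩ := D.exists_equiv_quotient_colIdeal (X := R ⧸ I)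
    exact ⟨⟨i, fun h => hI' (Module.Projective.of_equiv e)⟩, Quot.sound ⟨e⟩⟩

end WedderburnData

theorem nonempty_nonProjSimpleClasses_equiv_of_card_eq {k A B : Type*} [Field k] [Ring A]
    [Algebra k A] [Ring B] [Algebra k B] (D : WedderburnData k A) (D' : WedderburnData k B)
    (hn : D.n = D'.n)
    (hr : Nat.card {i // Module.Projective A (A ⧸ D.colIdeal i)} =
      Nat.card {i // Module.Projective B (B ⧸ D'.colIdeal i)}) :
    Nonempty (NonProjSimpleClasses A ≃ NonProjSimpleClasses B) := by
  classical
  obtain ⟨e⟩ := D.nonempty_nonProjSimpleClasses_equiv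
  obtain ⟨e'⟩ := D'.nonempty_nonProjSimpleClasses_equiv
  refine ⟨e.symm.trans (.trans (Fintype.equivOfCardEq ?_) e')⟩
  simp only [Nat.card_eq_fintype_card] at hr
  rw [Fintype.card_subtype_compl, Fintype.card_subtype_compl, hr, Fintype.card_fin,
    Fintype.card_fin, hn]

end

section StableCategory

variable {R X Y Z Z' : Type u} [Ring R] [AddCommGroup X] [Module R X] [AddCommGroup Y] [Module R Y]
  [AddCommGroup Z] [Module R Z] [AddCommGroup Z'] [Module R Z']

/-- A linear map is stably zero if it factors through a projective module. -/
def StabZero (f : X →ₗ[R] Y) : Prop :=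
  ∃ (F : Type u) (_ : AddCommGroup F) (_ : Module R F), Module.Projective R F ∧
    ∃ (a : X →ₗ[R] F) (b : F →ₗ[R] Y), b ∘ₗ a = f

/-- A linear map is stably split if it has a right inverse up to stably zero maps. -/
def StabSplit (g : Y →ₗ[R] Z) : Prop := ∃ s : Z →ₗ[R] Y, StabZero (g ∘ₗ s - LinearMap.id)

/-- A module is stably simple if it is stably nonzero and every map into it is stably zero
or stably split. -/
def IsStablySimple (R Z : Type u) [Ring R] [AddCommGroup Z] [Module R Z] : Prop :=
  ¬ StabZero (LinearMap.id : Z →ₗ[R] Z) ∧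
    ∀ (Y : Type u) [AddCommGroup Y] [Module R Y] (g : Y →ₗ[R] Z), StabZero g ∨ StabSplit g

theorem stabZero_of_projective_right [Module.Projective R Y] (f : X →ₗ[R] Y) : StabZero f :=
  ⟨Y, _, _, inferInstance, f, LinearMap.id, rfl⟩

namespace StabZero

theorem comp_left {f : X →ₗ[R] Y} (hf : StabZero f) (g : Y →ₗ[R] Z) : StabZero (g ∘ₗ f) := by
  obtain ⟨F, _, _, hF, a, b, rfl⟩ := hf
  exact ⟨F, _, _, hF, a, g ∘ₗ b, rfl⟩

theorem comp_right {g : Y →ₗ[R] Z} (hg : StabZero g) (f : X →ₗ[R] Y) : StabZero (g ∘ₗ f) := by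
  obtain ⟨F, _, _, hF, a, b, rfl⟩ := hg
  exact ⟨F, _, _, hF, a ∘ₗ f, b, rfl⟩

theorem add {f g : X →ₗ[R] Y} (hf : StabZero f) (hg : StabZero g) : StabZero (f + g) := by
  obtain ⟨F, _, _, hF, a, b, rfl⟩ := hf
  obtain ⟨F', _, _, hF', a', b', rfl⟩ := hg
  exact ⟨F × F', _, _, inferInstance, a.prod a', b.coprod b', by ext; simp⟩

theorem neg {f : X →ₗ[R] Y} (hf : StabZero f) : StabZero (-f) := by
  obtain ⟨F, _, _, hF, a, b, rfl⟩ := hf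
  exact ⟨F, _, _, hF, a, -b, by ext; simp⟩

theorem sub {f g : X →ₗ[R] Y} (hf : StabZero f) (hg : StabZero g) : StabZero (f - g) := by
  rw [sub_eq_add_neg]
  exact hf.add hg.neg

theorem exists_lift {f : X →ₗ[R] Z} (hf : StabZero f) (q : Y →ₗ[R] Z)
    (hq : Function.Surjective q) : ∃ l : X →ₗ[R] Y, q ∘ₗ l = f := by
  obtain ⟨F, _, _, hF, a, b, rfl⟩ := hf
  obtain ⟨l, hl⟩ := Module.projective_lifting_property q b hq
  exact ⟨l ∘ₗ a, by rw [← LinearMap.comp_assoc, hl]⟩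

end StabZero

theorem StabSplit.exists_section {g : Y →ₗ[R] Z} (hg : StabSplit g) (hs : Function.Surjective g) :
    ∃ s : Z →ₗ[R] Y, g ∘ₗ s = LinearMap.id := by
  obtain ⟨s, h⟩ := hg
  obtain ⟨l, hl⟩ := h.exists_lift g hs
  exact ⟨s - l, by rw [LinearMap.comp_sub, hl, sub_sub_cancel]⟩

theorem IsStablySimple.exists_comp_not_stabZero (hX : IsStablySimple R X) (hZ : IsStablySimple R Z)
    {g : X →ₗ[R] Z} (hg : ¬ StabZero g) {h : X →ₗ[R] Z'} (hh : ¬ StabZero h) :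
    ∃ f : Z →ₗ[R] Z', ¬ StabZero f := by
  obtain ⟨s, hs⟩ := (hZ.2 _ g).resolve_left hg
  have hs0 : ¬ StabZero s := fun h0 => hZ.1 (by
    simpa using (h0.comp_left g).sub hs)
  obtain ⟨r, hr⟩ := (hX.2 _ s).resolve_left hs0
  refine ⟨h ∘ₗ s, fun h0 => hh ?_⟩
  have := (h0.comp_right r).sub (hr.comp_left h)
  rw [LinearMap.comp_sub, LinearMap.comp_assoc, LinearMap.comp_id, sub_sub_cancel] at this
  exact this

end StableCategory

section

open MulOpposite

namespace RelTensor

variable {R S N Y : Type*} [Ring R] [AddCommGroup N] [Module Rᵐᵒᵖ N]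
    [AddCommGroup Y] [Module R Y] [Ring S] [Module S N] [SMulCommClass S Rᵐᵒᵖ N]

/-- The map `n ↦ n ⊗ y`. -/
def tmLeft (S : Type*) {N Y : Type*} [AddCommGroup N] [Module Rᵐᵒᵖ N]
    [AddCommGroup Y] [Module R Y] [Ring S] [Module S N] [SMulCommClass S Rᵐᵒᵖ N] (y : Y) :
    N →ₗ[S] RelTensor R N Y where
  toFun n := tm R n y
  map_add' n n' := add_tm n n' y
  map_smul' s n := (smul_tm s n y).symm

@[simp] theorem tmLeft_apply (n : N) (y : Y) : tmLeft S y n = tm R n y := rfl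

theorem projective_of_projective [Module.Projective S N] [Module.Projective R Y] :
    Module.Projective S (RelTensor R N Y) := by
  classical
  obtain ⟨s, hs⟩ := Module.projective_def.1 (inferInstance : Module.Projective R Y)
  let φ : N →+ R →+ N := AddMonoidHom.mk' (fun n => AddMonoidHom.mk' (fun r => op r • n)
    (fun r r' => by simp [add_smul])) (fun n n' => by ext; simp)
  let f : RelTensor R N Y →ₗ[S] (Y →₀ N) := liftL
    (AddMonoidHom.mk' (fun n => (Finsupp.mapRange.addMonoidHom (φ n)).comp s.toAddMonoidHom)
      (fun n n' => by ext; simp))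
    (fun r n y => by ext; simp [φ, smul_smul])
    (fun t n y => by ext; simp [φ, smul_comm t])
  let b : (Y →₀ N) →ₗ[S] RelTensor R N Y := Finsupp.lsum ℕ (fun y => tmLeft S y)
  have : Module.Projective S (Y →₀ N) :=
    .of_equiv (finsuppLequivDFinsupp (ι := Y) (M := N) S).symm
  refine Module.Projective.of_split f b (hom_ext fun n y => ?_)
  have h1 : f (tm R n y) = (s y).mapRange (φ n) (map_zero _) := rfl
  rw [LinearMap.comp_apply, h1, LinearMap.id_apply]
  simp only [b, Finsupp.lsum_apply]
  rw [Finsupp.sum_mapRange_index (by simp)]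
  conv_rhs => rw [← hs y, Finsupp.linearCombination_apply, Finsupp.sum, tm_sum]
  refine Finset.sum_congr rfl fun x _ => ?_
  simp [φ, tm_smul]

section Env

open TensorProduct

theorem projective_of_env {k A P Y : Type*} [Field k] [Ring A] [Algebra k A] [AddCommGroup P]
    [Module (A ⊗[k] Aᵐᵒᵖ) P] [Module A P] [Module Aᵐᵒᵖ P] [SMulCommClass A Aᵐᵒᵖ P]
    [AddCommGroup Y] [Module A Y] [Module k Y] [IsScalarTower k A Y]
    (hl : ∀ (a : A) (x : P), a • x = (a ⊗ₜ[k] (1 : Aᵐᵒᵖ)) • x)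
    (hr : ∀ (a : Aᵐᵒᵖ) (x : P), a • x = ((1 : A) ⊗ₜ[k] a) • x)
    [Module.Projective (A ⊗[k] Aᵐᵒᵖ) P] : Module.Projective A (RelTensor A P Y) := by
  classical
  obtain ⟨s, hs⟩ := Module.projective_def.1
    (inferInstance : Module.Projective (A ⊗[k] Aᵐᵒᵖ) P)
  let ev : Y →ₗ[k] Aᵐᵒᵖ →ₗ[k] Y := LinearMap.mk₂ k (fun y v => unop v • y)
    (fun y y' v => by simp) (fun c y v => by rw [smul_comm])
    (fun y v v' => by simp [add_smul]) (fun c y v => by simp)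
  let φ : Y →+ A ⊗[k] Aᵐᵒᵖ →+ A ⊗[k] Y := AddMonoidHom.mk'
    (fun y => (TensorProduct.map LinearMap.id (ev y)).toAddMonoidHom)
    (fun y y' => by ext z; simp [TensorProduct.map_add_right])
  have hφ : ∀ y u v, φ y (u ⊗ₜ v) = u ⊗ₜ (unop v • y) := fun y u v => rfl
  have hφl : ∀ y a z, φ y ((a ⊗ₜ[k] (1 : Aᵐᵒᵖ)) * z) = a • φ y z := by
    intro y a z
    induction z using TensorProduct.induction_on with
    | zero => simp
    | tmul u v => simp [hφ, TensorProduct.smul_tmul']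
    | add x y hx hy => simp [mul_add, hx, hy]
  have hφr : ∀ y (a : A) z, φ y (((1 : A) ⊗ₜ[k] op a) * z) = φ (a • y) z := by
    intro y a z
    induction z using TensorProduct.induction_on with
    | zero => simp
    | tmul u v => simp [hφ, mul_smul]
    | add x y hx hy => simp [mul_add, hx, hy]
  let f : RelTensor A P Y →ₗ[A] (P →₀ A ⊗[k] Y) := liftL
    (AddMonoidHom.mk' (fun n => AddMonoidHom.mk' (fun y => (s n).mapRange (φ y) (map_zero _))
      (fun y y' => by ext; simp)) (fun n n' => by ext y x; simp))
    (fun r n y => by ext; simp [hr, hφr])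
    (fun t n y => by ext; simp [hl, hφl])
  have hk : ∀ (c : k) (x : P), algebraMap k A c • x = op (algebraMap k A c) • x := by
    intro c x
    rw [hl, hr, ← MulOpposite.algebraMap_apply, Algebra.algebraMap_eq_smul_one,
      Algebra.algebraMap_eq_smul_one, TensorProduct.tmul_smul, TensorProduct.smul_tmul']
  let β₀ (x : P) : A ⊗[k] Y →+ RelTensor A P Y :=
    TensorProduct.liftAddHom ((tmHom A P Y).comp
      ((LinearMap.toSpanSingleton A P x).toAddMonoidHom)) (fun c a y => by
        change tm A ((c • a) • x) y = tm A (a • x) (c • y)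
        rw [← algebraMap_smul A c y, tm_smul, ← hk, smul_smul, Algebra.smul_def])
  let β (x : P) : A ⊗[k] Y →ₗ[A] RelTensor A P Y :=
    { β₀ x with
      map_smul' := fun a z => by
        change β₀ x (a • z) = a • β₀ x z
        induction z using TensorProduct.induction_on with
        | zero => rw [smul_zero, map_zero, smul_zero]
        | tmul u v =>
          change tm A ((a * u) • x) v = a • tm A (u • x) v
          rw [smul_tm, mul_smul]
        | add z z' hz hz' =>
          rw [smul_add, _root_.map_add, _root_.map_add, smul_add]
          exact congrArg₂ (· + ·) hz hz' }
  have hβ : ∀ x a y, β x (a ⊗ₜ y) = tm A (a • x) y := fun _ _ _ => rfl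
  let b : (P →₀ A ⊗[k] Y) →ₗ[A] RelTensor A P Y := Finsupp.lsum ℕ β
  have : Module.Projective A (P →₀ A ⊗[k] Y) :=
    .of_equiv (finsuppLequivDFinsupp (ι := P) (M := A ⊗[k] Y) A).symm
  refine Module.Projective.of_split f b (hom_ext fun n y => ?_)
  have h1 : f (tm A n y) = (s n).mapRange (φ y) (map_zero _) := rfl
  rw [LinearMap.comp_apply, h1, LinearMap.id_apply]
  simp only [b, Finsupp.lsum_apply]
  rw [Finsupp.sum_mapRange_index (by simp)]
  conv_rhs => rw [← hs n, Finsupp.linearCombination_apply, Finsupp.sum, sum_tm]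
  refine Finset.sum_congr rfl fun x _ => ?_
  change β x (φ y (s n x)) = tm A (s n x • x) y
  generalize s n x = z
  induction z using TensorProduct.induction_on with
  | zero => rw [map_zero, map_zero, zero_smul (A ⊗[k] Aᵐᵒᵖ) x, zero_tm]
  | tmul u v =>
    rw [hφ, hβ, tm_smul, op_unop, hr, hl, smul_smul]
    simp
  | add z z' hz hz' => rw [_root_.map_add, _root_.map_add, hz, hz', add_smul, add_tm]

end Env

end RelTensor

end

section

open MulOpposite

namespace RelTensor

/-- Universal property of an iterated tensor product. -/
def lift₂ {R S T M N Y Z : Type*} [Ring R] [Ring S] [Ring T] [AddCommGroup M] [Module T M]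
    [Module Sᵐᵒᵖ M] [SMulCommClass T Sᵐᵒᵖ M] [AddCommGroup N] [Module S N] [Module Rᵐᵒᵖ N]
    [SMulCommClass S Rᵐᵒᵖ N] [AddCommGroup Y] [Module R Y] [AddCommGroup Z] [Module T Z]
    (f : M →+ N →+ Y →+ Z) (h₁ : ∀ m (a : R) n y, f m (op a • n) y = f m n (a • y))
    (h₂ : ∀ (b : S) m n y, f (op b • m) n y = f m (b • n) y)
    (h₃ : ∀ (t : T) m n y, f (t • m) n y = t • f m n y) :
    RelTensor S M (RelTensor R N Y) →ₗ[T] Z :=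
  liftL (AddMonoidHom.mk' (fun m => lift (f m) (h₁ m))
      (fun m m' => hom_ext fun n y => by simp))
    (fun b m t => by
      have : lift (f (op b • m)) (h₁ _) = (lift (f m) (h₁ m)).comp
          (DistribSMul.toAddMonoidHom _ b) := hom_ext fun n y => by simp [h₂]
      exact DFunLike.congr_fun this t)
    (fun b m t => by
      have : lift (f (b • m)) (h₁ _) = (DistribSMul.toAddMonoidHom _ b).comp
          (lift (f m) (h₁ m)) := hom_ext fun n y => by simp [h₃]
      exact DFunLike.congr_fun this t)

@[simp] theorem lift₂_tm {R S T M N Y Z : Type*} [Ring R] [Ring S] [Ring T] [AddCommGroup M]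
    [Module T M] [Module Sᵐᵒᵖ M] [SMulCommClass T Sᵐᵒᵖ M] [AddCommGroup N] [Module S N]
    [Module Rᵐᵒᵖ N] [SMulCommClass S Rᵐᵒᵖ N] [AddCommGroup Y] [Module R Y] [AddCommGroup Z]
    [Module T Z] (f : M →+ N →+ Y →+ Z) (h₁ h₂) (h₃ : ∀ (t : T) m n y, f (t • m) n y = t • f m n y)
    (m : M) (n : N) (y : Y) :
    lift₂ (R := R) (S := S) f h₁ h₂ h₃ (tm S m (tm R n y)) = f m n y :=
  (liftL_tm _ _ _ _ _).trans (lift_tm (f m) (h₁ m) n y)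

theorem hom_ext₂ {R S T M N Y Z : Type*} [Ring R] [Ring S] [Ring T] [AddCommGroup M] [Module T M]
    [Module Sᵐᵒᵖ M] [SMulCommClass T Sᵐᵒᵖ M] [AddCommGroup N] [Module S N] [Module Rᵐᵒᵖ N]
    [SMulCommClass S Rᵐᵒᵖ N] [AddCommGroup Y] [Module R Y] [AddCommGroup Z] [Module T Z]
    {f g : RelTensor S M (RelTensor R N Y) →ₗ[T] Z}
    (h : ∀ m n y, f (tm S m (tm R n y)) = g (tm S m (tm R n y))) : f = g := by
  refine hom_ext fun m t => ?_
  induction t using induct with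
  | h0 => simp
  | ht n y => exact h m n y
  | ha a b ha hb => rw [tm_add, _root_.map_add, _root_.map_add, ha, hb]

end RelTensor

namespace StableMoritaWitness

open RelTensor

variable {k A B : Type u} [Field k] [Ring A] [Ring B] [Algebra k A] [Algebra k B]
  (W : StableMoritaWitness k A B) (Y : Type u) [AddCommGroup Y] [Module A Y]

/-- The counit-like map `M ⊗ N ⊗ Y → Y`. -/
noncomputable def prj : RelTensor B W.M (RelTensor A W.N Y) →ₗ[A] Y :=
  lift₂ (AddMonoidHom.mk' (fun m => AddMonoidHom.mk' (fun n =>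
      AddMonoidHom.mk' (fun y => W.ang m n • y) (fun y y' => smul_add _ y y'))
      (fun n n' => by ext; simp [add_smul]))
      (fun m m' => by ext; simp [add_smul]))
    (fun m a n y => by simp [ang_op_smul, mul_smul])
    (fun b m n y => by simp [ang_bal])
    (fun a m n y => by simp [ang_smul, mul_smul])

@[simp] theorem prj_tm (m : W.M) (n : W.N) (y : Y) :
    W.prj Y (tm B m (tm A n y)) = W.ang m n • y := by
  simp [prj]

/-- The unit-like map `Y → M ⊗ N ⊗ Y`. -/
noncomputable def inj : Y →ₗ[A] RelTensor B W.M (RelTensor A W.N Y) where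
  toFun y := ∑ i, tm B (W.me i) (tm A (W.ne i) y)
  map_add' y y' := by simp [tm_add, Finset.sum_add_distrib]
  map_smul' a y := by
    simp only [tm_smul (R := A), RingHom.id_apply, Finset.smul_sum, smul_tm]
    exact (W.sum_central (AddMonoidHom.mk' (fun m => AddMonoidHom.mk'
      (fun n => tm B m (tm A n y)) (fun n n' => by rw [add_tm, tm_add]))
      (fun m m' => by ext; simp [add_tm])) (fun b m n => by
        change tm B _ _ = tm B m (tm A (b • n) y)
        rw [← smul_tm b n y, tm_smul]) a).symm

theorem inj_apply (y : Y) : W.inj Y y = ∑ i, tm B (W.me i) (tm A (W.ne i) y) := rfl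

theorem prj_inj : W.prj Y ∘ₗ W.inj Y = LinearMap.id := by
  ext y
  simp [inj_apply, map_sum, ← Finset.sum_smul, sum_ang]

/-- Right multiplication as a left linear map. -/
noncomputable def rmul (a : A) : W.N →ₗ[B] W.N where
  toFun n := op a • n
  map_add' := smul_add _
  map_smul' b n := (smul_comm b (op a) n).symm

theorem th_map_rmul (a : A) (t : RelTensor B W.M W.N) :
    W.th (map A W.M (W.rmul a) t) = op a • W.th t := by
  induction t using RelTensor.induct with
  | h0 => simp
  | ht m n => rw [map_tm]; exact W.th_right a m n
  | ha x y hx hy => rw [_root_.map_add, _root_.map_add, hx, hy, _root_.map_add, smul_add]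

theorem projective_P_tensor : Module.Projective A (RelTensor A W.P Y) := by
  let _ : Module k Y := Module.compHom Y (algebraMap k A)
  have : IsScalarTower k A Y := ⟨fun c a y => by
    rw [Algebra.smul_def, mul_smul]; rfl⟩
  exact RelTensor.projective_of_env (k := k) (fun _ _ => rfl) (fun _ _ => rfl)

/-- The projection onto the projective part. -/
noncomputable def fwd : RelTensor B W.M (RelTensor A W.N Y) →ₗ[A] RelTensor A W.P Y :=
  lift₂ (AddMonoidHom.mk' (fun m => AddMonoidHom.mk' (fun n =>
      AddMonoidHom.mk' (fun y => tm A (W.angP m n) y) (fun y y' => tm_add _ y y'))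
      (fun n n' => by ext; simp [add_tm]))
      (fun m m' => by ext; simp [add_tm]))
    (fun m a n y => by simp [angP_op_smul, tm_smul])
    (fun b m n y => by simp [angP_bal])
    (fun a m n y => by simp [angP_smul])

/-- The inclusion of the projective part. -/
noncomputable def back : RelTensor A W.P Y →ₗ[A] RelTensor B W.M (RelTensor A W.N Y) :=
  liftL (AddMonoidHom.mk' (fun p => AddMonoidHom.mk'
      (fun y => map A W.M (tmLeft B y) (W.thL.symm (0, p)))
      (fun y y' => by
        have : (tmLeft B (y + y') : W.N →ₗ[B] RelTensor A W.N Y) = tmLeft B y + tmLeft B y' := by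
          ext n; simp [tm_add]
        rw [this, RelTensor.map_add]; rfl))
      (fun p p' => by
        ext y
        have : ((0 : A), p + p') = (0, p) + (0, p') := by simp
        change map A W.M (tmLeft B y) (W.thL.symm (0, p + p')) =
          map A W.M (tmLeft B y) (W.thL.symm (0, p)) + map A W.M (tmLeft B y) (W.thL.symm (0, p'))
        rw [this, _root_.map_add, _root_.map_add]))
    (fun a p y => by
      change map A W.M (tmLeft B y) (W.thL.symm (0, op a • p)) =
        map A W.M (tmLeft B (a • y)) (W.thL.symm (0, p))
      have h1 : W.thL.symm (0, op a • p) = map A W.M (W.rmul a) (W.thL.symm (0, p)) := by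
        apply W.thL.injective
        rw [LinearEquiv.apply_symm_apply]
        have := W.th_map_rmul a (W.thL.symm (0, p))
        refine Eq.trans ?_ this.symm
        have h2 : W.th (W.thL.symm (0, p)) = (0, p) := W.thL.apply_symm_apply (0, p)
        rw [h2]
        simp
      have h3 : (tmLeft B (a • y) : W.N →ₗ[B] RelTensor A W.N Y) = tmLeft B y ∘ₗ W.rmul a := by
        ext n; simp [tm_smul, rmul]
      rw [h1, h3, RelTensor.map_comp]; rfl)
    (fun a p y => by
      change map A W.M (tmLeft B y) (W.thL.symm (0, a • p)) =
        a • map A W.M (tmLeft B y) (W.thL.symm (0, p))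
      have : ((0 : A), a • p) = a • (0, p) := by simp
      rw [this, _root_.map_smul, _root_.map_smul])

theorem back_tm (p : W.P) (y : Y) :
    W.back Y (tm A p y) = map A W.M (tmLeft B y) (W.thL.symm (0, p)) := by
  simp [back]

theorem inj_prj_add : W.inj Y ∘ₗ W.prj Y + W.back Y ∘ₗ W.fwd Y = LinearMap.id := by
  refine hom_ext₂ fun m n y => ?_
  have h1 : W.fwd Y (tm B m (tm A n y)) = tm A (W.angP m n) y := by simp [fwd]
  have h2 : W.inj Y (W.ang m n • y) = map A W.M (tmLeft B y) (W.thL.symm (W.ang m n, 0)) := by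
    have : W.thL.symm (W.ang m n, 0) = _ := (W.sum_tm_smul (W.ang m n)).symm
    rw [_root_.map_smul, this, map_sum, inj_apply, Finset.smul_sum]
    refine Finset.sum_congr rfl fun i _ => ?_
    rw [smul_tm, map_tm]; rfl
  rw [LinearMap.add_apply, LinearMap.comp_apply, LinearMap.comp_apply, h1, back_tm, prj_tm, h2,
    ← _root_.map_add, ← _root_.map_add, Prod.mk_add_mk, add_zero, zero_add, LinearMap.id_apply,
    show W.thL.symm (W.ang m n, W.angP m n) = tm B m n from W.th.symm_apply_apply (tm B m n),
    map_tm]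
  rfl

theorem stabZero_sub_inj_prj : StabZero (W.inj Y ∘ₗ W.prj Y - LinearMap.id) := by
  have := W.projective_P_tensor Y
  refine StabZero.comp_left (stabZero_of_projective_right (W.fwd Y)) (-W.back Y) |> fun h => ?_
  convert h using 1
  rw [← W.inj_prj_add Y, LinearMap.neg_comp]
  abel

end StableMoritaWitness

end

section

open MulOpposite

namespace RelTensor

variable {R S N Y Y' Y'' : Type*} [Ring R] [AddCommGroup N] [Module Rᵐᵒᵖ N]
    [AddCommGroup Y] [Module R Y] [AddCommGroup Y'] [Module R Y'] [AddCommGroup Y''] [Module R Y'']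
    [Ring S] [Module S N] [SMulCommClass S Rᵐᵒᵖ N]

theorem map_injective [Module.Projective Rᵐᵒᵖ N] {f : Y →ₗ[R] Y'} (hf : Function.Injective f) :
    Function.Injective (map S N f) := by
  classical
  obtain ⟨s, hs⟩ := Module.projective_def.1 (inferInstance : Module.Projective Rᵐᵒᵖ N)
  let σ : ∀ (X : Type _) [AddCommGroup X] [Module R X], RelTensor R N X →+ (N →₀ X) :=
    fun X _ _ => lift (AddMonoidHom.mk' (fun n => AddMonoidHom.mk'
        (fun x => (s n).mapRange (fun r => unop r • x) (by simp)) (fun x x' => by ext; simp))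
        (fun n n' => by ext; simp [add_smul]))
      (fun r n y => by ext; simp [mul_smul])
  let b : (N →₀ Y) →+ RelTensor R N Y := Finsupp.liftAddHom (tmHom R N Y)
  have hb : ∀ t, b (σ Y t) = t := by
    intro t
    induction t using induct with
    | h0 => simp
    | ht n y =>
      change ((s n).mapRange (fun r => unop r • y) (by simp)).sum (fun x z => tm R x z) = _
      rw [Finsupp.sum_mapRange_index (by simp)]
      conv_rhs => rw [← hs n, Finsupp.linearCombination_apply, Finsupp.sum, sum_tm]
      exact Finset.sum_congr rfl fun x _ => tm_smul x (unop (s n x)) y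
    | ha x y hx hy => rw [_root_.map_add, _root_.map_add, hx, hy]
  let σ' : RelTensor R N Y' →+ (N →₀ Y') :=
    lift (AddMonoidHom.mk' (fun n => AddMonoidHom.mk'
        (fun x => (s n).mapRange (fun r => unop r • x) (by simp)) (fun x x' => by ext; simp))
        (fun n n' => by ext; simp [add_smul]))
      (fun r n y => by ext; simp [mul_smul])
  have hn : ∀ t, σ' (map S N f t) = Finsupp.mapRange f (map_zero f) (σ Y t) := by
    intro t
    induction t using induct with
    | h0 => simp
    | ht n y =>
      rw [map_tm]
      ext x
      change unop (s n x) • f y = f (unop (s n x) • y)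
      rw [map_smul]
    | ha x y hx hy =>
      rw [_root_.map_add, _root_.map_add, hx, hy, _root_.map_add, Finsupp.mapRange_add]
      exact fun _ _ => _root_.map_add f _ _
  intro t t' h
  rw [← hb t, ← hb t']
  congr 1
  apply Finsupp.mapRange_injective f (map_zero f) hf
  rw [← hn, ← hn, h]

theorem ker_map_le_range_map {j : Y →ₗ[R] Y'} {q : Y' →ₗ[R] Y''} (hq : Function.Surjective q)
    (h : LinearMap.ker q ≤ LinearMap.range j) :
    LinearMap.ker (map S N q) ≤ LinearMap.range (map S N j) := by
  let C := RelTensor R N Y' ⧸ LinearMap.range (map S N j)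
  let π := (LinearMap.range (map S N j)).mkQ
  have hπ : ∀ n y y', q y = q y' → π (tm R n y) = π (tm R n y') := by
    intro n y y' hy
    rw [← sub_eq_zero, ← _root_.map_sub, Submodule.mkQ_apply, Submodule.Quotient.mk_eq_zero]
    obtain ⟨x, hx⟩ := h (show y - y' ∈ LinearMap.ker q by simp [hy])
    refine ⟨tm R n x, ?_⟩
    rw [map_tm, hx, eq_sub_iff_add_eq, ← tm_add, sub_add_cancel]
  let g : RelTensor R N Y'' →+ C :=
    lift (AddMonoidHom.mk' (fun n => AddMonoidHom.mk'
        (fun z => π (tm R n (Function.surjInv hq z))) (fun z z' => by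
          rw [← _root_.map_add, ← tm_add]
          exact hπ _ _ _ (by simp [Function.surjInv_eq])))
        (fun n n' => by ext z; simp [add_tm]))
      (fun r n z => by
        change π (tm R _ _) = π (tm R _ _)
        rw [← tm_smul]
        exact hπ _ _ _ (by simp [Function.surjInv_eq]))
  have hg : ∀ t, g (map S N q t) = π t := by
    intro t
    induction t using induct with
    | h0 => simp
    | ht n y =>
      rw [map_tm]
      exact hπ _ _ _ (Function.surjInv_eq hq _)
    | ha x y hx hy => rw [_root_.map_add, _root_.map_add, hx, hy, _root_.map_add]
  intro t ht
  rw [LinearMap.mem_ker] at ht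
  have := hg t
  rw [ht, _root_.map_zero] at this
  exact (Submodule.Quotient.mk_eq_zero _).1 this.symm

end RelTensor

section

open RelTensor

theorem StabZero.relTensorMap {R S N Y Y' : Type u} [Ring R] [AddCommGroup N] [Module Rᵐᵒᵖ N]
    [AddCommGroup Y] [Module R Y] [AddCommGroup Y'] [Module R Y'] [Ring S] [Module S N]
    [SMulCommClass S Rᵐᵒᵖ N] [Module.Projective S N] {f : Y →ₗ[R] Y'} (hf : StabZero f) :
    StabZero (RelTensor.map S N f) := by
  obtain ⟨F, _, _, hF, a, b, rfl⟩ := hf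
  exact ⟨RelTensor R N F, _, _, projective_of_projective, RelTensor.map S N a,
    RelTensor.map S N b, (RelTensor.map_comp b a).symm⟩

end

namespace StableMoritaWitness

open RelTensor

variable {k A B : Type u} [Field k] [Ring A] [Ring B] [Algebra k A] [Algebra k B]
  (W : StableMoritaWitness k A B) {Y Y' : Type u} [AddCommGroup Y] [Module A Y]
  [AddCommGroup Y'] [Module A Y']

theorem prj_naturality (f : Y →ₗ[A] Y') :
    W.prj Y' ∘ₗ RelTensor.map A W.M (RelTensor.map B W.N f) = f ∘ₗ W.prj Y :=
  hom_ext₂ fun m n y => by simp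

theorem inj_naturality (f : Y →ₗ[A] Y') :
    RelTensor.map A W.M (RelTensor.map B W.N f) ∘ₗ W.inj Y = W.inj Y' ∘ₗ f := by
  ext y
  simp [inj_apply, map_sum]

theorem stabZero_of_stabZero_map {f : Y →ₗ[A] Y'} (hf : StabZero (RelTensor.map B W.N f)) :
    StabZero f := by
  have h1 := (hf.relTensorMap (S := A) (N := W.M)).comp_right (W.inj Y)
  rw [inj_naturality] at h1
  have h2 := h1.comp_left (W.prj Y')
  rwa [← LinearMap.comp_assoc, prj_inj, LinearMap.id_comp] at h2

/-- `prj` for the inverse equivalence. -/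
noncomputable def prj' (Z : Type u) [AddCommGroup Z] [Module B Z] :
    RelTensor A W.N (RelTensor B W.M Z) →ₗ[B] Z := W.symm.prj Z

/-- `inj` for the inverse equivalence. -/
noncomputable def inj' (Z : Type u) [AddCommGroup Z] [Module B Z] :
    Z →ₗ[B] RelTensor A W.N (RelTensor B W.M Z) := W.symm.inj Z

variable {Z Z' : Type u} [AddCommGroup Z] [Module B Z] [AddCommGroup Z'] [Module B Z']

theorem prj'_inj' : W.prj' Z ∘ₗ W.inj' Z = LinearMap.id := W.symm.prj_inj Z

theorem prj'_naturality (f : Z →ₗ[B] Z') :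
    W.prj' Z' ∘ₗ RelTensor.map B W.N (RelTensor.map A W.M f) = f ∘ₗ W.prj' Z :=
  W.symm.prj_naturality f

theorem stabZero_of_stabZero_map' {f : Z →ₗ[B] Z'} (hf : StabZero (RelTensor.map A W.M f)) :
    StabZero f := W.symm.stabZero_of_stabZero_map hf

theorem stabZero_of_prj_comp {X : Type u} [AddCommGroup X] [Module A X]
    {h : X →ₗ[A] RelTensor B W.M (RelTensor A W.N Y)}
    (hh : StabZero (W.prj Y ∘ₗ h)) : StabZero h := by
  have h1 := (hh.comp_left (W.inj Y)).sub ((W.stabZero_sub_inj_prj Y).comp_right h)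
  convert h1 using 1
  rw [LinearMap.sub_comp, LinearMap.id_comp, LinearMap.comp_assoc]
  abel

theorem stabZero_of_comp_inj {X : Type u} [AddCommGroup X] [Module A X]
    {h : RelTensor B W.M (RelTensor A W.N Y) →ₗ[A] X}
    (hh : StabZero (h ∘ₗ W.inj Y)) : StabZero h := by
  have h1 := (hh.comp_right (W.prj Y)).sub ((W.stabZero_sub_inj_prj Y).comp_left h)
  convert h1 using 1
  rw [LinearMap.comp_sub, LinearMap.comp_id, LinearMap.comp_assoc]
  abel

theorem stabZero_of_stabZero_prj_map_inj {h : RelTensor A W.N Y →ₗ[B] RelTensor A W.N Y'}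
    (hh : StabZero (W.prj Y' ∘ₗ RelTensor.map A W.M h ∘ₗ W.inj Y)) : StabZero h :=
  W.stabZero_of_stabZero_map' (W.stabZero_of_comp_inj (W.stabZero_of_prj_comp hh))

theorem isStablySimple_map (hY : IsStablySimple A Y) :
    IsStablySimple B (RelTensor A W.N Y) := by
  refine ⟨fun h => hY.1 (W.stabZero_of_stabZero_map ?_), fun Z _ _ g => ?_⟩
  · rwa [RelTensor.map_id]
  · rcases hY.2 _ (W.prj Y ∘ₗ RelTensor.map A W.M g) with h | ⟨s, hs⟩
    · exact .inl (W.stabZero_of_stabZero_map' (W.stabZero_of_prj_comp h))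
    · right
      have h1 : StabZero (RelTensor.map A W.M g ∘ₗ s - W.inj Y) := by
        apply W.stabZero_of_prj_comp
        rw [LinearMap.comp_sub, prj_inj, ← LinearMap.comp_assoc]
        exact hs
      have h2 := (h1.relTensorMap (S := B) (N := W.N)).comp_left (W.prj' _)
      rw [RelTensor.map_sub, LinearMap.comp_sub, RelTensor.map_comp, ← LinearMap.comp_assoc,
        prj'_naturality] at h2
      have h3 := ((W.stabZero_sub_inj_prj Y).relTensorMap (S := B) (N := W.N)).comp_left (W.prj' _)
      have h4 := (h3.comp_right (W.inj' _))
      rw [RelTensor.map_sub, RelTensor.map_id, LinearMap.comp_sub, LinearMap.comp_id,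
        LinearMap.sub_comp, prj'_inj', RelTensor.map_comp] at h4
      refine ⟨W.prj' Z ∘ₗ RelTensor.map B W.N s ∘ₗ RelTensor.map B W.N (W.prj Y) ∘ₗ W.inj' _, ?_⟩
      convert (h2.comp_right (RelTensor.map B W.N (W.prj Y) ∘ₗ W.inj' _)).add h4 using 1
      rw [LinearMap.sub_comp]
      simp only [LinearMap.comp_assoc]
      abel

end StableMoritaWitness

end

section

section Factorization

variable {R : Type*} [Ring R] {X Y Z : Type*} [AddCommGroup X] [Module R X] [AddCommGroup Y]
  [Module R Y] [AddCommGroup Z] [Module R Z]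

theorem LinearMap.exists_comp_eq_of_ker_le (p : X →ₗ[R] Y) (hp : Function.Surjective p)
    (f : X →ₗ[R] Z) (h : LinearMap.ker p ≤ LinearMap.ker f) : ∃ l : Y →ₗ[R] Z, l ∘ₗ p = f := by
  refine ⟨(LinearMap.ker p).liftQ f h ∘ₗ (p.quotKerEquivOfSurjective hp).symm.toLinearMap, ?_⟩
  ext x
  have : (p.quotKerEquivOfSurjective hp).symm (p x) = (LinearMap.ker p).mkQ x := by
    rw [LinearEquiv.symm_apply_eq]; rfl
  simp [this]

theorem LinearMap.exists_comp_eq_of_range_le (j : X →ₗ[R] Y) (hj : Function.Injective j)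
    (f : Z →ₗ[R] Y) (h : LinearMap.range f ≤ LinearMap.range j) :
    ∃ l : Z →ₗ[R] X, j ∘ₗ l = f := by
  refine ⟨(LinearEquiv.ofInjective j hj).symm.toLinearMap ∘ₗ
    f.codRestrict (LinearMap.range j) (fun z => h ⟨z, rfl⟩), ?_⟩
  ext z
  have := (LinearEquiv.ofInjective j hj).apply_symm_apply
    (f.codRestrict (LinearMap.range j) (fun z => h ⟨z, rfl⟩) z)
  exact congrArg Subtype.val this

end Factorization

section AlmostSplit

variable {R S F : Type u} [Ring R] [AddCommGroup S] [Module R S] [AddCommGroup F] [Module R F]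

/-- A map which is not split injective and through which every map that is not split injective
factors. -/
def IsLeftAlmostSplit (w : S →ₗ[R] F) : Prop :=
  (¬ ∃ ρ : F →ₗ[R] S, ρ ∘ₗ w = LinearMap.id) ∧
    ∀ (Y : Type u) [AddCommGroup Y] [Module R Y] (g : S →ₗ[R] Y),
      (∃ ρ : Y →ₗ[R] S, ρ ∘ₗ g = LinearMap.id) ∨ ∃ h : F →ₗ[R] Y, h ∘ₗ w = g

theorem IsLeftAlmostSplit.isStablySimple [Module.Projective R F] {w : S →ₗ[R] F}
    (hw : IsLeftAlmostSplit w) (hi : Function.Injective w) :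
    IsStablySimple R (F ⧸ LinearMap.range w) := by
  set π := (LinearMap.range w).mkQ with hπ
  have hs : Function.Surjective π := Submodule.mkQ_surjective _
  have hk : ∀ s, π (w s) = 0 := fun s => (Submodule.Quotient.mk_eq_zero _).2 ⟨s, rfl⟩
  have hker : LinearMap.ker π = LinearMap.range w := Submodule.ker_mkQ _
  refine ⟨fun h0 => hw.1 ?_, fun Y _ _ g => ?_⟩
  · obtain ⟨l, hl⟩ := h0.exists_lift π hs
    obtain ⟨ρ, hρ⟩ := LinearMap.exists_comp_eq_of_range_le w hi (LinearMap.id - l ∘ₗ π) (by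
      rintro _ ⟨v, rfl⟩
      refine hker.le (LinearMap.mem_ker.2 ?_)
      have := LinearMap.congr_fun hl (π v)
      simp only [LinearMap.comp_apply, LinearMap.id_apply] at this
      simp [this])
    refine ⟨ρ, LinearMap.ext fun s => hi ?_⟩
    have := LinearMap.congr_fun hρ (w s)
    simpa [hk] using this
  · let Z := LinearMap.ker (g ∘ₗ LinearMap.fst R Y F - π ∘ₗ LinearMap.snd R Y F)
    have hZ : ∀ z : Z, g z.1.1 = π z.1.2 := fun z => sub_eq_zero.1 z.2
    let i : S →ₗ[R] Z := (LinearMap.inr R Y F ∘ₗ w).codRestrict Z (fun s => by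
      simp [Z, hk])
    let p₁ : Z →ₗ[R] Y := LinearMap.fst R Y F ∘ₗ Z.subtype
    let p₂ : Z →ₗ[R] F := LinearMap.snd R Y F ∘ₗ Z.subtype
    have hp₁ : Function.Surjective p₁ := by
      intro y
      obtain ⟨v, hv⟩ := hs (g y)
      exact ⟨⟨(y, v), by simp [Z, hv]⟩, rfl⟩
    have hp₁i : p₁ ∘ₗ i = 0 := rfl
    have hp₂i : p₂ ∘ₗ i = w := rfl
    have hgp : g ∘ₗ p₁ = π ∘ₗ p₂ := LinearMap.ext hZ
    rcases hw.2 Z i with ⟨ρ, hρ⟩ | ⟨h, hh⟩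
    · left
      obtain ⟨l, hl⟩ := LinearMap.exists_comp_eq_of_ker_le p₁ hp₁ (p₂ - w ∘ₗ ρ) (by
        intro z hz
        have h1 : z.1.1 = 0 := hz
        have h2 : π z.1.2 = 0 := by rw [← hZ, h1, map_zero]
        rw [← LinearMap.mem_ker, hker] at h2
        obtain ⟨s, h2⟩ := h2
        have h3 : z = i s := Subtype.ext (Prod.ext h1 h2.symm)
        have h4 : ρ (i s) = s := LinearMap.congr_fun hρ s
        have h5 : p₂ (i s) = w s := rfl
        simp [h3, h4, h5])
      refine ⟨F, _, _, inferInstance, l, π, ?_⟩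
      ext y
      obtain ⟨z, rfl⟩ := hp₁ y
      have h1 : l (p₁ z) = p₂ z - w (ρ z) := LinearMap.congr_fun hl z
      rw [LinearMap.comp_apply, h1, map_sub, hk, sub_zero]
      exact (hZ z).symm
    · right
      obtain ⟨t, ht⟩ := LinearMap.exists_comp_eq_of_ker_le π hs (p₁ ∘ₗ h) (by
        rw [hker]
        rintro _ ⟨s, rfl⟩
        exact congrArg p₁ (LinearMap.congr_fun hh s))
      obtain ⟨l, hl⟩ := LinearMap.exists_comp_eq_of_ker_le π hs (p₂ ∘ₗ h - LinearMap.id) (by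
        rw [hker]
        rintro _ ⟨s, rfl⟩
        have := congrArg p₂ (LinearMap.congr_fun hh s)
        simp only [LinearMap.comp_apply] at this
        rw [LinearMap.mem_ker, LinearMap.sub_apply, LinearMap.comp_apply, this]
        exact sub_self _)
      refine ⟨t, F, _, _, inferInstance, l, π, ?_⟩
      ext x
      have h1 := LinearMap.congr_fun hl x
      have h2 := LinearMap.congr_fun ht x
      have h3 := LinearMap.congr_fun hgp (h x)
      simp only [LinearMap.comp_apply, LinearMap.sub_apply, LinearMap.id_apply] at h1 h2 h3 ⊢
      change π (l (π x)) = g (t (π x)) - π x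
      rw [h1, h2, h3, map_sub]

theorem IsLeftAlmostSplit.exists_not_stabZero {w : S →ₗ[R] F}
    (hw : IsLeftAlmostSplit w) {Y Z : Type u} [AddCommGroup Y] [Module R Y] [AddCommGroup Z]
    [Module R Z] (i : S →ₗ[R] Y) (hi : Function.Injective i)
    (hi' : ¬ ∃ ρ : Y →ₗ[R] S, ρ ∘ₗ i = LinearMap.id)
    (q : Y →ₗ[R] Z) (hq : Function.Surjective q) (hqi : LinearMap.ker q = LinearMap.range i) :
    ∃ f : (F ⧸ LinearMap.range w) →ₗ[R] Z, ¬ StabZero f := by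
  set π := (LinearMap.range w).mkQ with hπ
  have hs : Function.Surjective π := Submodule.mkQ_surjective _
  have hker : LinearMap.ker π = LinearMap.range w := Submodule.ker_mkQ _
  have hk : ∀ s, π (w s) = 0 := fun s => (Submodule.Quotient.mk_eq_zero _).2 ⟨s, rfl⟩
  have hqi0 : ∀ s, q (i s) = 0 := fun s => by
    rw [← LinearMap.mem_ker, hqi]; exact ⟨s, rfl⟩
  obtain ⟨h, hh⟩ := (hw.2 Y i).resolve_left hi'
  have hh' : ∀ s, h (w s) = i s := LinearMap.congr_fun hh
  obtain ⟨f, hf⟩ := LinearMap.exists_comp_eq_of_ker_le π hs (q ∘ₗ h) (by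
    rw [hker]
    rintro _ ⟨s, rfl⟩
    simp [hh', hqi0])
  refine ⟨f, fun h0 => hw.1 ?_⟩
  obtain ⟨l, hl⟩ := h0.exists_lift q hq
  obtain ⟨ρ, hρ⟩ := LinearMap.exists_comp_eq_of_range_le i hi (h - l ∘ₗ π) (by
    rintro _ ⟨v, rfl⟩
    rw [← hqi, LinearMap.mem_ker]
    have h1 := LinearMap.congr_fun hl (π v)
    have h2 := LinearMap.congr_fun hf v
    simp only [LinearMap.comp_apply] at h1 h2
    simp [h1, h2])
  refine ⟨ρ, LinearMap.ext fun s => hi ?_⟩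
  have := LinearMap.congr_fun hρ (w s)
  simpa [hk, hh'] using this

end AlmostSplit

section Semiprimary

variable {R : Type u} [Ring R]

theorem isSemisimpleModule_quotient_jacobson_smul [IsArtinianRing R] (Y : Type*) [AddCommGroup Y] [Module R Y] :
    IsSemisimpleModule R (Y ⧸ (Ring.jacobson R • (⊤ : Submodule R Y))) := by
  have h : Module.IsTorsionBySet R (Y ⧸ (Ring.jacobson R • (⊤ : Submodule R Y)))
      (Ring.jacobson R) := by
    rw [Module.isTorsionBySet_quotient_iff]
    exact fun m i hi ↦ Submodule.smul_mem_smul hi trivial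
  let _ := h.module
  exact (h.semilinearMap.isSemisimpleModule_iff_of_bijective Function.bijective_id).2
      inferInstance

theorem smul_eq_zero_of_mem_jacobson {X : Type*} [AddCommGroup X] [Module R X]
    [IsSemisimpleModule R X] {a : R} (ha : a ∈ Ring.jacobson R) (x : X) : a • x = 0 :=
  Module.mem_annihilator.1 (IsSemisimpleModule.jacobson_le_annihilator R X ha) x

theorem exists_retraction_of_notMem [IsArtinianRing R] {S Y : Type*} [AddCommGroup S] [Module R S]
    [IsSimpleModule R S] [AddCommGroup Y] [Module R Y] (g : S →ₗ[R] Y) (s : S)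
    (hs : g s ∉ Ring.jacobson R • (⊤ : Submodule R Y)) :
    ∃ ρ : Y →ₗ[R] S, ρ ∘ₗ g = LinearMap.id := by
  have := isSemisimpleModule_quotient_jacobson_smul (R := R) Y
  have hinj : Function.Injective ((Ring.jacobson R • (⊤ : Submodule R Y)).mkQ ∘ₗ g) := by
    refine (LinearMap.injective_or_eq_zero _).resolve_right fun h => hs ?_
    exact (Submodule.Quotient.mk_eq_zero _).1 (LinearMap.congr_fun h s)
  obtain ⟨ρ, hρ⟩ := IsSemisimpleModule.extension_property _ hinj LinearMap.id
  exact ⟨ρ ∘ₗ (Ring.jacobson R • (⊤ : Submodule R Y)).mkQ, hρ⟩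

end Semiprimary

end

section

section Isolated

theorem IsIndecomposableAlgebra.isSemisimpleRing {R : Type*} [Ring R] [IsArtinianRing R]
    (hR : IsIndecomposableAlgebra R) {e : R} (he : IsIdempotentElem e) (he0 : e ≠ 0)
    (hl : ∀ a ∈ Ring.jacobson R, a * e = 0) (hr : ∀ a ∈ Ring.jacobson R, e * a = 0) :
    IsSemisimpleRing R := by
  let I : Ideal R := Submodule.span R (Set.range fun b => e * b)
  have heI : ∀ b, e * b ∈ I := fun b => Submodule.subset_span ⟨b, rfl⟩
  have hIr : ∀ x ∈ I, ∀ r, x * r ∈ I := by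
    intro x hx r
    induction hx using Submodule.span_induction with
    | mem x hx => obtain ⟨b, rfl⟩ := hx; rw [mul_assoc]; exact heI _
    | zero => rw [zero_mul]; exact I.zero_mem
    | add x y _ _ hx hy => rw [add_mul]; exact I.add_mem hx hy
    | smul a x _ hx => rw [smul_mul_assoc]; exact I.smul_mem a hx
  have hIJ : ∀ x ∈ I, ∀ a ∈ Ring.jacobson R, x * a = 0 := by
    intro x hx a ha
    induction hx using Submodule.span_induction with
    | mem x hx =>
      obtain ⟨b, rfl⟩ := hx; rw [mul_assoc]; exact hr _ (Ideal.mul_mem_left _ _ ha)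
    | zero => rw [zero_mul]
    | add x y _ _ hx hy => rw [add_mul, hx, hy, add_zero]
    | smul r x _ hx => rw [smul_mul_assoc, hx, smul_zero]
  have hJI : ∀ a ∈ Ring.jacobson R, ∀ x ∈ I, a * x = 0 := by
    intro a ha x hx
    induction hx using Submodule.span_induction generalizing a with
    | mem x hx => obtain ⟨b, rfl⟩ := hx; rw [← mul_assoc, hl a ha, zero_mul]
    | zero => rw [mul_zero]
    | add x y _ _ hx hy => rw [mul_add, hx a ha, hy a ha, add_zero]
    | smul r x _ hx =>
      rw [smul_eq_mul, ← mul_assoc]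
      exact hx _ (Ideal.mul_mem_right _ _ ha)
  have hss : IsSemisimpleModule R I := by
    have h : Module.IsTorsionBySet R I (Ring.jacobson R) := by
      rintro x ⟨a, ha⟩
      exact Subtype.ext (hJI a ha x x.2)
    let _ := h.module
    exact (h.semilinearMap.isSemisimpleModule_iff_of_bijective Function.bijective_id).2
        inferInstance
  have hK0 : ∀ z ∈ I, (∀ x ∈ I, x * z = 0) → z = 0 := by
    let K : Submodule R I :=
      { carrier := {z | ∀ x ∈ I, x * z.1 = 0}
        add_mem' := fun {z z'} hz hz' x hx => by
          rw [Submodule.coe_add, mul_add, hz x hx, hz' x hx, add_zero]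
        zero_mem' := fun x _ => mul_zero x
        smul_mem' := fun r z hz x hx => by
          rw [Submodule.coe_smul, smul_eq_mul, ← mul_assoc]; exact hz _ (hIr x hx r) }
    obtain ⟨K', hK'⟩ := exists_isCompl K
    have htop : ∀ b, (⟨e * b, heI b⟩ : I) ∈ K' := by
      intro b
      obtain ⟨z, hz, z', hz', h⟩ := Submodule.mem_sup.1
        (hK'.sup_eq_top ▸ Submodule.mem_top : (⟨e * b, heI b⟩ : I) ∈ K ⊔ K')
      have h1 : (⟨e * b, heI b⟩ : I) = e • z' := by
        apply Subtype.ext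
        have h2 := congrArg (fun t : I => e * t.1) h
        simp only [Submodule.coe_add, mul_add] at h2
        rw [hz e (by simpa using heI 1), zero_add, ← mul_assoc, he.eq] at h2
        exact h2.symm
      rw [h1]
      exact K'.smul_mem _ hz'
    have hK'top : ∀ x (hx : x ∈ I), (⟨x, hx⟩ : I) ∈ K' := by
      intro x hx
      induction hx using Submodule.span_induction with
      | mem x hx => obtain ⟨b, rfl⟩ := hx; exact htop b
      | zero => exact K'.zero_mem
      | add x y _ _ hx hy => exact K'.add_mem hx hy
      | smul r x _ hx => exact K'.smul_mem r hx
    intro z hz hzI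
    have : (⟨z, hz⟩ : I) ∈ K ⊓ K' := ⟨hzI, hK'top z hz⟩
    rw [hK'.inf_eq_bot, Submodule.mem_bot] at this
    exact congrArg Subtype.val this
  have hJ : Ring.jacobson R • (⊤ : Submodule R R) ≤ Ring.jacobson R :=
    Ring.jacobson_smul_top_le R R
  have := isSemisimpleModule_quotient_jacobson_smul (R := R) R
  have hinj : Function.Injective
      ((Ring.jacobson R • (⊤ : Submodule R R)).mkQ ∘ₗ Submodule.subtype I) := by
    rw [injective_iff_map_eq_zero]
    rintro ⟨x, hx⟩ h
    have hxJ := hJ ((Submodule.Quotient.mk_eq_zero _).1 h)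
    exact Subtype.ext (hK0 x hx fun y hy => hIJ y hy x hxJ)
  obtain ⟨ρ, hρ⟩ := IsSemisimpleModule.extension_property _ hinj LinearMap.id
  obtain ⟨c, hc⟩ : ∃ c : I, ∀ x ∈ I, x * c.1 = x := by
    refine ⟨ρ ((Ring.jacobson R • (⊤ : Submodule R R)).mkQ 1), fun x hx => ?_⟩
    have h1 := LinearMap.congr_fun hρ ⟨x, hx⟩
    have h2 : (Ring.jacobson R • (⊤ : Submodule R R)).mkQ x =
        x • (Ring.jacobson R • (⊤ : Submodule R R)).mkQ 1 := by
      rw [← map_smul, show x • (1 : R) = x from mul_one x]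
    simp only [LinearMap.comp_apply, Submodule.subtype_apply, h2, map_smul,
      LinearMap.id_apply] at h1
    exact congrArg Subtype.val h1
  have hc' : ∀ x ∈ I, c.1 * x = x := by
    intro x hx
    rw [← sub_eq_zero]
    refine hK0 _ (I.sub_mem (hIr _ c.2 x) hx) fun y hy => ?_
    rw [mul_sub, ← mul_assoc, hc y hy, sub_self]
  have hcc : c.1 ∈ Set.center R := by
    rw [Semigroup.mem_center_iff]
    intro r
    rw [← hc' (r * c.1) (I.mul_mem_left r c.2), ← mul_assoc, hc _ (hIr _ c.2 r)]
  rcases hR.2 c.1 (hc c.1 c.2) hcc with h | h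
  · refine absurd ?_ he0
    have := hc e (by simpa using heI 1)
    rwa [h, mul_zero, eq_comm] at this
  · rw [IsArtinianRing.isSemisimpleRing_iff_jacobson, eq_bot_iff]
    intro a ha
    have := hIJ _ c.2 a ha
    rwa [h, one_mul] at this

end Isolated

section SourceMap

theorem exists_isLeftAlmostSplit (k R S : Type u) [Field k] [Ring R] [Algebra k R]
    [FiniteDimensional k R] [AddCommGroup S] [Module R S] [IsSimpleModule R S]
    [Module.Projective R S] (hR : IsIndecomposableAlgebra R) (hR' : ¬ IsSemisimpleRing R) :
    ∃ (n : ℕ) (w : S →ₗ[R] (Fin n → R)), Function.Injective w ∧ IsLeftAlmostSplit w := by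
  have : IsArtinianRing R := IsArtinianRing.of_finite k R
  have := IsSimpleModule.nontrivial R S
  obtain ⟨s₀, hs₀⟩ := exists_ne (0 : S)
  obtain ⟨σ, hσ⟩ := Module.projective_lifting_property (LinearMap.toSpanSingleton R S s₀)
    LinearMap.id (IsSimpleModule.toSpanSingleton_surjective R hs₀)
  have hσ' : ∀ s, σ s • s₀ = s := LinearMap.congr_fun hσ
  let b := Module.finBasis k ((Ring.jacobson R).restrictScalars k)
  have hb : ∀ i, (b i : R) ∈ Ring.jacobson R := fun i => (b i).2
  let w : S →ₗ[R] (Fin _ → R) :=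
    LinearMap.pi fun i => LinearMap.toSpanSingleton R R (b i : R) ∘ₗ σ
  have hw : ∀ s i, w s i = σ s * (b i : R) := fun _ _ => rfl
  refine ⟨_, w, ?_, ?_, ?_⟩
  · refine (LinearMap.injective_or_eq_zero w).resolve_right fun h0 => hR' ?_
    have h1 : ∀ a ∈ Ring.jacobson R, σ s₀ * a = 0 := by
      intro a ha
      have h2 := congrArg Subtype.val (b.sum_repr ⟨a, ha⟩)
      simp only [Submodule.coe_sum, Submodule.coe_smul] at h2
      rw [← h2, Finset.mul_sum]
      refine Finset.sum_eq_zero fun i _ => ?_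
      rw [mul_smul_comm, ← hw, h0]
      simp
    refine hR.isSemisimpleRing (e := σ s₀) ?_ ?_ (fun a ha => ?_) h1
    · rw [IsIdempotentElem, ← smul_eq_mul, ← map_smul, hσ']
    · intro h; exact hs₀ (by rw [← hσ' s₀, h, zero_smul])
    · rw [← smul_eq_mul, ← map_smul, smul_eq_zero_of_mem_jacobson ha, map_zero]
  · rintro ⟨ρ, hρ⟩
    refine hs₀ ?_
    have h1 := LinearMap.congr_fun hρ s₀
    rw [LinearMap.comp_apply, LinearMap.pi_apply_eq_sum_univ] at h1
    rw [LinearMap.id_apply] at h1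
    rw [← h1]
    refine Finset.sum_eq_zero fun i _ => ?_
    rw [hw, mul_smul, smul_eq_zero_of_mem_jacobson (hb i), smul_zero]
  · intro Y _ _ g
    by_cases h : g s₀ ∈ Ring.jacobson R • (⊤ : Submodule R Y)
    · right
      obtain ⟨y, hy⟩ : ∃ y : Fin _ → Y, g s₀ = ∑ i, (b i : R) • y i := by
        generalize g s₀ = z at h ⊢
        induction h using Submodule.smul_induction_on' with
        | smul a ha y _ =>
          refine ⟨fun i => algebraMap k R (b.repr ⟨a, ha⟩ i) • y, ?_⟩
          have h2 := congrArg Subtype.val (b.sum_repr ⟨a, ha⟩)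
          simp only [Submodule.coe_sum, Submodule.coe_smul] at h2
          conv_lhs => rw [← h2, Finset.sum_smul]
          refine Finset.sum_congr rfl fun i _ => ?_
          rw [smul_smul, ← Algebra.commutes, ← Algebra.smul_def]
        | add x _ y _ hx hy =>
          obtain ⟨x', hx⟩ := hx
          obtain ⟨y', hy⟩ := hy
          exact ⟨x' + y', by simp [hx, hy, Finset.sum_add_distrib]⟩
      refine ⟨∑ i, LinearMap.toSpanSingleton R Y (y i) ∘ₗ LinearMap.proj i, ?_⟩
      ext s
      conv_rhs => rw [← hσ' s, map_smul, hy, Finset.smul_sum]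
      simp [hw, mul_smul]
    · exact .inl (exists_retraction_of_notMem g s₀ h)

end SourceMap

end

section Presentation

variable {R K E Z : Type u} [Ring R] [IsArtinianRing R] [AddCommGroup K] [Module R K]
  [AddCommGroup E] [Module R E] [AddCommGroup Z] [Module R Z]

theorem exists_retraction_of_injective_quotient [Module.Projective R E] (j : K →ₗ[R] E)
    (h : ∀ x, j x ∈ Ring.jacobson R • (⊤ : Submodule R E) →
      x ∈ Ring.jacobson R • (⊤ : Submodule R K)) :
    ∃ r : E →ₗ[R] K, r ∘ₗ j = LinearMap.id := by
  have := isSemisimpleModule_quotient_jacobson_smul (R := R) E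
  set J := Ring.jacobson R with hJ
  have hle : J • (⊤ : Submodule R K) ≤ (J • (⊤ : Submodule R E)).comap j := by
    rw [Submodule.smul_le]
    intro a ha x _
    rw [Submodule.mem_comap, map_smul]
    exact Submodule.smul_mem_smul ha trivial
  let jb := Submodule.mapQ _ _ j hle
  have hjb : Function.Injective jb := by
    rw [injective_iff_map_eq_zero]
    intro x hx
    obtain ⟨x, rfl⟩ := Submodule.mkQ_surjective _ x
    exact (Submodule.Quotient.mk_eq_zero _).2 (h x ((Submodule.Quotient.mk_eq_zero _).1 hx))
  obtain ⟨rb, hrb⟩ := IsSemisimpleModule.extension_property jb hjb LinearMap.id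
  obtain ⟨r, hr⟩ := Module.projective_lifting_property (J • (⊤ : Submodule R K)).mkQ
    (rb ∘ₗ (J • (⊤ : Submodule R E)).mkQ) (Submodule.mkQ_surjective _)
  have hn : ∀ x, (LinearMap.id - r ∘ₗ j : K →ₗ[R] K) x ∈ J • (⊤ : Submodule R K) := by
    intro x
    rw [← (J • (⊤ : Submodule R K)).ker_mkQ, LinearMap.mem_ker]
    have h1 := LinearMap.congr_fun hr (j x)
    have h2 := LinearMap.congr_fun hrb ((J • (⊤ : Submodule R K)).mkQ x)
    simp only [LinearMap.comp_apply] at h1 h2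
    rw [LinearMap.sub_apply, map_sub, LinearMap.comp_apply, h1]
    exact sub_eq_zero.2 h2.symm
  obtain ⟨m, hm⟩ := (inferInstance : IsSemiprimaryRing R).isNilpotent
  set f : Module.End R K := LinearMap.id - r ∘ₗ j
  have hf : ∀ l : ℕ, ∀ x, (f ^ l) x ∈ J ^ l • (⊤ : Submodule R K) := by
    intro l
    induction l with
    | zero => intro x; simp [Submodule.pow_zero, Ideal.one_eq_top, Submodule.top_smul]
    | succ l ih =>
      intro x
      rw [pow_succ', Module.End.mul_apply]
      have : ∀ y ∈ J ^ l • (⊤ : Submodule R K), f y ∈ J ^ (l + 1) • (⊤ : Submodule R K) := by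
        intro y hy
        induction hy using Submodule.smul_induction_on' with
        | smul a ha y _ =>
          rw [map_smul, J.pow_succ, Submodule.mul_smul]
          exact Submodule.smul_mem_smul ha (hn y)
        | add x _ y _ hx hy => rw [map_add]; exact Submodule.add_mem _ hx hy
      exact this _ (ih x)
  have hf0 : IsNilpotent f := ⟨m, LinearMap.ext fun x => by
    have := hf m x
    rw [hm] at this
    simpa using this⟩
  obtain ⟨u, hu⟩ := hf0.isUnit_one_sub
  refine ⟨(↑u⁻¹ : Module.End R K) ∘ₗ r, ?_⟩
  have h1 : r ∘ₗ j = (u : Module.End R K) := by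
    rw [hu]
    change r ∘ₗ j = LinearMap.id - (LinearMap.id - r ∘ₗ j)
    abel
  rw [LinearMap.comp_assoc, h1]
  exact u.inv_mul

theorem exists_simple_quotient_not_extend [Module.Projective R E] (j : K →ₗ[R] E)
    (h : ¬ ∃ r : E →ₗ[R] K, r ∘ₗ j = LinearMap.id) :
    ∃ (T : Type u) (_ : AddCommGroup T) (_ : Module R T) (τ : K →ₗ[R] T),
      IsSimpleModule R T ∧ Function.Surjective τ ∧ ¬ ∃ g : E →ₗ[R] T, g ∘ₗ j = τ := by
  by_contra! H
  refine h (exists_retraction_of_injective_quotient j fun x hx => ?_)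
  have := isSemisimpleModule_quotient_jacobson_smul (R := R) K
  set V := K ⧸ Ring.jacobson R • (⊤ : Submodule R K)
  rw [← (Ring.jacobson R • (⊤ : Submodule R K)).ker_mkQ, LinearMap.mem_ker, ← Submodule.mem_bot R,
    ← IsSemisimpleModule.jacobson_eq_bot R V, Module.jacobson, Submodule.mem_sInf]
  intro p hp
  have hs : IsSimpleModule R (V ⧸ p) := isSimpleModule_iff_isCoatom.2 hp
  obtain ⟨g, hg⟩ := H (V ⧸ p) _ _ (p.mkQ ∘ₗ (Ring.jacobson R • (⊤ : Submodule R K)).mkQ) hs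
    ((Submodule.mkQ_surjective _).comp (Submodule.mkQ_surjective _))
  have h1 := LinearMap.congr_fun hg x
  rw [← p.ker_mkQ, LinearMap.mem_ker]
  refine h1.symm.trans ?_
  rw [LinearMap.comp_apply]
  generalize j x = y at hx
  induction hx using Submodule.smul_induction_on' with
  | smul a ha y _ => rw [map_smul, smul_eq_zero_of_mem_jacobson ha]
  | add x _ y _ hx hy => rw [map_add, hx, hy, add_zero]

theorem IsStablySimple.exists_simple_projective [Module.Projective R K] [Module.Projective R E]
    (hZ : IsStablySimple R Z) (j : K →ₗ[R] E) (hj : Function.Injective j) (q : E →ₗ[R] Z)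
    (hq : Function.Surjective q) (hjq : LinearMap.ker q = LinearMap.range j) :
    ∃ (T : Type u) (_ : AddCommGroup T) (_ : Module R T) (Y : Type u) (_ : AddCommGroup Y)
      (_ : Module R Y) (i : T →ₗ[R] Y) (q' : Y →ₗ[R] Z),
      IsSimpleModule R T ∧ Module.Projective R T ∧ Function.Injective i ∧
      (¬ ∃ ρ : Y →ₗ[R] T, ρ ∘ₗ i = LinearMap.id) ∧ Function.Surjective q' ∧
      LinearMap.ker q' = LinearMap.range i := by
  have hqj : ∀ x, q (j x) = 0 := fun x => by rw [← LinearMap.mem_ker, hjq]; exact ⟨x, rfl⟩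
  have hret : ¬ ∃ r : E →ₗ[R] K, r ∘ₗ j = LinearMap.id := by
    rintro ⟨r, hr⟩
    obtain ⟨s, hs⟩ := LinearMap.exists_comp_eq_of_ker_le q hq (LinearMap.id - j ∘ₗ r) (by
      rw [hjq]
      rintro _ ⟨x, rfl⟩
      have := LinearMap.congr_fun hr x
      simp only [LinearMap.comp_apply, LinearMap.id_apply] at this
      simp [this])
    refine hZ.1 ⟨E, _, _, inferInstance, s, q, ?_⟩
    ext z
    obtain ⟨e, rfl⟩ := hq z
    have := LinearMap.congr_fun hs e
    simp only [LinearMap.comp_apply] at this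
    simp [this, hqj]
  obtain ⟨T, _, _, τ, hT, hτ, hext⟩ := exists_simple_quotient_not_extend j hret
  set V := (LinearMap.ker τ).map j with hV
  set p := V.mkQ with hp
  have hps : Function.Surjective p := Submodule.mkQ_surjective _
  have hpk : ∀ e, p e = 0 ↔ ∃ x, τ x = 0 ∧ j x = e := fun e => by
    rw [hp, Submodule.mkQ_apply, Submodule.Quotient.mk_eq_zero]; rfl
  obtain ⟨i, hi⟩ := LinearMap.exists_comp_eq_of_ker_le τ hτ (p ∘ₗ j) (fun x hx =>
    (hpk _).2 ⟨x, hx, rfl⟩)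
  have hi' : ∀ x, i (τ x) = p (j x) := LinearMap.congr_fun hi
  obtain ⟨q', hq'⟩ := LinearMap.exists_comp_eq_of_ker_le p hps q (fun e he => by
    obtain ⟨x, -, rfl⟩ := (hpk e).1 he
    exact hqj x)
  have hq'p : ∀ e, q' (p e) = q e := LinearMap.congr_fun hq'
  have hinj : Function.Injective i := by
    rw [injective_iff_map_eq_zero]
    intro t ht
    obtain ⟨x, rfl⟩ := hτ t
    rw [hi', hpk] at ht
    obtain ⟨y, hy, hyx⟩ := ht
    rw [← hj hyx, hy]
  have hq's : Function.Surjective q' := fun z => by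
    obtain ⟨e, rfl⟩ := hq z
    exact ⟨p e, hq'p e⟩
  have hker : LinearMap.ker q' = LinearMap.range i := by
    ext y
    constructor
    · obtain ⟨e, rfl⟩ := hps y
      intro he
      rw [LinearMap.mem_ker, hq'p, ← LinearMap.mem_ker, hjq] at he
      obtain ⟨x, rfl⟩ := he
      exact ⟨τ x, hi' x⟩
    · rintro ⟨t, rfl⟩
      obtain ⟨x, rfl⟩ := hτ t
      rw [LinearMap.mem_ker, hi', hq'p, hqj]
  have hiret : ¬ ∃ ρ, ρ ∘ₗ i = LinearMap.id := by
    rintro ⟨ρ, hρ⟩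
    refine hext ⟨ρ ∘ₗ p, ?_⟩
    rw [LinearMap.comp_assoc, ← hi, ← LinearMap.comp_assoc, hρ, LinearMap.id_comp]
  refine ⟨T, _, _, _, _, _, i, q', hT, ?_, hinj, hiret, hq's, hker⟩
  have hns : ¬ StabSplit q' := by
    intro hsp
    obtain ⟨s, hs⟩ := hsp.exists_section hq's
    have hs' : ∀ z, q' (s z) = z := LinearMap.congr_fun hs
    obtain ⟨ρ, hρ⟩ := LinearMap.exists_comp_eq_of_range_le i hinj (LinearMap.id - s ∘ₗ q') (by
      rintro _ ⟨y, rfl⟩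
      rw [← hker]
      simp [hs'])
    refine hiret ⟨ρ, LinearMap.ext fun t => hinj ?_⟩
    have h1 := LinearMap.congr_fun hρ (i t)
    have h2 : q' (i t) = 0 := by rw [← LinearMap.mem_ker, hker]; exact ⟨t, rfl⟩
    simpa [h2] using h1
  obtain ⟨l, hl⟩ := ((hZ.2 _ q').resolve_right hns).exists_lift q hq
  have hl' : ∀ y, q (l y) = q' y := LinearMap.congr_fun hl
  obtain ⟨ρ, hρ⟩ := LinearMap.exists_comp_eq_of_range_le j hj (LinearMap.id - l ∘ₗ p) (by
    rintro _ ⟨e, rfl⟩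
    rw [← hjq]
    simp [hl', hq'p])
  have hρ' : ∀ e, j (ρ e) = e - l (p e) := LinearMap.congr_fun hρ
  obtain ⟨μ, hμ⟩ := LinearMap.exists_comp_eq_of_range_le j hj (l ∘ₗ i) (by
    rintro _ ⟨t, rfl⟩
    obtain ⟨x, rfl⟩ := hτ t
    rw [← hjq, LinearMap.mem_ker, LinearMap.comp_apply, hl', hi', hq'p, hqj])
  have hμ' : ∀ t, j (μ t) = l (i t) := LinearMap.congr_fun hμ
  have hρj : ∀ x, ρ (j x) = x - μ (τ x) := fun x => hj (by
    rw [hρ', map_sub, hμ', hi'])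
  have hτμ : τ ∘ₗ μ ≠ 0 := by
    intro h0
    have h0' : ∀ t, τ (μ t) = 0 := LinearMap.congr_fun h0
    refine hret ⟨(LinearMap.id + μ ∘ₗ τ) ∘ₗ ρ, LinearMap.ext fun x => ?_⟩
    simp [hρj, h0']
  have hb := LinearMap.bijective_of_ne_zero hτμ
  let e := LinearEquiv.ofBijective _ hb
  refine Module.Projective.of_split (μ ∘ₗ e.symm.toLinearMap) τ (LinearMap.ext fun t => ?_)
  exact e.apply_symm_apply t

end Presentation

section SimpleProjective

theorem nonempty_linearEquiv_of_not_stabZero {R S S' F F' : Type u} [Ring R]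
    [AddCommGroup S] [Module R S] [AddCommGroup S'] [Module R S'] [AddCommGroup F] [Module R F]
    [AddCommGroup F'] [Module R F'] [IsSimpleModule R S] [IsSimpleModule R S']
    [Module.Projective R F] [Module.Projective R F'] (w : S →ₗ[R] F) (w' : S' →ₗ[R] F')
    (hw' : Function.Injective w')
    (f : (F ⧸ LinearMap.range w) →ₗ[R] (F' ⧸ LinearMap.range w')) (hf : ¬ StabZero f) :
    Nonempty (S ≃ₗ[R] S') := by
  obtain ⟨φ, hφ⟩ := Module.projective_lifting_property (LinearMap.range w').mkQ
    (f ∘ₗ (LinearMap.range w).mkQ) (Submodule.mkQ_surjective _)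
  obtain ⟨ψ, hψ⟩ := LinearMap.exists_comp_eq_of_range_le w' hw' (φ ∘ₗ w) (by
    rintro _ ⟨s, rfl⟩
    rw [← (LinearMap.range w').ker_mkQ, LinearMap.mem_ker]
    have h1 : (LinearMap.range w).mkQ (w s) = 0 :=
      (Submodule.Quotient.mk_eq_zero _).2 ⟨s, rfl⟩
    refine (LinearMap.congr_fun hφ (w s)).trans ?_
    rw [LinearMap.comp_apply, h1, map_zero])
  have hψ0 : ψ ≠ 0 := by
    rintro rfl
    obtain ⟨l, hl⟩ := LinearMap.exists_comp_eq_of_ker_le (LinearMap.range w).mkQ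
      (Submodule.mkQ_surjective _) φ (by
        rw [Submodule.ker_mkQ]
        rintro _ ⟨s, rfl⟩
        exact (LinearMap.congr_fun hψ s).symm.trans (map_zero w'))
    refine hf ⟨F', _, _, inferInstance, l, (LinearMap.range w').mkQ, ?_⟩
    refine LinearMap.ext fun z => ?_
    obtain ⟨x, rfl⟩ := Submodule.mkQ_surjective _ z
    have h1 := LinearMap.congr_fun hφ x
    have h2 := LinearMap.congr_fun hl x
    simp only [LinearMap.comp_apply] at h1 h2 ⊢
    rw [h2, h1]
  exact ⟨LinearEquiv.ofBijective ψ (LinearMap.bijective_of_ne_zero hψ0)⟩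

namespace StableMoritaWitness

variable {k A B : Type u} [Field k] [Ring A] [Ring B] [Algebra k A] [Algebra k B]
  (W : StableMoritaWitness k A B)

theorem exists_simple_projective [IsArtinianRing B] {S F : Type u} [AddCommGroup S] [Module A S]
    [AddCommGroup F] [Module A F] [Module.Projective A S] [Module.Projective A F]
    (w : S →ₗ[A] F) (hi : Function.Injective w) (hw : IsLeftAlmostSplit w) :
    ∃ (T : Type u) (_ : AddCommGroup T) (_ : Module B T) (Y : Type u) (_ : AddCommGroup Y)
      (_ : Module B Y) (i : T →ₗ[B] Y)
      (q : Y →ₗ[B] RelTensor A W.N (F ⧸ LinearMap.range w)),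
      IsSimpleModule B T ∧ Module.Projective B T ∧ Function.Injective i ∧
      (¬ ∃ ρ : Y →ₗ[B] T, ρ ∘ₗ i = LinearMap.id) ∧ Function.Surjective q ∧
      LinearMap.ker q = LinearMap.range i := by
  have h1 : Module.Projective B (RelTensor A W.N S) := RelTensor.projective_of_projective
  have h2 : Module.Projective B (RelTensor A W.N F) := RelTensor.projective_of_projective
  refine (W.isStablySimple_map (hw.isStablySimple hi)).exists_simple_projective
    (RelTensor.map B W.N w) (RelTensor.map_injective hi)
    (RelTensor.map B W.N (LinearMap.range w).mkQ)
    (RelTensor.map_surjective (Submodule.mkQ_surjective _)) (le_antisymm ?_ ?_)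
  · exact RelTensor.ker_map_le_range_map (Submodule.mkQ_surjective _) (Submodule.ker_mkQ _).le
  · rw [LinearMap.range_le_ker_iff, ← RelTensor.map_comp, LinearMap.range_mkQ_comp]
    exact RelTensor.hom_ext (by simp)

theorem nonempty_linearEquiv_of_simple_projective [FiniteDimensional k B]
    (hB : IsIndecomposableAlgebra B) (hB' : ¬ IsSemisimpleRing B)
    {S S' F F' : Type u} [AddCommGroup S] [Module A S] [AddCommGroup S'] [Module A S']
    [AddCommGroup F] [Module A F] [AddCommGroup F'] [Module A F']
    [IsSimpleModule A S] [IsSimpleModule A S'] [Module.Projective A F] [Module.Projective A F']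
    {w : S →ₗ[A] F} {w' : S' →ₗ[A] F'} (hi : Function.Injective w) (hi' : Function.Injective w')
    (hw : IsLeftAlmostSplit w)
    {T Y Y' : Type u} [AddCommGroup T] [Module B T] [AddCommGroup Y] [Module B Y]
    [AddCommGroup Y'] [Module B Y'] [IsSimpleModule B T] [Module.Projective B T]
    (i : T →ₗ[B] Y) (hinj : Function.Injective i)
    (hret : ¬ ∃ ρ : Y →ₗ[B] T, ρ ∘ₗ i = LinearMap.id)
    (q : Y →ₗ[B] RelTensor A W.N (F ⧸ LinearMap.range w)) (hq : Function.Surjective q)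
    (hqi : LinearMap.ker q = LinearMap.range i)
    (i' : T →ₗ[B] Y') (hinj' : Function.Injective i')
    (hret' : ¬ ∃ ρ : Y' →ₗ[B] T, ρ ∘ₗ i' = LinearMap.id)
    (q' : Y' →ₗ[B] RelTensor A W.N (F' ⧸ LinearMap.range w')) (hq' : Function.Surjective q')
    (hqi' : LinearMap.ker q' = LinearMap.range i') :
    Nonempty (S ≃ₗ[A] S') := by
  obtain ⟨n, t, ht, hta⟩ := exists_isLeftAlmostSplit k B T hB hB'
  obtain ⟨g, hg⟩ := hta.exists_not_stabZero i hinj hret q hq hqi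
  obtain ⟨g', hg'⟩ := hta.exists_not_stabZero i' hinj' hret' q' hq' hqi'
  obtain ⟨h, hh⟩ := (hta.isStablySimple ht).exists_comp_not_stabZero
    (W.isStablySimple_map (hw.isStablySimple hi)) hg hg'
  exact nonempty_linearEquiv_of_not_stabZero w w' hi' _
    fun h0 => hh (W.stabZero_of_stabZero_prj_map_inj h0)

theorem card_projective_simple_le (W : StableMoritaWitness k A B) [FiniteDimensional k A] [FiniteDimensional k B]
    (hA : IsIndecomposableAlgebra A) (hA' : ¬ IsSemisimpleRing A)
    (hB : IsIndecomposableAlgebra B) (hB' : ¬ IsSemisimpleRing B)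
    (D : WedderburnData k A) (D' : WedderburnData k B) :
    Nat.card {i // Module.Projective A (A ⧸ D.colIdeal i)} ≤
      Nat.card {i // Module.Projective B (B ⧸ D'.colIdeal i)} := by
  have : IsArtinianRing B := IsArtinianRing.of_finite k B
  have key : ∀ i : {i // Module.Projective A (A ⧸ D.colIdeal i)},
      ∃ j : {j // Module.Projective B (B ⧸ D'.colIdeal j)},
      ∃ (n : ℕ) (w : (A ⧸ D.colIdeal i.1) →ₗ[A] (Fin n → A)) (Y : Type u) (_ : AddCommGroup Y)
        (_ : Module B Y) (f : (B ⧸ D'.colIdeal j.1) →ₗ[B] Y)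
        (q : Y →ₗ[B] RelTensor A W.N ((Fin n → A) ⧸ LinearMap.range w)),
        Function.Injective w ∧ IsLeftAlmostSplit w ∧ Function.Injective f ∧
        (¬ ∃ ρ : Y →ₗ[B] (B ⧸ D'.colIdeal j.1), ρ ∘ₗ f = LinearMap.id) ∧
        Function.Surjective q ∧ LinearMap.ker q = LinearMap.range f := by
    rintro ⟨i, hi⟩
    obtain ⟨n, w, hw, hwa⟩ := exists_isLeftAlmostSplit k A (A ⧸ D.colIdeal i) hA hA'
    obtain ⟨T, _, _, Y, _, _, f, q, hT, hT', hf, hret, hq, hqf⟩ :=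
      W.exists_simple_projective w hw hwa
    obtain ⟨j, ⟨e⟩⟩ := D'.exists_equiv_quotient_colIdeal (X := T)
    refine ⟨⟨j, Module.Projective.of_equiv e.symm⟩, n, w, Y, _, _, f ∘ₗ e.toLinearMap, q, hw, hwa,
      hf.comp e.injective, ?_, hq, ?_⟩
    · rintro ⟨ρ, hρ⟩
      refine hret ⟨e.toLinearMap ∘ₗ ρ, LinearMap.ext fun t => ?_⟩
      have h1 := LinearMap.congr_fun hρ (e.symm t)
      simp only [LinearMap.comp_apply, LinearEquiv.coe_coe, e.apply_symm_apply,
        LinearMap.id_apply] at h1 ⊢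
      rw [h1, e.apply_symm_apply]
    · rw [hqf, LinearMap.range_comp_of_range_eq_top _ e.range]
  choose j n w Y hY hY' f q hw hwa hf hret hq hqf using key
  refine Nat.card_le_card_of_injective j fun a b hab => ?_
  obtain ⟨e⟩ : Nonempty ((A ⧸ D.colIdeal a.1) ≃ₗ[A] (A ⧸ D.colIdeal b.1)) := by
    have := (j a).2
    have key : ∀ (c) (_ : j a = c) (f' : (B ⧸ D'.colIdeal c.1) →ₗ[B] Y b),
        Function.Injective f' →
        (¬ ∃ ρ : Y b →ₗ[B] (B ⧸ D'.colIdeal c.1), ρ ∘ₗ f' = LinearMap.id) →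
        LinearMap.ker (q b) = LinearMap.range f' →
        Nonempty ((A ⧸ D.colIdeal a.1) ≃ₗ[A] (A ⧸ D.colIdeal b.1)) := by
      rintro _ rfl f' h1 h2 h3
      exact W.nonempty_linearEquiv_of_simple_projective hB hB' (hw a) (hw b) (hwa a) (f a) (hf a)
        (hret a) (q a) (hq a) (hqf a) f' h1 h2 (q b) (hq b) h3
    exact key _ hab (f b) (hf b) (hret b) (hqf b)
  exact Subtype.ext (D.eq_of_equiv e)

end StableMoritaWitness

end SimpleProjective

open TensorProduct in
/-- Let `k` be an algebraically closed field of characteristic `p > 0`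
and `C_p` the cyclic group of order `p`.  If `A`, `B` are indecomposable non-semisimple
finite-dimensional `k`-algebras that are stably equivalent of Morita type, and
`A ⊗ₖ kC_p` and `B ⊗ₖ kC_p` are also stably equivalent of Morita type, then `A` and `B`
have the same number of isomorphism classes of non-projective simple modules. -/
theorem tensor_cyclic_semt_implies_auslander_reiten
    (k : Type u) [Field k] [IsAlgClosed k] (p : ℕ) (hp : 0 < p) [CharP k p]
    (A B : Type u) [Ring A] [Ring B] [Algebra k A] [Algebra k B]
    [FiniteDimensional k A] [FiniteDimensional k B]
    (hAind : IsIndecomposableAlgebra A) (hBind : IsIndecomposableAlgebra B)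
    (hAns : ¬ IsSemisimpleRing A) (hBns : ¬ IsSemisimpleRing B)
    (h : IsStablyEquivalentOfMoritaType k A B)
    (h' : IsStablyEquivalentOfMoritaType k
      (A ⊗[k] MonoidAlgebra k (Multiplicative (ZMod p)))
      (B ⊗[k] MonoidAlgebra k (Multiplicative (ZMod p)))) :
    Nonempty (NonProjSimpleClasses A ≃ NonProjSimpleClasses B) := by

  obtain ⟨D⟩ := nonempty_wedderburnData k A
  obtain ⟨D'⟩ := nonempty_wedderburnData k B
  obtain ⟨W⟩ := h
  refine nonempty_nonProjSimpleClasses_equiv_of_card_eq D D' ?_ (le_antisymm ?_ ?_)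
  · rw [← D.finrank_charFun, ← D'.finrank_charFun]
    exact finrank_charFun_eq hp ⟨W⟩ h'
  · exact W.card_projective_simple_le hAind hAns hBind hBns D D'
  · exact W.symm.card_projective_simple_le hBind hBns hAind hAns D' D
end

section
/- Let k be a field of characteristic 2 and let D₈ be the dihedral group of order 8, generated by two involutions s and t (with st of order 4). Then the group algebra kD₈ is isomorphic, as a k-algebra, to the quotient of the free associative k-algebra on two generators X, Y by the two-sided ideal generated by X², Y², and (XY)² − (YX)²; an isomorphism sends X to s + 1 and Y to t + 1. -/
/-- The defining relations of the quotient of the free algebra `k⟨X,Y⟩` by the two-sided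
ideal generated by `X²`, `Y²` and `(XY)² - (YX)²`. -/
inductive DihedralPresRel (k : Type*) [Field k] :
    FreeAlgebra k (Fin 2) → FreeAlgebra k (Fin 2) → Prop
  | Xsq : DihedralPresRel k (FreeAlgebra.ι k 0 * FreeAlgebra.ι k 0) 0
  | Ysq : DihedralPresRel k (FreeAlgebra.ι k 1 * FreeAlgebra.ι k 1) 0
  | braid : DihedralPresRel k ((FreeAlgebra.ι k 0 * FreeAlgebra.ι k 1) ^ 2)
      ((FreeAlgebra.ι k 1 * FreeAlgebra.ι k 0) ^ 2)

/-- Two involutions of `D₈` whose product has order `4` are reflections in adjacent positions. -/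
theorem DihedralGroup.exists_sr_of_orderOf_mul_eq_four {s t : DihedralGroup 4}
    (hs : s ^ 2 = 1) (ht : t ^ 2 = 1) (hst : orderOf (s * t) = 4) :
    ∃ a d : ZMod 4, s = sr a ∧ t = sr (a + d) ∧ (d = 1 ∨ d = -1) := by
  have h2 : (s * t) ^ 2 ≠ 1 := fun h ↦ by
    have := orderOf_dvd_of_pow_eq_one h
    rw [hst] at this
    omega
  clear hst
  cases s with
  | r i =>
    cases t with
    | r j => revert i j; decide
    | sr j => revert i j; decide
  | sr i =>
    cases t with
    | r j => revert i j; decide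
    | sr j => exact ⟨i, j - i, rfl, by simp, by revert i j; decide⟩

/-- A homomorphism out of a dihedral group, given by the image `R` of the rotation `r 1` and the
image `S` of an arbitrary reflection `sr a`. -/
theorem DihedralGroup.exists_monoidHom {n : ℕ} {G : Type*} [Group G] (a : ZMod n) {R S : G}
    (hR : R ^ n = 1) (hS : S * S = 1) (hSR : S * R * S = R⁻¹) :
    ∃ f : DihedralGroup n →* G, ∀ m : ℤ, f (r m) = R ^ m ∧ f (sr (a + m)) = S * R ^ m := by
  let φ : ZMod n →+ Additive G := ZMod.lift n ⟨zmultiplesHom (Additive G) (.ofMul R), by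
    simp [← ofMul_pow, hR]⟩
  let ρ : ZMod n → G := fun i ↦ (φ i).toMul
  have hρ (m : ℤ) : ρ m = R ^ m := by simp [ρ, φ]
  have hadd (i j : ZMod n) : ρ (i + j) = ρ i * ρ j := by simp [ρ]
  have hinv : S⁻¹ = S := inv_eq_of_mul_eq_one_left hS
  have hconj (i : ZMod n) : ρ i * S = S * ρ (-i) := by
    obtain ⟨m, rfl⟩ := ZMod.intCast_surjective i
    have h := conj_zpow (a := S) (b := R) (i := m)
    rw [hinv, hSR, inv_zpow] at h
    rw [← Int.cast_neg, hρ, hρ, zpow_neg, h, ← mul_assoc, ← mul_assoc, hS, one_mul]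
  refine ⟨MonoidHom.mk' (fun g ↦ match g with
    | r i => ρ i
    | sr i => S * ρ (i - a)) ?_, fun m ↦ ⟨hρ m, ?_⟩⟩
  · rintro (i | i) (j | j)
    · exact hadd i j
    · change S * ρ (j - i - a) = ρ i * (S * ρ (j - a))
      rw [← mul_assoc, hconj, mul_assoc, ← hadd]
      congr 2; ring
    · change S * ρ (i + j - a) = S * ρ (i - a) * ρ j
      rw [mul_assoc, ← hadd]
      congr 2; ring
    · change ρ (j - i) = S * ρ (i - a) * (S * ρ (j - a))
      rw [mul_assoc, ← mul_assoc (ρ _), hconj, mul_assoc, ← hadd, ← mul_assoc, hS, one_mul]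
      congr 1; ring
  · change S * ρ (a + m - a) = _
    rw [add_sub_cancel_left, hρ]

/-- The universal property of `D₈` as the Coxeter group generated by `s` and `t`. -/
theorem DihedralGroup.exists_monoidHom_of_involutions {G : Type*} [Group G]
    {s t : DihedralGroup 4} (hs : s ^ 2 = 1) (ht : t ^ 2 = 1) (hst : orderOf (s * t) = 4)
    {S T : G} (hS : S * S = 1) (hT : T * T = 1) (hST : (S * T) ^ 4 = 1) :
    ∃ f : DihedralGroup 4 →* G, f s = S ∧ f t = T := by
  have hS' : S⁻¹ = S := inv_eq_of_mul_eq_one_left hS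
  have hT' : T⁻¹ = T := inv_eq_of_mul_eq_one_left hT
  obtain ⟨a, d, rfl, rfl, rfl | rfl⟩ := exists_sr_of_orderOf_mul_eq_four hs ht hst
  · obtain ⟨f, hf⟩ := exists_monoidHom (n := 4) a (R := S * T) (S := S) hST hS
      (by rw [mul_inv_rev, hS', hT', ← mul_assoc, hS, one_mul])
    refine ⟨f, by simpa using (hf 0).2, ?_⟩
    simpa [← mul_assoc, hS] using (hf 1).2
  · obtain ⟨f, hf⟩ := exists_monoidHom (n := 4) a (R := (S * T)⁻¹) (S := S)
      (by rw [inv_pow, hST, inv_one]) hS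
      (by rw [inv_inv, mul_inv_rev, hS', hT', mul_assoc, mul_assoc, hS, mul_one])
    refine ⟨f, by simpa using (hf 0).2, ?_⟩
    simpa [← mul_assoc, hS, hS', hT'] using (hf (-1)).2

/-- Homomorphisms out of `D₈` are determined by the images of two involutions whose product has
order `4`. -/
theorem DihedralGroup.monoidHom_ext_of_involutions {M : Type*} [Monoid M]
    {s t : DihedralGroup 4} (hs : s ^ 2 = 1) (ht : t ^ 2 = 1) (hst : orderOf (s * t) = 4)
    {f g : DihedralGroup 4 →* M} (h₁ : f s = g s) (h₂ : f t = g t) : f = g := by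
  have key : ∀ x, ∃ n : Fin 4, x = (s * t) ^ (n : ℕ) ∨ x = s * (s * t) ^ (n : ℕ) := by
    obtain ⟨a, d, rfl, rfl, hd⟩ := exists_sr_of_orderOf_mul_eq_four hs ht hst
    clear hs ht hst h₁ h₂
    rintro (i | i) <;> revert a d i <;> decide
  ext x
  obtain ⟨n, rfl | rfl⟩ := key x <;> simp [h₁, h₂]

theorem add_one_mul_self_of_charTwo {A : Type*} [Ring A] [CharP A 2] {x : A} (hx : x * x = 0) :
    (x + 1) * (x + 1) = 1 := by
  have h : (x + 1) * (x + 1) = x * x + (x + x) + 1 := by noncomm_ring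
  rw [h, hx, CharTwo.add_self_eq_zero, zero_add, zero_add]

theorem add_one_mul_self_eq_zero_of_charTwo {A : Type*} [Ring A] [CharP A 2] {x : A}
    (hx : x * x = 1) : (x + 1) * (x + 1) = 0 := by
  have h : (x + 1) * (x + 1) = x * x + (x + x) + 1 := by noncomm_ring
  rw [h, hx, CharTwo.add_self_eq_zero, add_zero, CharTwo.add_self_eq_zero]

theorem mul_add_one_sq_comm_of_charTwo {A : Type*} [Ring A] [CharP A 2] {x y : A}
    (hx : x * x = 1) (hy : y * y = 1) (hxy : (x * y) ^ 2 = (y * x) ^ 2) :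
    ((x + 1) * (y + 1)) ^ 2 = ((y + 1) * (x + 1)) ^ 2 := by
  have key (u v : A) (hu : u * u = 1) (hv : v * v = 1) : ((u + 1) * (v + 1)) ^ 2 =
      (u * v) ^ 2 + (u * v * u + v * u * v) + (u + v) + (u * v + v * u) + 1 := by
    have h : ((u + 1) * (v + 1)) ^ 2 =
        (u * v) ^ 2 + (u * v * u + v * u * v) + (u * (v * v) + u * u * v) + (u * v + v * u) + 1
          + (u * u + v * v) + (u * v + u * v) + (u + u) + (v + v) := by
      noncomm_ring
    rw [h]
    simp [hu, hv, CharTwo.add_self_eq_zero]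
  rw [key x y hx hy, key y x hy hx, hxy, add_comm (x * y * x), add_comm x, add_comm (x * y)]

theorem mul_add_one_pow_four_of_charTwo {A : Type*} [Ring A] [CharP A 2] {x y : A}
    (hx : x * x = 0) (hy : y * y = 0) (hxy : (x * y) ^ 2 = (y * x) ^ 2) :
    ((x + 1) * (y + 1)) ^ 4 = 1 := by
  have hx' (z : A) : x * (x * z) = 0 := by rw [← mul_assoc, hx, zero_mul]
  have hy' (z : A) : y * (y * z) = 0 := by rw [← mul_assoc, hy, zero_mul]
  have hb : y * (x * (y * x)) = x * (y * (x * y)) := by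
    simpa [sq, mul_assoc] using hxy.symm
  have hb' (z : A) : y * (x * (y * (x * z))) = x * (y * (x * (y * z))) := by
    simpa [mul_assoc] using congrArg (· * z) hb
  have hsq : ((x + 1) * (y + 1)) ^ 2 =
      1 + (x * y + y * x + x * y * x + y * x * y + x * y * x * y) := by
    have h : ((x + 1) * (y + 1)) ^ 2 = 1 + (x * y + y * x + x * y * x + y * x * y + x * y * x * y)
        + (x + x) + (y + y) + (x * y + x * y) + x * x + y * y + x * x * y + x * y * y := by
      noncomm_ring
    rw [h]
    simp [hx, hy, mul_assoc, CharTwo.add_self_eq_zero]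
  have hsq' (u : A) : (1 + u) * (1 + u) = 1 + u * u := by
    have h : (1 + u) * (1 + u) = 1 + (u + u) + u * u := by noncomm_ring
    rw [h, CharTwo.add_self_eq_zero, add_zero]
  rw [show 4 = 2 * 2 from rfl, pow_mul, hsq, sq, hsq']
  simp [mul_add, add_mul, mul_assoc, hy, hx', hy', hb, hb', CharTwo.add_self_eq_zero]

/-- Over a field `k` of characteristic `2`, for any two involutions `s`, `t`
of the dihedral group `D₈` of order `8` with `s * t` of order `4`, the group algebra `k D₈` is
isomorphic, as a `k`-algebra, to the quotient of the free algebra `k⟨X,Y⟩` by the two-sided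
ideal generated by `X²`, `Y²`, `(XY)² - (YX)²`; an isomorphism sends `X ↦ s + 1`, `Y ↦ t + 1`. -/
theorem groupAlgebra_dihedral_presentation
    (k : Type*) [Field k] [CharP k 2] (s t : DihedralGroup 4)
    (hs : s ^ 2 = 1) (ht : t ^ 2 = 1) (hst : orderOf (s * t) = 4) :
    ∃ ψ : RingQuot (DihedralPresRel k) ≃ₐ[k] MonoidAlgebra k (DihedralGroup 4),
      ψ (RingQuot.mkAlgHom k (DihedralPresRel k) (FreeAlgebra.ι k 0)) =
          MonoidAlgebra.of k (DihedralGroup 4) s + 1 ∧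
      ψ (RingQuot.mkAlgHom k (DihedralPresRel k) (FreeAlgebra.ι k 1)) =
          MonoidAlgebra.of k (DihedralGroup 4) t + 1 := by
  have : CharP (MonoidAlgebra k (DihedralGroup 4)) 2 :=
    charP_of_injective_algebraMap (algebraMap k _).injective 2
  let e := MonoidAlgebra.of k (DihedralGroup 4)
  have hs' : e s * e s = 1 := by rw [← map_mul, ← sq, hs, map_one]
  have ht' : e t * e t = 1 := by rw [← map_mul, ← sq, ht, map_one]
  have hst' : (e s * e t) ^ 2 = (e t * e s) ^ 2 := by
    have h : (s * t) ^ 2 = (t * s) ^ 2 := by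
      have h4 : (s * t) ^ 2 * (s * t) ^ 2 = 1 := by
        rw [← pow_add]
        exact orderOf_dvd_iff_pow_eq_one.mp hst.dvd
      rw [eq_inv_of_mul_eq_one_left h4, ← inv_pow, mul_inv_rev,
        inv_eq_of_mul_eq_one_left ((sq s).symm.trans hs),
        inv_eq_of_mul_eq_one_left ((sq t).symm.trans ht)]
    simp only [← map_mul, ← map_pow, h]
  let F : RingQuot (DihedralPresRel k) →ₐ[k] MonoidAlgebra k (DihedralGroup 4) :=
    RingQuot.liftAlgHom k ⟨FreeAlgebra.lift k ![e s + 1, e t + 1], by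
      rintro _ _ (_ | _ | _)
      · simpa using add_one_mul_self_eq_zero_of_charTwo hs'
      · simpa using add_one_mul_self_eq_zero_of_charTwo ht'
      · simpa using mul_add_one_sq_comm_of_charTwo hs' ht' hst'⟩
  let q := RingQuot.mkAlgHom k (DihedralPresRel k)
  let x := q (FreeAlgebra.ι k 0)
  let y := q (FreeAlgebra.ι k 1)
  have hFx : F x = e s + 1 := by simp [F, x, q]
  have hFy : F y = e t + 1 := by simp [F, y, q]
  have : Nontrivial (RingQuot (DihedralPresRel k)) := F.toRingHom.domain_nontrivial
  have : CharP (RingQuot (DihedralPresRel k)) 2 :=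
    charP_of_injective_algebraMap (algebraMap k _).injective 2
  have hx : x * x = 0 := by
    simpa [x, q] using RingQuot.mkAlgHom_rel k (DihedralPresRel.Xsq (k := k))
  have hy : y * y = 0 := by
    simpa [y, q] using RingQuot.mkAlgHom_rel k (DihedralPresRel.Ysq (k := k))
  have hxy : (x * y) ^ 2 = (y * x) ^ 2 := by
    simpa [x, y, q] using RingQuot.mkAlgHom_rel k (DihedralPresRel.braid (k := k))
  have hS := add_one_mul_self_of_charTwo hx
  have hT := add_one_mul_self_of_charTwo hy
  obtain ⟨f, hfs, hft⟩ := DihedralGroup.exists_monoidHom_of_involutions hs ht hst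
    (S := (⟨x + 1, x + 1, hS, hS⟩ : (RingQuot (DihedralPresRel k))ˣ))
    (T := ⟨y + 1, y + 1, hT, hT⟩) (Units.ext hS) (Units.ext hT)
    (Units.ext (mul_add_one_pow_four_of_charTwo hx hy hxy))
  let H : MonoidAlgebra k (DihedralGroup 4) →ₐ[k] RingQuot (DihedralPresRel k) :=
    MonoidAlgebra.lift k _ _ ((Units.coeHom _).comp f)
  have hHs : H (e s) = x + 1 := by simp [H, e, hfs]
  have hHt : H (e t) = y + 1 := by simp [H, e, hft]
  refine ⟨AlgEquiv.ofAlgHom F H ?_ ?_, hFx, hFy⟩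
  · refine (MonoidAlgebra.lift k _ _).symm.injective
      (DihedralGroup.monoidHom_ext_of_involutions hs ht hst ?_ ?_)
    · change F (H (e s)) = e s
      rw [hHs, map_add, hFx, map_one, add_assoc, CharTwo.add_self_eq_zero, add_zero]
    · change F (H (e t)) = e t
      rw [hHt, map_add, hFy, map_one, add_assoc, CharTwo.add_self_eq_zero, add_zero]
  · refine RingQuot.ringQuot_ext' k _ _ (FreeAlgebra.hom_ext (funext fun i ↦ ?_))
    fin_cases i
    · change H (F x) = x
      rw [hFx, map_add, hHs, map_one, add_assoc, CharTwo.add_self_eq_zero, add_zero]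
    · change H (F y) = y
      rw [hFy, map_add, hHt, map_one, add_assoc, CharTwo.add_self_eq_zero, add_zero]
end

section
/- Let k be a field of characteristic 2 and let A = kD₈ be the group algebra of the dihedral group of order 8. Then the center Z(A) of A has dimension 5 over k, Z(A) is a local ring, and the Jacobson radical J of Z(A) satisfies J² = 0. -/
namespace MonoidAlgebra

variable {k G : Type*}

/-- An element of a group algebra is central iff its coefficients form a class function. -/
theorem mem_center_iff_forall_isConj [CommSemiring k] [Group G] {a : MonoidAlgebra k G} :
    a ∈ Subalgebra.center k (MonoidAlgebra k G) ↔
      ∀ g h : G, IsConj g h → a.coeff g = a.coeff h := by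
  rw [Subalgebra.mem_center_iff]
  constructor
  · intro ha g h hgh
    obtain ⟨c, rfl⟩ := isConj_iff.1 hgh
    have := congrArg (fun b ↦ b.coeff (c * g)) (ha (single c 1))
    simpa using this
  · intro ha b
    induction b using MonoidAlgebra.induction_linear with
    | zero => simp
    | add x y hx hy => rw [add_mul, mul_add, hx, hy]
    | single c r =>
      ext g
      have hconj : a.coeff (c⁻¹ * g) = a.coeff (g * c⁻¹) :=
        ha _ _ (isConj_iff.2 ⟨c, by group⟩)
      simp [hconj, mul_comm]

/-- The center of the group algebra of a finite group, as functions on the conjugacy classes. -/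
noncomputable def centerEquivConjClasses [CommSemiring k] [Group G] [Finite G] :
    Subalgebra.center k (MonoidAlgebra k G) ≃ₗ[k] (ConjClasses G → k) where
  toFun a := Quotient.lift (s := IsConj.setoid G) a.1.coeff
    (mem_center_iff_forall_isConj.1 a.2)
  map_add' a b := by ext ⟨g⟩; rfl
  map_smul' r a := by ext ⟨g⟩; rfl
  invFun f := ⟨ofCoeff (Finsupp.equivFunOnFinite.symm fun g ↦ f (ConjClasses.mk g)),
    mem_center_iff_forall_isConj.2 fun g h hgh ↦ by
      simp [ConjClasses.mk_eq_mk_iff_isConj.2 hgh]⟩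
  left_inv a := by ext g; rfl
  right_inv f := by ext ⟨g⟩; rfl

theorem finrank_center [CommRing k] [StrongRankCondition k] [Group G] [Finite G] :
    Module.finrank k (Subalgebra.center k (MonoidAlgebra k G)) = Nat.card (ConjClasses G) := by
  have := Fintype.ofFinite (ConjClasses G)
  rw [centerEquivConjClasses.finrank_eq, Module.finrank_fintype_fun_eq_card,
    Nat.card_eq_fintype_card]

/-- In characteristic two, elements invariant under translation by a central
involution multiply to zero. -/
theorem mul_eq_zero_of_coeff_mul_left_eq [CommRing k] [CharP k 2] [Group G] [Finite G]
    {z : G} (hz : ∀ g, z * g = g * z) (hz_sq : z * z = 1) (hz_ne : z ≠ 1)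
    {a b : MonoidAlgebra k G} (ha : ∀ g, a.coeff (z * g) = a.coeff g)
    (hb : ∀ g, b.coeff (z * g) = b.coeff g) : a * b = 0 := by
  have := Fintype.ofFinite G
  ext g
  rw [coeff_mul_apply_left, Finsupp.sum_fintype _ _ (by simp)]
  have hz_inv : z⁻¹ = z := inv_eq_of_mul_eq_one_left hz_sq
  refine Finset.sum_involution (fun h _ ↦ z * h) (fun h _ ↦ ?_) (fun h _ _ ↦ ?_)
    (fun _ _ ↦ Finset.mem_univ _) (fun h _ ↦ by rw [← mul_assoc, hz_sq, one_mul])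
  · rw [ha, mul_inv_rev, hz_inv, ← hz, mul_assoc, hb, CharTwo.add_self_eq_zero]
  · simpa using hz_ne

/-- The augmentation map, sending an element of a monoid algebra to the sum of its coefficients. -/
noncomputable def augmentation (k G : Type*) [CommSemiring k] [Monoid G] :
    MonoidAlgebra k G →ₐ[k] k :=
  lift k k G 1

theorem augmentation_apply [CommSemiring k] [Monoid G] [Fintype G] (a : MonoidAlgebra k G) :
    augmentation k G a = ∑ g, a.coeff g := by
  simp [augmentation, lift_apply, Finsupp.sum_fintype]

end MonoidAlgebra

section LocalAlgebra

variable {k A : Type*} [Field k] [CommRing A] [Algebra k A]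

theorem AlgHom.isLocalRing_of_ker_mul_eq_zero (f : A →ₐ[k] k)
    (hf : ∀ a b, f a = 0 → f b = 0 → a * b = 0) : IsLocalRing A := by
  have : IsLocalHom (f : A →+* k) := ⟨fun a ha ↦ by
    have hker : f (a - algebraMap k A (f a)) = 0 := by simp
    have hnil : IsNilpotent (a - algebraMap k A (f a)) :=
      ⟨2, by rw [sq]; exact hf _ _ hker hker⟩
    have hunit : IsUnit (algebraMap k A (f a)) := IsUnit.map (algebraMap k A) ha
    simpa using hnil.isUnit_add_right_of_commute hunit (Commute.all _ _)⟩
  exact RingHom.domain_isLocalRing (f : A →+* k)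

theorem AlgHom.jacobson_bot_sq_eq_bot_of_ker_mul_eq_zero (f : A →ₐ[k] k)
    (hf : ∀ a b, f a = 0 → f b = 0 → a * b = 0) :
    Ideal.jacobson (⊥ : Ideal A) ^ 2 = ⊥ := by
  have hmax : (RingHom.ker f).IsMaximal :=
    RingHom.ker_isMaximal_of_surjective f fun c ↦ ⟨algebraMap k A c, by simp⟩
  have hle : Ideal.jacobson (⊥ : Ideal A) ≤ RingHom.ker f := sInf_le ⟨bot_le, hmax⟩
  rw [eq_bot_iff, sq, Ideal.mul_le]
  exact fun a ha b hb ↦ hf a b (hle ha) (hle hb)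

end LocalAlgebra

/-- A class function on `D₈` with coefficient sum zero in characteristic two is invariant under
translation by the central rotation. -/
theorem DihedralGroup.coeff_r_two_mul_of_mem_center {k : Type*} [CommRing k] [CharP k 2]
    {a : MonoidAlgebra k (DihedralGroup 4)}
    (ha : a ∈ Subalgebra.center k (MonoidAlgebra k (DihedralGroup 4)))
    (haug : MonoidAlgebra.augmentation k (DihedralGroup 4) a = 0) (g : DihedralGroup 4) :
    a.coeff (r 2 * g) = a.coeff g := by
  rw [MonoidAlgebra.mem_center_iff_forall_isConj] at ha
  have hr : a.coeff (r 3) = a.coeff (r 1) := ha _ _ (by decide)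
  have hs0 : a.coeff (sr 2) = a.coeff (sr 0) := ha _ _ (by decide)
  have hs1 : a.coeff (sr 3) = a.coeff (sr 1) := ha _ _ (by decide)
  have hsum : a.coeff (r 0) + a.coeff (r 2) = 0 := by
    rw [MonoidAlgebra.augmentation_apply, ← equivSum.symm.sum_comp, Fintype.sum_sum_type] at haug
    change ∑ i : Fin 4, a.coeff (r i) + ∑ i : Fin 4, a.coeff (sr i) = 0 at haug
    rw [Fin.sum_univ_four, Fin.sum_univ_four] at haug
    linear_combination haug - hr - hs0 - hs1
      - (a.coeff (r 1) + a.coeff (sr 0) + a.coeff (sr 1)) * CharTwo.two_eq_zero (R := k)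
  have hz : a.coeff (r 2) = a.coeff (r 0) := (CharTwo.add_eq_zero.1 hsum).symm
  rcases g with i | i <;> fin_cases i
  exacts [hz, hr, hz.symm, hr.symm, hs0, hs1, hs0.symm, hs1.symm]

/-- Over a field `k` of characteristic `2`, the center of the group algebra
`k D₈` of the dihedral group of order `8` is `5`-dimensional, local, and its Jacobson radical
squares to zero. -/
theorem center_groupAlgebra_dihedral
    (k : Type*) [Field k] [CharP k 2] :
    Module.finrank k (Subalgebra.center k (MonoidAlgebra k (DihedralGroup 4))) = 5 ∧
    IsLocalRing (Subalgebra.center k (MonoidAlgebra k (DihedralGroup 4))) ∧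
    (Ideal.jacobson (⊥ : Ideal (Subalgebra.center k (MonoidAlgebra k (DihedralGroup 4))))) ^ 2
      = ⊥ := by
  let f := (MonoidAlgebra.augmentation k (DihedralGroup 4)).comp
    (Subalgebra.center k (MonoidAlgebra k (DihedralGroup 4))).val
  have hf : ∀ a b, f a = 0 → f b = 0 → a * b = 0 := fun a b ha hb ↦ Subtype.ext <|
    MonoidAlgebra.mul_eq_zero_of_coeff_mul_left_eq (z := DihedralGroup.r 2) (by decide)
      (by decide) (by decide) (DihedralGroup.coeff_r_two_mul_of_mem_center a.2 ha)
      (DihedralGroup.coeff_r_two_mul_of_mem_center b.2 hb)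
  refine ⟨?_, f.isLocalRing_of_ker_mul_eq_zero hf,
    f.jacobson_bot_sq_eq_bot_of_ker_mul_eq_zero hf⟩
  rw [MonoidAlgebra.finrank_center, Nat.card_eq_fintype_card]
  decide
end
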